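/- For every pair of integers 1 ≤ k < n there exists a proper injective holomorphic map F : ℂᵏ → ℂⁿ whose derivative is injective at every point, such that for every p ≥ 1 and every holomorphic map g : ℂᵖ → ℂⁿ whose range is disjoint from F(ℂᵏ), the derivative dg_z : ℂᵖ → ℂⁿ has rank strictly less than n − k at every point z ∈ ℂᵖ (i.e., the dimension of the range of the linear map dg_z is < n − k). -/

import Mathlib

noncomputable section

namespace EisenmanEmbedding

open Metric Filter Topology Set

/-! ### Cauchy estimates and limits of holomorphic maps -/

section Holomorphic

variable {V W : Type*} [NormedAddCommGroup V] [NormedSpace ℂ V]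
  [NormedAddCommGroup W] [NormedSpace ℂ W]

theorem norm_fderiv_le_of_ball {f : V → W} {x : V} {ρ M : ℝ} (hρ : 0 < ρ)
    (hd : DifferentiableOn ℂ f (ball x ρ)) (hM : ∀ z ∈ ball x ρ, ‖f z‖ ≤ M) :
    ‖fderiv ℂ f x‖ ≤ 2 * M / ρ := by
  refine Complex.norm_fderiv_le_div_of_mapsTo_ball hd (fun z hz => ?_) hρ
  rw [mem_closedBall, dist_eq_norm]
  have h1 := hM z hz
  have h2 := hM x (mem_ball_self hρ)
  have := norm_sub_le (f z) (f x)
  linarith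

theorem norm_sub_le_of_bound {f : V → W} {S : Set V} (hS : Convex ℝ S) {ρ M : ℝ} (hρ : 0 < ρ)
    (hd : ∀ x ∈ S, DifferentiableOn ℂ f (ball x ρ)) (hM : ∀ x ∈ S, ∀ z ∈ ball x ρ, ‖f z‖ ≤ M)
    {x y : V} (hx : x ∈ S) (hy : y ∈ S) : ‖f y - f x‖ ≤ 2 * M / ρ * ‖y - x‖ :=
  hS.norm_image_sub_le_of_norm_fderiv_le (𝕜 := ℂ)
    (fun z hz => (hd z hz).differentiableAt (ball_mem_nhds z hρ))
    (fun z hz => norm_fderiv_le_of_ball hρ (hd z hz) (hM z hz)) hx hy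

theorem limit_of_tendstoUniformlyOn [CompleteSpace W] {α : Type*} {l : Filter α} [l.NeBot]
    {f : α → V → W} {g : V → W} {U : Set V} (hU : IsOpen U)
    (hf : ∀ n, DifferentiableOn ℂ (f n) U) (h : TendstoUniformlyOn f g l U) {x : V} (hx : x ∈ U) :
    DifferentiableAt ℂ g x ∧ Tendsto (fun n => fderiv ℂ (f n) x) l (𝓝 (fderiv ℂ g x)) := by
  obtain ⟨δ, hδ, hball⟩ := Metric.isOpen_iff.1 hU x hx
  set ρ := δ / 2 with hρdef
  have hρ : 0 < ρ := by positivity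
  have hsub : ∀ y ∈ ball x ρ, ball y ρ ⊆ U := fun y hy => by
    refine Subset.trans (ball_subset_ball' ?_) hball
    have := mem_ball.1 hy
    linarith
  have hdat : ∀ n, ∀ y ∈ U, DifferentiableAt ℂ (f n) y := fun n y hy =>
    (hf n).differentiableAt (hU.mem_nhds hy)
  have hcau : UniformCauchySeqOn (fun n => fderiv ℂ (f n)) l (ball x ρ) := by
    intro u hu
    obtain ⟨ε, hε, hεu⟩ := Metric.mem_uniformity_dist.1 hu
    have h1 := h.uniformCauchySeqOn {p | dist p.1 p.2 < ε * ρ / 4}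
      (Metric.dist_mem_uniformity (by positivity))
    filter_upwards [h1] with m hm y hy
    apply hεu
    rw [dist_eq_norm]
    have hyU : y ∈ U := hsub y hy (mem_ball_self hρ)
    rw [← fderiv_sub (hdat _ y hyU) (hdat _ y hyU)]
    have := norm_fderiv_le_of_ball (f := f m.1 - f m.2) (x := y) (M := ε * ρ / 4) hρ
      (((hf _).mono (hsub y hy)).sub ((hf _).mono (hsub y hy))) (fun z hz => by
        have := hm z (hsub y hy hz)
        simp only [dist_eq_norm] at this
        exact this.le)
    refine this.trans_lt ?_
    have : 2 * (ε * ρ / 4) / ρ = ε / 2 := by field_simp; ring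
    rw [this]; linarith
  have hlim : ∀ y, ∃ L : V →L[ℂ] W, y ∈ ball x ρ → Tendsto (fun n => fderiv ℂ (f n) y) l (𝓝 L) := by
    intro y
    by_cases hy : y ∈ ball x ρ
    · obtain ⟨L, hL⟩ := CompleteSpace.complete (hcau.cauchy_map hy)
      exact ⟨L, fun _ => hL⟩
    · exact ⟨0, fun h => absurd h hy⟩
  choose g' hg' using hlim
  have hun : TendstoUniformlyOn (fun n => fderiv ℂ (f n)) g' l (ball x ρ) :=
    hcau.tendstoUniformlyOn_of_tendsto hg'
  have hder : HasFDerivAt g (g' x) x :=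
    hasFDerivAt_of_tendstoUniformlyOn isOpen_ball hun
      (fun n y hy => (hdat n y (hsub y hy (mem_ball_self hρ))).hasFDerivAt)
      (fun y hy => h.tendsto_at (hsub y hy (mem_ball_self hρ))) (mem_ball_self hρ)
  exact ⟨hder.differentiableAt, by rw [hder.fderiv]; exact hg' x (mem_ball_self hρ)⟩

theorem norm_fderiv_sub_le_of_close {f g : V → W} {x : V} {ρ ε : ℝ} (hρ : 0 < ρ)
    (hf : DifferentiableOn ℂ f (ball x ρ)) (hg : DifferentiableOn ℂ g (ball x ρ))
    (h : ∀ z ∈ ball x ρ, ‖f z - g z‖ ≤ ε) : ‖fderiv ℂ f x - fderiv ℂ g x‖ ≤ 2 * ε / ρ := by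
  rw [← fderiv_sub (hf.differentiableAt (ball_mem_nhds x hρ))
    (hg.differentiableAt (ball_mem_nhds x hρ))]
  exact norm_fderiv_le_of_ball hρ (hf.sub hg) h

/-- A holomorphic map with a zero at which its derivative is onto keeps a zero under small
holomorphic perturbations. -/
theorem exists_zero_of_close [CompleteSpace V] [CompleteSpace W] {H : V → W} {p : V} {R : ℝ}
    (hR : 0 < R) (hH : DifferentiableOn ℂ H (ball p R)) (h0 : H p = 0)
    (hsurj : Function.Surjective (fderiv ℂ H p)) :
    ∃ ε > 0, ∀ h : V → W, DifferentiableOn ℂ h (ball p R) →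
      (∀ z ∈ ball p R, ‖h z - H z‖ ≤ ε) → ∃ z ∈ ball p R, h z = 0 := by
  set L := fderiv ℂ H p with hL
  set S := L.nonlinearRightInverseOfSurjective (LinearMap.range_eq_top.2 hsurj) with hS
  have hSpos : 0 < S.nnnorm :=
    L.nonlinearRightInverseOfSurjective_nnnorm_pos (LinearMap.range_eq_top.2 hsurj)
  set κ : ℝ := (S.nnnorm : ℝ)⁻¹ with hκ
  have hκpos : 0 < κ := by positivity
  have hdiff : DifferentiableAt ℂ H p := hH.differentiableAt (ball_mem_nhds p hR)
  -- choose a radius on which the linearisation is good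
  have hlo := hdiff.hasFDerivAt.isLittleO.def (c := κ / 16) (by positivity)
  obtain ⟨δ, hδ, hδH⟩ := Metric.eventually_nhds_iff_ball.1 hlo
  set ρ := min δ R / 2 with hρ
  have hρpos : 0 < ρ := by positivity
  have hρδ : 2 * ρ ≤ δ := by rw [hρ]; linarith [min_le_left δ R]
  have hρR : 2 * ρ ≤ R := by rw [hρ]; linarith [min_le_right δ R]
  refine ⟨κ * ρ / 16, by positivity, fun h hh hclose => ?_⟩
  have hb : ∀ z ∈ ball p (2 * ρ), ‖h z - L (z - p)‖ ≤ κ * ρ * (3 / 16) := by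
    intro z hz
    have h1 := hclose z (ball_subset_ball hρR hz)
    have h2 := hδH z (ball_subset_ball hρδ hz)
    rw [h0, sub_zero] at h2
    have h3 : ‖z - p‖ ≤ 2 * ρ := by rw [← dist_eq_norm]; exact (mem_ball.1 hz).le
    have h4 : κ / 16 * ‖z - p‖ ≤ κ / 16 * (2 * ρ) := by gcongr
    calc ‖h z - L (z - p)‖ = ‖(h z - H z) + (H z - L (z - p))‖ := by congr 1; abel
      _ ≤ _ := norm_add_le _ _
      _ ≤ _ := by linarith
  set e : V → W := fun z => h z - L (z - p) with he
  have hed : DifferentiableOn ℂ e (ball p (2 * ρ)) := by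
    apply (hh.mono (ball_subset_ball hρR)).sub
    fun_prop
  have hsub : ∀ x ∈ ball p ρ, ball x ρ ⊆ ball p (2 * ρ) := fun x hx =>
    ball_subset_ball' (by have := mem_ball.1 hx; linarith)
  have happ : ApproximatesLinearOn h L (ball p ρ) (⟨κ / 2, by positivity⟩ : NNReal) := by
    intro x hx y hy
    have := norm_sub_le_of_bound (f := e) (convex_ball p ρ) hρpos
      (fun x hx => hed.mono (hsub x hx)) (fun x hx z hz => hb z (hsub x hx hz)) hy hx
    have h2 : e x - e y = h x - h y - L (x - y) := by
      simp only [he, map_sub]; abel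
    rw [h2] at this
    refine this.trans ?_
    have : 2 * (κ * ρ * (3 / 16)) / ρ = κ * (3 / 8) := by field_simp; ring
    rw [this]
    apply mul_le_mul_of_nonneg_right _ (norm_nonneg _)
    change _ ≤ κ / 2
    linarith
  have hs := happ.surjOn_closedBall_of_nonlinearRightInverse S (ε := ρ * (7 / 8)) (b := p)
    (by positivity) (closedBall_subset_ball (by linarith))
  have hmem : (0 : W) ∈ closedBall (h p) (((S.nnnorm : ℝ)⁻¹ -
      ((⟨κ / 2, by positivity⟩ : NNReal) : ℝ)) * (ρ * (7 / 8))) := by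
    rw [mem_closedBall, dist_comm, dist_zero_right]
    have := hb p (mem_ball_self (by positivity))
    rw [sub_self, map_zero, sub_zero] at this
    refine this.trans ?_
    change κ * ρ * (3 / 16) ≤ (κ - κ / 2) * (ρ * (7 / 8))
    nlinarith [mul_pos hκpos hρpos]
  obtain ⟨z, hz, hz0⟩ := hs hmem
  refine ⟨z, ?_, hz0⟩
  have := mem_closedBall.1 hz
  rw [mem_ball]
  linarith

end Holomorphic

section Density

variable {V W : Type*} [NormedAddCommGroup V] [NormedSpace ℂ V]
  [NormedAddCommGroup W] [NormedSpace ℂ W]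

/-- The identity theorem: a holomorphic function on a convex open set which is nonzero somewhere is
nonzero somewhere on every nonempty open subset. -/
theorem exists_ne_zero_of_open {f : V → ℂ} {U : Set V} (hU : IsOpen U) (hc : Convex ℝ U)
    (hf : DifferentiableOn ℂ f U) {p : V} (hp : p ∈ U) (hfp : f p ≠ 0) {O : Set V} (hO : IsOpen O)
    (hOU : O ⊆ U) (hne : O.Nonempty) : ∃ z ∈ O, f z ≠ 0 := by
  obtain ⟨w, hw⟩ := hne
  by_contra! hcon
  set ℓ : ℂ → V := fun t => w + t • (p - w) with hℓ
  have hℓd : Differentiable ℂ ℓ := by fun_prop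
  have hTo : IsOpen (ℓ ⁻¹' U) := hU.preimage hℓd.continuous
  have hTc : Convex ℝ (ℓ ⁻¹' U) := by
    intro a ha b hb s t hs ht hst
    have : ℓ (s • a + t • b) = s • ℓ a + t • ℓ b := by
      have h1 : w = s • w + t • w := by rw [← add_smul, hst, one_smul]
      simp only [hℓ, smul_add, add_smul, smul_assoc]
      nth_rewrite 1 [h1]
      abel
    rw [mem_preimage, this]
    exact hc ha hb hs ht hst
  have han : AnalyticOnNhd ℂ (f ∘ ℓ) (ℓ ⁻¹' U) :=
    (hf.comp hℓd.differentiableOn (fun _ h => h)).analyticOnNhd hTo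
  have h0 : (0 : ℂ) ∈ ℓ ⁻¹' U := by simpa [hℓ] using hOU hw
  have h1 : (1 : ℂ) ∈ ℓ ⁻¹' U := by simpa [hℓ] using hp
  have hev : (f ∘ ℓ) =ᶠ[𝓝 0] (fun _ => 0) := by
    have : ℓ ⁻¹' O ∈ 𝓝 (0 : ℂ) := (hO.preimage hℓd.continuous).mem_nhds (by simpa [hℓ] using hw)
    filter_upwards [this] with t ht using hcon _ ht
  have := han.eqOn_of_preconnected_of_eventuallyEq analyticOnNhd_const hTc.isPreconnected h0 hev h1
  simp [hℓ] at this
  exact hfp this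

theorem norm_taylor_one_le {φ : ℂ → W} [CompleteSpace W] {M : ℝ}
    (hφ : DifferentiableOn ℂ φ (ball 0 3))
    (hM : ∀ s ∈ ball (0 : ℂ) 3, ‖φ s‖ ≤ M) {h : ℂ} (hh : ‖h‖ < 1) :
    ‖φ h - φ 0 - h • deriv φ 0‖ ≤ 8 * M * ‖h‖ ^ 2 := by
  have hM0 : 0 ≤ M := (norm_nonneg _).trans (hM 0 (by simp))
  have hd : DifferentiableOn ℂ (deriv φ) (ball 0 3) := hφ.deriv isOpen_ball
  have hb : ∀ s ∈ ball (0 : ℂ) 2, ‖deriv φ s‖ ≤ 2 * M := by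
    intro s hs
    have hsub : ball s 1 ⊆ ball (0 : ℂ) 3 := ball_subset_ball' (by have := mem_ball.1 hs; linarith)
    have := norm_fderiv_le_of_ball (x := s) one_pos (hφ.mono hsub) (fun z hz => hM z (hsub hz))
    rw [← norm_deriv_eq_norm_fderiv] at this
    simpa using this
  have hl : ∀ s ∈ ball (0 : ℂ) 1, ‖deriv φ s - deriv φ 0‖ ≤ 4 * M * ‖s‖ := by
    intro s hs
    have hsub : ∀ x ∈ ball (0 : ℂ) 1, ball x 1 ⊆ ball (0 : ℂ) 2 := fun x hx =>
      ball_subset_ball' (by have := mem_ball.1 hx; linarith)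
    have := norm_sub_le_of_bound (convex_ball (0 : ℂ) 1) one_pos
      (fun x hx => hd.mono ((hsub x hx).trans (ball_subset_ball (by norm_num))))
      (fun x hx z hz => hb z (hsub x hx hz)) (mem_ball_self one_pos) hs
    rw [sub_zero] at this
    linarith
  have hconv : Convex ℝ (closedBall (0 : ℂ) ‖h‖) := convex_closedBall _ _
  have hda : ∀ s ∈ closedBall (0 : ℂ) ‖h‖, DifferentiableAt ℂ φ s := fun s hs =>
    hφ.differentiableAt (isOpen_ball.mem_nhds (by
      rw [mem_ball]; have := mem_closedBall.1 hs; linarith))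
  have key := hconv.norm_image_sub_le_of_norm_deriv_le (𝕜 := ℂ)
    (f := fun s => φ s - s • deriv φ 0) (C := 4 * M * ‖h‖) (x := 0) (y := h)
    (fun s hs => (hda s hs).sub (by fun_prop)) (fun s hs => by
      have e : deriv (fun s => φ s - s • deriv φ 0) s = deriv φ s - deriv φ 0 := by
        have h1 := ((hda s hs).hasDerivAt.sub ((hasDerivAt_id s).smul_const (deriv φ 0))).deriv
        rw [one_smul] at h1
        exact h1
      rw [e]
      have hs' : ‖s‖ ≤ ‖h‖ := by simpa using mem_closedBall.1 hs
      refine (hl s (by simpa using hs'.trans_lt hh)).trans ?_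
      gcongr) (by simp) (by simp)
  simp only [zero_smul, sub_zero] at key
  have e2 : φ h - φ 0 - h • deriv φ 0 = φ h - h • deriv φ 0 - φ 0 := by abel
  rw [e2]
  nlinarith [sq_nonneg ‖h‖, norm_nonneg h]

theorem differentiableAt_fderiv_apply [CompleteSpace W] {G : V → W} {U : Set V} (hU : IsOpen U)
    (hG : DifferentiableOn ℂ G U) {x : V} (hx : x ∈ U) (v : V) :
    DifferentiableAt ℂ (fun z => fderiv ℂ G z v) x := by
  -- a ball on which `G` is bounded
  have hcont : ContinuousAt G x := (hG.differentiableAt (hU.mem_nhds hx)).continuousAt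
  obtain ⟨δ, hδ, hδU⟩ := Metric.mem_nhds_iff.1
    (inter_mem (hU.mem_nhds hx) (hcont (ball_mem_nhds (G x) one_pos)))
  set M := ‖G x‖ + 1
  have hM : ∀ z ∈ ball x δ, ‖G z‖ ≤ M := fun z hz => by
    have h1 := (hδU hz).2
    rw [mem_preimage, mem_ball, dist_eq_norm] at h1
    have := norm_le_insert' (G z) (G x)
    linarith
  set c : ℝ := δ / (8 * (‖v‖ + 1)) with hc
  have hcpos : 0 < c := by positivity
  set v' : V := (c : ℂ) • v with hv'
  have hv'n : ‖v'‖ ≤ δ / 8 := by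
    rw [hv', norm_smul, Complex.norm_real, Real.norm_of_nonneg hcpos.le, hc, div_mul_eq_mul_div,
      div_le_div_iff₀ (by positivity) (by positivity)]
    nlinarith [norm_nonneg v]
  have hmain : DifferentiableAt ℂ (fun z => fderiv ℂ G z v') x := by
    set hn : ℕ → ℂ := fun n => ((1 / ((n : ℝ) + 2) : ℝ) : ℂ) with hhn
    have hnn : ∀ n, ‖hn n‖ = 1 / ((n : ℝ) + 2) := fun n => by
      rw [hhn, Complex.norm_real, Real.norm_of_nonneg (by positivity)]
    have hn1 : ∀ n, ‖hn n‖ < 1 := fun n => by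
      rw [hnn, div_lt_one (by positivity)]
      have : (0 : ℝ) ≤ n := Nat.cast_nonneg n
      linarith
    have hn0 : ∀ n, hn n ≠ 0 := fun n => by
      rw [← norm_ne_zero_iff, hnn]; positivity
    have hsub : ∀ z ∈ ball x (δ / 2), ∀ s ∈ ball (0 : ℂ) 3, z + s • v' ∈ ball x δ := by
      intro z hz s hs
      rw [mem_ball, dist_eq_norm] at hz ⊢
      have h1 : ‖s • v'‖ ≤ 3 * (δ / 8) := by
        rw [norm_smul]
        have : ‖s‖ ≤ 3 := by simpa using (mem_ball.1 hs).le
        gcongr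
      calc ‖z + s • v' - x‖ = ‖(z - x) + s • v'‖ := by congr 1; abel
        _ ≤ _ := norm_add_le _ _
        _ < δ := by linarith
    have hφ : ∀ z ∈ ball x (δ / 2), ∀ n,
        ‖(hn n)⁻¹ • (G (z + hn n • v') - G z) - fderiv ℂ G z v'‖ ≤ 8 * M * ‖hn n‖ := by
      intro z hz n
      have hzU : z ∈ U := (hδU (ball_subset_ball (by linarith) hz)).1
      have hder : HasDerivAt (fun s : ℂ => G (z + s • v')) (fderiv ℂ G z v') 0 := by
        have h1 : HasFDerivAt G (fderiv ℂ G z) (z + (0 : ℂ) • v') := by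
          rw [zero_smul, add_zero]
          exact (hG.differentiableAt (hU.mem_nhds hzU)).hasFDerivAt
        have h2 : HasDerivAt (fun s : ℂ => z + s • v') v' 0 := by
          simpa using ((hasDerivAt_id (0 : ℂ)).smul_const v').const_add z
        exact h1.comp_hasDerivAt _ h2
      have h3 := norm_taylor_one_le (φ := fun s : ℂ => G (z + s • v')) (M := M)
        (hG.comp (by fun_prop) (fun s hs => (hδU (hsub z hz s hs)).1))
        (fun s hs => hM _ (hsub z hz s hs)) (hn1 n)
      rw [hder.deriv] at h3
      simp only [zero_smul, add_zero] at h3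
      have e : (hn n)⁻¹ • (G (z + hn n • v') - G z) - fderiv ℂ G z v' =
          (hn n)⁻¹ • (G (z + hn n • v') - G z - hn n • fderiv ℂ G z v') := by
        rw [smul_sub _ _ (hn n • fderiv ℂ G z v'), inv_smul_smul₀ (hn0 n)]
      rw [e, norm_smul, norm_inv]
      have hp : 0 < ‖hn n‖ := norm_pos_iff.2 (hn0 n)
      rw [inv_mul_le_iff₀ hp]
      nlinarith
    have hM0 : 0 ≤ M := by positivity
    refine (limit_of_tendstoUniformlyOn (l := atTop) (U := ball x (δ / 2))
      (f := fun n z => (hn n)⁻¹ • (G (z + hn n • v') - G z)) isOpen_ball ?_ ?_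
      (mem_ball_self (by positivity))).1
    · intro n
      apply DifferentiableOn.const_smul
      apply DifferentiableOn.sub
      · refine hG.comp (by fun_prop) (fun z hz => (hδU (hsub z hz _ ?_)).1)
        simpa using (hn1 n).trans (by norm_num)
      · exact hG.mono (fun z hz => (hδU (ball_subset_ball (by linarith) hz)).1)
    · rw [Metric.tendstoUniformlyOn_iff]
      intro ε hε
      have ht : Tendsto (fun n : ℕ => 8 * M * ‖hn n‖) atTop (𝓝 0) := by
        simp_rw [hnn]
        have := (tendsto_const_div_atTop_nhds_zero_nat (1 : ℝ)).comp (tendsto_add_atTop_nat 2)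
        have := this.const_mul (8 * M)
        rw [mul_zero] at this
        refine this.congr fun n => ?_
        simp
      filter_upwards [ht.eventually (gt_mem_nhds hε)] with n hn' z hz
      rw [dist_comm, dist_eq_norm]
      exact (hφ z hz n).trans_lt hn'
  have e : (fun z => fderiv ℂ G z v) = fun z => (c : ℂ)⁻¹ • fderiv ℂ G z v' := by
    ext z
    rw [hv', map_smul, smul_smul, inv_mul_cancel₀ (by exact_mod_cast hcpos.ne'), one_smul]
  rw [e]
  exact hmain.const_smul _

end Density

section Jacobian

variable {κ : Type*} [Fintype κ]

theorem bijective_iff_det_ne_zero (L : (κ → ℂ) →L[ℂ] (κ → ℂ)) :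
    Function.Bijective L ↔ L.det ≠ 0 := by
  rw [ContinuousLinearMap.det, ← isUnit_iff_ne_zero, ← LinearMap.isUnit_iff_isUnit_det,
    Module.End.isUnit_iff]
  rfl

theorem exists_bijective_of_close {L : (κ → ℂ) →L[ℂ] (κ → ℂ)} (hL : Function.Bijective L) :
    ∃ δ > 0, ∀ T : (κ → ℂ) →L[ℂ] (κ → ℂ), ‖T - L‖ ≤ δ → Function.Bijective T := by
  have hc : Continuous fun T : (κ → ℂ) →L[ℂ] (κ → ℂ) => T.det := ContinuousLinearMap.continuous_det
  have ho : {T : (κ → ℂ) →L[ℂ] (κ → ℂ) | T.det ≠ 0} ∈ 𝓝 L :=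
    (isOpen_ne_fun hc continuous_const).mem_nhds ((bijective_iff_det_ne_zero L).1 hL)
  obtain ⟨δ, hδ, h⟩ := Metric.mem_nhds_iff.1 ho
  refine ⟨δ / 2, by positivity, fun T hT => (bijective_iff_det_ne_zero T).2 (h ?_)⟩
  rw [mem_ball, dist_eq_norm]
  linarith

theorem exists_bijective_fderiv_of_open [DecidableEq κ] {G : (κ → ℂ) → (κ → ℂ)} {U : Set (κ → ℂ)}
    (hU : IsOpen U) (hc : Convex ℝ U) (hG : DifferentiableOn ℂ G U) {p : κ → ℂ} (hp : p ∈ U)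
    (hbij : Function.Bijective (fderiv ℂ G p)) {O : Set (κ → ℂ)} (hO : IsOpen O) (hOU : O ⊆ U)
    (hne : O.Nonempty) : ∃ z ∈ O, Function.Bijective (fderiv ℂ G z) := by
  simp_rw [bijective_iff_det_ne_zero] at hbij ⊢
  refine exists_ne_zero_of_open (f := fun z => (fderiv ℂ G z).det) hU hc ?_ hp hbij hO hOU hne
  have e : (fun z => (fderiv ℂ G z).det) = fun z =>
      ∑ σ : Equiv.Perm κ, ((Equiv.Perm.sign σ : ℤ) : ℂ) *
        ∏ i, fderiv ℂ G z (Pi.single i 1) (σ i) := by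
    ext z
    rw [ContinuousLinearMap.det, ← LinearMap.det_toMatrix', Matrix.det_apply']
    rfl
  rw [e]
  intro x hx
  apply DifferentiableAt.differentiableWithinAt
  refine DifferentiableAt.fun_sum fun σ _ => DifferentiableAt.const_mul ?_ _
  have h : ∀ i, DifferentiableAt ℂ (fun z => fderiv ℂ G z (Pi.single i 1) (σ i)) x := fun i =>
    differentiableAt_pi.1 (differentiableAt_fderiv_apply hU hG hx (Pi.single i 1)) (σ i)
  exact (HasFDerivAt.finsetProd (u := Finset.univ)
    (fun i _ => (h i).hasFDerivAt)).differentiableAt.congr_of_eventuallyEq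
      (Eventually.of_forall fun z => by simp)

end Jacobian

section Montel

variable {V W : Type*} [NormedAddCommGroup V] [NormedSpace ℂ V] [ProperSpace V]
  [NormedAddCommGroup W] [NormedSpace ℂ W] [ProperSpace W]

theorem exists_subseq_tendstoUniformlyOn {g : ℕ → V → W} {R R' M : ℝ} (hR : R' < R)
    (hg : ∀ N, DifferentiableOn ℂ (g N) (ball 0 R)) (hM : ∀ N, ∀ z ∈ ball 0 R, ‖g N z‖ ≤ M) :
    ∃ φ : ℕ → ℕ, StrictMono φ ∧ ∃ G : V → W,
      TendstoUniformlyOn (fun N => g (φ N)) G atTop (closedBall 0 R') := by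
  set K := closedBall (0 : V) R'
  have : CompactSpace K := isCompact_iff_compactSpace.1 (isCompact_closedBall _ _)
  set ρ := R - R' with hρ
  have hρpos : 0 < ρ := by rw [hρ]; linarith
  have hsub : ∀ x ∈ K, ball x ρ ⊆ ball 0 R := fun x hx =>
    ball_subset_ball' (by have := mem_closedBall.1 hx; rw [hρ]; linarith)
  have hlip : ∀ N, ∀ x ∈ K, ∀ y ∈ K, ‖g N y - g N x‖ ≤ 2 * M / ρ * ‖y - x‖ := fun N x hx y hy =>
    norm_sub_le_of_bound (convex_closedBall _ _) hρpos (fun x hx => (hg N).mono (hsub x hx))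
      (fun x hx z hz => hM N z (hsub x hx hz)) hx hy
  have hcont : ∀ N, Continuous fun x : K => g N x := fun N => by
    exact continuousOn_iff_continuous_domRestrict.1
      ((hg N).continuousOn.mono (fun x hx => hsub x hx (mem_ball_self hρpos)))
  set f : ℕ → BoundedContinuousFunction K W := fun N =>
    BoundedContinuousFunction.mkOfCompact ⟨_, hcont N⟩ with hf
  have hcomp := BoundedContinuousFunction.arzela_ascoli (closedBall (0 : W) M)
    (isCompact_closedBall _ _) (range f) (by
      rintro _ x ⟨N, rfl⟩
      simpa [hf] using hM N x (hsub x x.2 (mem_ball_self hρpos))) (by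
      intro x
      rw [Metric.equicontinuousAt_iff_right]
      intro ε hε
      set C := |2 * M / ρ| + 1
      filter_upwards [ball_mem_nhds x (show 0 < ε / C by positivity)] with y hy
      rintro ⟨_, N, rfl⟩
      rw [dist_eq_norm]
      change ‖g N x - g N y‖ < ε
      refine (hlip N y y.2 x x.2).trans_lt ?_
      rw [mem_ball, Subtype.dist_eq, dist_comm, dist_eq_norm, lt_div_iff₀ (by positivity)] at hy
      refine lt_of_le_of_lt ?_ hy
      rw [mul_comm]
      gcongr
      exact (le_abs_self _).trans (by simp [C]))
  obtain ⟨F, -, φ, hφ, hlim⟩ := hcomp.tendsto_subseq (x := f) (fun N => subset_closure ⟨N, rfl⟩)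
  classical
  refine ⟨φ, hφ, fun x => if h : x ∈ K then F ⟨x, h⟩ else 0, ?_⟩
  have h1 := BoundedContinuousFunction.tendsto_iff_tendstoUniformly.1 hlim
  rw [Metric.tendstoUniformly_iff] at h1
  rw [Metric.tendstoUniformlyOn_iff]
  intro ε hε
  filter_upwards [h1 ε hε] with N hN x hx
  rw [dif_pos hx]
  exact hN ⟨x, hx⟩

end Montel

/-! ### Entire functions that are limits of exponential sums -/

section EntireFunctions

variable {ι : Type*} [Fintype ι]

/-- The exponential `w ↦ exp (l w)` of a linear functional. -/
def expFun (l : (ι → ℂ) →L[ℂ] ℂ) : C(ι → ℂ, ℂ) := ⟨fun w => Complex.exp (l w), by fun_prop⟩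

variable (ι) in
/-- The algebra of finite sums of exponentials of linear functionals. -/
def expAlg : Subalgebra ℂ C(ι → ℂ, ℂ) := Algebra.adjoin ℂ (range expFun)

/-- Locally uniform limits of exponential sums. -/
def Ent (f : (ι → ℂ) → ℂ) : Prop := ∃ F ∈ (expAlg ι).topologicalClosure, ⇑F = f

theorem Ent.continuous {f : (ι → ℂ) → ℂ} (hf : Ent f) : Continuous f := by
  obtain ⟨F, -, rfl⟩ := hf
  exact F.continuous

theorem Ent.exists_approx {f : (ι → ℂ) → ℂ} (hf : Ent f) (R : ℝ) {ε : ℝ} (hε : 0 < ε) :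
    ∃ g ∈ expAlg ι, ∀ w, ‖w‖ ≤ R → ‖g w - f w‖ ≤ ε := by
  obtain ⟨F, hF, rfl⟩ := hf
  have h1 : F ∈ closure (expAlg ι : Set C(ι → ℂ, ℂ)) := hF
  have h2 := mem_closure_iff_nhdsWithin_neBot.1 h1
  have h3 : Tendsto id (𝓝[(expAlg ι : Set C(ι → ℂ, ℂ))] F) (𝓝 F) := tendsto_id.mono_left inf_le_left
  have h4 := Metric.tendstoUniformlyOn_iff.1
    (ContinuousMap.tendsto_iff_forall_isCompact_tendstoUniformlyOn.1 h3 (closedBall 0 R)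
      (isCompact_closedBall _ _)) ε hε
  obtain ⟨g, hg, hgm⟩ := (h4.and self_mem_nhdsWithin).exists
  refine ⟨g, hgm, fun w hw => ?_⟩
  have := hg w (by simpa using hw)
  rw [dist_comm, dist_eq_norm] at this
  exact this.le

theorem Ent.of_approx {f : (ι → ℂ) → ℂ} (hc : Continuous f)
    (h : ∀ R : ℝ, ∀ ε > 0, ∃ g, Ent g ∧ ∀ w, ‖w‖ ≤ R → ‖g w - f w‖ ≤ ε) : Ent f := by
  have h' : ∀ n : ℕ, ∃ g ∈ (expAlg ι).topologicalClosure,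
      ∀ w, ‖w‖ ≤ (n : ℝ) → ‖g w - f w‖ ≤ 1 / ((n : ℝ) + 1) := fun n => by
    obtain ⟨_, ⟨g, hg, rfl⟩, hgf⟩ := h n (1 / ((n : ℝ) + 1)) (by positivity)
    exact ⟨g, hg, hgf⟩
  choose g hg hgf using h'
  refine ⟨⟨f, hc⟩, ?_, rfl⟩
  refine (Subalgebra.isClosed_topologicalClosure (expAlg ι)).mem_of_tendsto
    (f := g) (b := atTop) ?_ (Eventually.of_forall hg)
  rw [ContinuousMap.tendsto_iff_forall_isCompact_tendstoUniformlyOn]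
  intro K hK
  obtain ⟨R, hR⟩ := hK.isBounded.exists_norm_le
  rw [Metric.tendstoUniformlyOn_iff]
  intro ε hε
  filter_upwards [eventually_ge_atTop ⌈R⌉₊,
    tendsto_one_div_add_atTop_nhds_zero_nat.eventually (gt_mem_nhds hε)] with n hn hn2 w hw
  rw [dist_comm, dist_eq_norm]
  exact (hgf n w ((hR w hw).trans (Nat.ceil_le.1 hn))).trans_lt hn2

theorem Ent.const (c : ℂ) : Ent (fun _ : ι → ℂ => c) :=
  ⟨algebraMap ℂ _ c, Subalgebra.algebraMap_mem _ c, rfl⟩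

theorem Ent.add {f g : (ι → ℂ) → ℂ} (hf : Ent f) (hg : Ent g) : Ent (fun w => f w + g w) := by
  obtain ⟨F, hF, rfl⟩ := hf
  obtain ⟨G, hG, rfl⟩ := hg
  exact ⟨F + G, add_mem hF hG, rfl⟩

theorem Ent.sub {f g : (ι → ℂ) → ℂ} (hf : Ent f) (hg : Ent g) : Ent (fun w => f w - g w) := by
  obtain ⟨F, hF, rfl⟩ := hf
  obtain ⟨G, hG, rfl⟩ := hg
  exact ⟨F - G, sub_mem hF hG, rfl⟩

theorem Ent.mul {f g : (ι → ℂ) → ℂ} (hf : Ent f) (hg : Ent g) : Ent (fun w => f w * g w) := by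
  obtain ⟨F, hF, rfl⟩ := hf
  obtain ⟨G, hG, rfl⟩ := hg
  exact ⟨F * G, mul_mem hF hG, rfl⟩

theorem Ent.pow {f : (ι → ℂ) → ℂ} (hf : Ent f) (n : ℕ) : Ent (fun w => f w ^ n) := by
  obtain ⟨F, hF, rfl⟩ := hf
  exact ⟨F ^ n, pow_mem hF n, rfl⟩

theorem Ent.sum {α : Type*} (s : Finset α) {f : α → (ι → ℂ) → ℂ} (hf : ∀ i ∈ s, Ent (f i)) :
    Ent (fun w => ∑ i ∈ s, f i w) := by
  classical
  induction s using Finset.induction_on with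
  | empty => simpa using Ent.const 0
  | insert a s ha ih =>
    simp_rw [Finset.sum_insert ha]
    exact (hf a (by simp)).add (ih fun i hi => hf i (by simp [hi]))

theorem Ent.prod {α : Type*} (s : Finset α) {f : α → (ι → ℂ) → ℂ} (hf : ∀ i ∈ s, Ent (f i)) :
    Ent (fun w => ∏ i ∈ s, f i w) := by
  classical
  induction s using Finset.induction_on with
  | empty => simpa using Ent.const 1
  | insert a s ha ih =>
    simp_rw [Finset.prod_insert ha]
    exact (hf a (by simp)).mul (ih fun i hi => hf i (by simp [hi]))

theorem Ent.exp_linear (l : (ι → ℂ) →L[ℂ] ℂ) : Ent (fun w => Complex.exp (l w)) :=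
  ⟨expFun l, Subalgebra.le_topologicalClosure _ (Algebra.subset_adjoin ⟨l, rfl⟩), rfl⟩

theorem norm_exp_sub_one_sub_le {z : ℂ} (hz : ‖z‖ ≤ 1) : ‖Complex.exp z - 1 - z‖ ≤ ‖z‖ ^ 2 :=
  Complex.norm_exp_sub_one_sub_id_le hz

theorem Ent.linear (l : (ι → ℂ) →L[ℂ] ℂ) : Ent (fun w => l w) := by
  refine Ent.of_approx l.continuous fun R ε hε => ?_
  set B := ‖l‖ * |R| + 1 with hB
  have hBpos : 0 < B := by positivity
  set h : ℝ := min (1 / B) (ε / B ^ 2) with hh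
  have hpos : 0 < h := by positivity
  have hhn : ‖(h : ℂ)‖ = h := by rw [Complex.norm_real, Real.norm_of_nonneg hpos.le]
  have hh0 : (h : ℂ) ≠ 0 := by exact_mod_cast hpos.ne'
  refine ⟨fun w => (h : ℂ)⁻¹ * (Complex.exp (((h : ℂ) • l) w) - 1),
    (Ent.const _).mul ((Ent.exp_linear _).sub (Ent.const 1)), fun w hw => ?_⟩
  have hlw : ‖l w‖ ≤ B := by
    have := l.le_opNorm w
    have : ‖l‖ * ‖w‖ ≤ ‖l‖ * |R| := by gcongr; exact hw.trans (le_abs_self R)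
    linarith
  have h1 : ‖(h : ℂ) * l w‖ ≤ h * B := by
    rw [norm_mul, hhn]; gcongr
  have h2 : h * B ≤ 1 := by
    have : h ≤ 1 / B := min_le_left _ _
    rwa [le_div_iff₀ hBpos] at this
  have h3 : h * B ^ 2 ≤ ε := by
    have : h ≤ ε / B ^ 2 := min_le_right _ _
    rwa [le_div_iff₀ (by positivity)] at this
  have h4 := norm_exp_sub_one_sub_le (h1.trans h2)
  have e : (h : ℂ)⁻¹ * (Complex.exp (((h : ℂ) • l) w) - 1) - l w =
      (h : ℂ)⁻¹ * (Complex.exp ((h : ℂ) * l w) - 1 - (h : ℂ) * l w) := by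
    rw [_root_.smul_apply, smul_eq_mul]
    field_simp
  rw [e, norm_mul, norm_inv, hhn, inv_mul_le_iff₀ hpos]
  calc _ ≤ _ := h4
    _ ≤ (h * B) ^ 2 := by gcongr
    _ = h * (h * B ^ 2) := by ring
    _ ≤ h * ε := by gcongr

theorem Ent.coord (i : ι) : Ent (fun w : ι → ℂ => w i) :=
  Ent.linear (ContinuousLinearMap.proj (R := ℂ) (φ := fun _ : ι => ℂ) i)

theorem Ent.exp {f : (ι → ℂ) → ℂ} (hf : Ent f) : Ent (fun w => Complex.exp (f w)) := by
  refine Ent.of_approx (Complex.continuous_exp.comp hf.continuous) fun R ε hε => ?_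
  obtain ⟨B, hB⟩ := (isCompact_closedBall (0 : ι → ℂ) R).exists_bound_of_continuousOn
    hf.continuous.continuousOn
  have ht := (FloorSemiring.tendsto_pow_div_factorial_atTop (|B|)).mul_const 2
  rw [zero_mul] at ht
  obtain ⟨n, hn, hn2⟩ := ((ht.eventually (gt_mem_nhds hε)).and
    (eventually_ge_atTop ⌈2 * |B|⌉₊)).exists
  refine ⟨fun w => ∑ j ∈ Finset.range n, f w ^ j * ((j.factorial : ℂ)⁻¹),
    Ent.sum _ fun j _ => (hf.pow j).mul (Ent.const _), fun w hw => ?_⟩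
  have hfw : ‖f w‖ ≤ |B| := (hB w (by simpa using hw)).trans (le_abs_self B)
  have hn2' : 2 * |B| ≤ n := Nat.ceil_le.1 hn2
  have := Complex.exp_bound' (x := f w) (n := n) (by
    rw [div_le_iff₀ (by positivity)]
    push_cast
    linarith)
  rw [norm_sub_rev]
  refine le_trans (by simpa [div_eq_mul_inv] using this) ?_
  refine le_trans ?_ hn.le
  rw [div_eq_mul_inv]
  gcongr

omit [Fintype ι] in
theorem Ent.induction_approx {P : ((ι → ℂ) → ℂ) → Prop}
    (hlin : ∀ (c : ℂ) (l : (ι → ℂ) →L[ℂ] ℂ), P (fun w => c * Complex.exp (l w)))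
    (hadd : ∀ f g, P f → P g → P (fun w => f w + g w))
    {g : C(ι → ℂ, ℂ)} (hg : g ∈ expAlg ι) : P g := by
  have hmon : ((Submonoid.closure (range (expFun (ι := ι)))) : Set C(ι → ℂ, ℂ)) ⊆ range expFun := by
    intro x hx
    induction hx using Submonoid.closure_induction with
    | mem x hx => exact hx
    | one => exact ⟨0, by ext w; simp [expFun]⟩
    | mul x y _ _ hx hy =>
      obtain ⟨l, rfl⟩ := hx
      obtain ⟨l', rfl⟩ := hy
      exact ⟨l + l', by ext w; simp [expFun, Complex.exp_add]⟩
  have hg' : g ∈ Submodule.span ℂ (range (expFun (ι := ι))) := by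
    have h1 : g ∈ Subalgebra.toSubmodule (expAlg ι) := hg
    rw [expAlg, Algebra.adjoin_eq_span] at h1
    exact Submodule.span_mono hmon h1
  suffices h : ∀ c : ℂ, P (fun w => c * g w) by simpa using h 1
  clear hg
  induction hg' using Submodule.span_induction with
  | mem x hx =>
    obtain ⟨l, rfl⟩ := hx
    exact fun c => hlin c l
  | zero => exact fun c => by simpa using hlin 0 0
  | add x y hx hy h1 h2 => exact fun c => by simpa [mul_add] using hadd _ _ (h1 c) (h2 c)
  | smul a x hx h => exact fun c => by simpa [mul_assoc] using h (c * a)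

theorem Ent.differentiable {f : (ι → ℂ) → ℂ} (hf : Ent f) : Differentiable ℂ f := by
  intro x
  have h : ∀ n : ℕ, ∃ g : (ι → ℂ) → ℂ, Differentiable ℂ g ∧
      ∀ w, ‖w‖ ≤ ‖x‖ + 1 → ‖g w - f w‖ ≤ 1 / ((n : ℝ) + 1) := fun n => by
    obtain ⟨g, hg, hgf⟩ := hf.exists_approx (‖x‖ + 1) (ε := 1 / ((n : ℝ) + 1)) (by positivity)
    refine ⟨g, ?_, hgf⟩
    exact Ent.induction_approx (P := fun f => Differentiable ℂ f) (fun c l => by fun_prop)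
      (fun _ _ h1 h2 => h1.add h2) hg
  choose g hg hgf using h
  refine (limit_of_tendstoUniformlyOn (l := atTop) (f := g) (U := ball 0 (‖x‖ + 1)) isOpen_ball
    (fun n => (hg n).differentiableOn) ?_ (by simp)).1
  rw [Metric.tendstoUniformlyOn_iff]
  intro ε hε
  filter_upwards [tendsto_one_div_add_atTop_nhds_zero_nat.eventually (gt_mem_nhds hε)]
    with n hn w hw
  rw [dist_comm, dist_eq_norm]
  exact (hgf n w (by simpa using (mem_ball.1 hw).le)).trans_lt hn

theorem clm_apply_eq_sum [DecidableEq ι] (l : (ι → ℂ) →L[ℂ] ℂ) (w : ι → ℂ) :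
    l w = ∑ i, l (Pi.single i 1) * w i := by
  conv_lhs => rw [pi_eq_sum_univ' w, map_sum]
  refine Finset.sum_congr rfl fun i _ => ?_
  rw [map_smul, smul_eq_mul, mul_comm]

theorem Ent.comp {κ : Type*} [Fintype κ] {f : (ι → ℂ) → ℂ} (hf : Ent f)
    {Φ : (κ → ℂ) → (ι → ℂ)} (hΦ : ∀ i, Ent fun w => Φ w i) : Ent (fun w => f (Φ w)) := by
  classical
  have hΦc : Continuous Φ := continuous_pi fun i => (hΦ i).continuous
  refine Ent.of_approx (hf.continuous.comp hΦc) fun R ε hε => ?_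
  obtain ⟨B, hB⟩ := (isCompact_closedBall (0 : κ → ℂ) R).exists_bound_of_continuousOn
    hΦc.continuousOn
  obtain ⟨g, hg, hgf⟩ := hf.exists_approx B hε
  refine ⟨fun w => g (Φ w), ?_, fun w hw => hgf _ (hB w (by simpa using hw))⟩
  refine Ent.induction_approx (P := fun f => Ent fun w => f (Φ w)) (fun c l => ?_)
    (fun _ _ h1 h2 => h1.add h2) hg
  refine (Ent.const c).mul (Ent.exp ?_)
  rw [show (fun w => l (Φ w)) = fun w => ∑ i, l (Pi.single i 1) * Φ w i from
    funext fun w => clm_apply_eq_sum l (Φ w)]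
  exact Ent.sum _ fun i _ => (Ent.const _).mul (hΦ i)

end EntireFunctions

/-! ### The automorphism group -/

section Automorphisms

variable {ι : Type*} [Fintype ι]

/-- A homeomorphism of `ℂ^ι` which, together with its inverse, has components that are limits of
exponential sums. -/
def IsAut (Φ : (ι → ℂ) ≃ₜ (ι → ℂ)) : Prop :=
  (∀ i, Ent fun w => Φ w i) ∧ ∀ i, Ent fun w => Φ.symm w i

theorem IsAut.differentiable {Φ : (ι → ℂ) ≃ₜ (ι → ℂ)} (h : IsAut Φ) : Differentiable ℂ Φ :=
  differentiable_pi.2 fun i => (h.1 i).differentiable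

theorem IsAut.symm {Φ : (ι → ℂ) ≃ₜ (ι → ℂ)} (h : IsAut Φ) : IsAut Φ.symm := ⟨h.2, h.1⟩

theorem IsAut.refl : IsAut (Homeomorph.refl (ι → ℂ)) := ⟨Ent.coord, Ent.coord⟩

theorem IsAut.trans {Φ Ψ : (ι → ℂ) ≃ₜ (ι → ℂ)} (h : IsAut Φ) (h' : IsAut Ψ) : IsAut (Φ.trans Ψ) :=
  ⟨fun i => (h'.1 i).comp h.1, fun i => (h.2 i).comp h'.2⟩

theorem exists_isAut {f g : (ι → ℂ) → (ι → ℂ)} (hf : ∀ i, Ent fun w => f w i)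
    (hg : ∀ i, Ent fun w => g w i) (h1 : ∀ w, g (f w) = w) (h2 : ∀ w, f (g w) = w) :
    ∃ Φ : (ι → ℂ) ≃ₜ (ι → ℂ), IsAut Φ ∧ (∀ w, Φ w = f w) ∧ ∀ w, Φ.symm w = g w :=
  ⟨{ toFun := f, invFun := g, left_inv := h1, right_inv := h2,
     continuous_toFun := continuous_pi fun i => (hf i).continuous,
     continuous_invFun := continuous_pi fun i => (hg i).continuous }, ⟨hf, hg⟩, fun _ => rfl,
    fun _ => rfl⟩

theorem exists_shear {f : (ι → ℂ) → ℂ} (hf : Ent f) {v : ι → ℂ}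
    (hv : ∀ w (c : ℂ), f (w + c • v) = f w) :
    ∃ Φ : (ι → ℂ) ≃ₜ (ι → ℂ), IsAut Φ ∧ ∀ w, Φ w = w + f w • v := by
  obtain ⟨Φ, h, h1, -⟩ := exists_isAut (f := fun w => w + f w • v) (g := fun w => w - f w • v)
    (fun i => (Ent.coord i).add (hf.mul (Ent.const (v i))))
    (fun i => (Ent.coord i).sub (hf.mul (Ent.const (v i))))
    (fun w => by simp [hv]) (fun w => by
      have := hv w (-f w)
      rw [neg_smul, ← sub_eq_add_neg] at this
      simp [this])
  exact ⟨Φ, h, h1⟩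

theorem exists_overshear {f : (ι → ℂ) → ℂ} (hf : Ent f) {v : ι → ℂ}
    (hv : ∀ w (c : ℂ), f (w + c • v) = f w) {μ : (ι → ℂ) →L[ℂ] ℂ} (hμ : μ v = 1) :
    ∃ Φ : (ι → ℂ) ≃ₜ (ι → ℂ), IsAut Φ ∧
      ∀ w, Φ w = w + ((Complex.exp (f w) - 1) * μ w) • v := by
  have hcomp : ∀ g, Ent g → ∀ i, Ent fun w => (w + ((Complex.exp (g w) - 1) * μ w) • v) i :=
    fun g hg i => (Ent.coord i).add (((hg.exp.sub (Ent.const 1)).mul (Ent.linear μ)).mul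
      (Ent.const (v i)))
  have hinv : ∀ g h : (ι → ℂ) → ℂ, (∀ w (c : ℂ), h (w + c • v) = h w) → (∀ w, h w = - g w) → ∀ w,
      (w + ((Complex.exp (g w) - 1) * μ w) • v) +
        ((Complex.exp (h (w + ((Complex.exp (g w) - 1) * μ w) • v)) - 1) *
          μ (w + ((Complex.exp (g w) - 1) * μ w) • v)) • v = w := by
    intro g h hh hgh w
    rw [hh, hgh, add_assoc, ← add_smul]
    have : (Complex.exp (g w) - 1) * μ w + (Complex.exp (-g w) - 1) *
        μ (w + ((Complex.exp (g w) - 1) * μ w) • v) = 0 := by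
      rw [map_add, map_smul, hμ, smul_eq_mul, Complex.exp_neg]
      have := Complex.exp_ne_zero (g w)
      field_simp
      ring
    rw [this, zero_smul, add_zero]
  have hneg : Ent fun w => - f w := by simpa using (Ent.const 0).sub hf
  obtain ⟨Φ, h, h1, -⟩ := exists_isAut (hcomp f hf) (hcomp _ hneg)
    (hinv f (fun w => - f w) (fun w c => by rw [hv]) (fun _ => rfl))
    (hinv (fun w => - f w) f hv (fun w => by simp))
  exact ⟨Φ, h, h1⟩

end Automorphisms

/-! ### Vector fields generated by automorphisms -/

section Generators

variable {ι : Type*} [Fintype ι]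

/-- A continuous vector field whose Euler steps are approximated, locally uniformly and to first
order, by automorphisms. -/
def Gen (X : (ι → ℂ) → (ι → ℂ)) : Prop :=
  Continuous X ∧ ∀ R : ℝ, ∀ ε > 0, ∃ h₀ > 0, ∀ h : ℝ, 0 < h → h < h₀ →
    ∃ A : (ι → ℂ) ≃ₜ (ι → ℂ), IsAut A ∧ ∀ w, ‖w‖ ≤ R → ‖A w - w - (h : ℂ) • X w‖ ≤ ε * h

theorem exists_bound_closedBall {V W : Type*} [NormedAddCommGroup V] [ProperSpace V]
    [NormedAddCommGroup W] {f : V → W} (hf : Continuous f) (R : ℝ) :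
    ∃ B > 0, ∀ w, ‖w‖ ≤ R → ‖f w‖ ≤ B := by
  obtain ⟨B, hB⟩ := (isCompact_closedBall (0 : V) R).exists_bound_of_continuousOn hf.continuousOn
  exact ⟨|B| + 1, by positivity, fun w hw =>
    (hB w (by simpa using hw)).trans ((le_abs_self B).trans (by simp))⟩

theorem exists_unif_closedBall {V W : Type*} [NormedAddCommGroup V] [ProperSpace V]
    [NormedAddCommGroup W] {f : V → W} (hf : Continuous f) (R : ℝ) {ε : ℝ} (hε : 0 < ε) :
    ∃ δ > 0, ∀ a b, ‖a‖ ≤ R → ‖b‖ ≤ R → ‖a - b‖ ≤ δ → ‖f a - f b‖ ≤ ε := by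
  have := (isCompact_closedBall (0 : V) R).uniformContinuousOn_of_continuous hf.continuousOn
  obtain ⟨δ, hδ, h⟩ := Metric.uniformContinuousOn_iff.1 this ε hε
  refine ⟨δ / 2, by positivity, fun a b ha hb hab => ?_⟩
  have := h a (by simpa using ha) b (by simpa using hb) (by rw [dist_eq_norm]; linarith)
  rw [dist_eq_norm] at this
  exact this.le

theorem norm_real_smul {V : Type*} [NormedAddCommGroup V] [NormedSpace ℂ V] {h : ℝ} (hh : 0 ≤ h)
    (v : V) : ‖(h : ℂ) • v‖ = h * ‖v‖ := by
  rw [norm_smul, Complex.norm_real, Real.norm_of_nonneg hh]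

theorem Gen.zero : Gen (fun _ : ι → ℂ => 0) :=
  ⟨continuous_const, fun R ε hε => ⟨1, one_pos, fun h hh _ => ⟨_, IsAut.refl, fun w _ => by
    simp; positivity⟩⟩⟩

theorem Gen.add {X Y : (ι → ℂ) → (ι → ℂ)} (hX : Gen X) (hY : Gen Y) :
    Gen (fun w => X w + Y w) := by
  refine ⟨hX.1.add hY.1, fun R ε hε => ?_⟩
  obtain ⟨B, hB, hBY⟩ := exists_bound_closedBall hY.1 R
  obtain ⟨δ, hδ, hδX⟩ := exists_unif_closedBall hX.1 (R + 1) (ε := ε / 3) (by positivity)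
  obtain ⟨h₁, hh₁, H₁⟩ := hX.2 (R + 1) (ε / 3) (by positivity)
  obtain ⟨h₂, hh₂, H₂⟩ := hY.2 R (min (ε / 3) 1) (by positivity)
  refine ⟨min (min h₁ h₂) (min 1 δ / (B + 1)), by positivity, fun h hh hlt => ?_⟩
  obtain ⟨A, hA, HA⟩ := H₁ h hh (hlt.trans_le ((min_le_left _ _).trans (min_le_left _ _)))
  obtain ⟨A', hA', HA'⟩ := H₂ h hh (hlt.trans_le ((min_le_left _ _).trans (min_le_right _ _)))
  have hsmall : h * (B + 1) ≤ min 1 δ := by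
    have := (hlt.trans_le (min_le_right _ _)).le
    rwa [le_div_iff₀ (by positivity)] at this
  refine ⟨A'.trans A, hA'.trans hA, fun w hw => ?_⟩
  have h1 := HA' w hw
  have h2 : ‖A' w - w‖ ≤ min 1 δ := by
    refine le_trans ?_ hsmall
    calc ‖A' w - w‖ = ‖(A' w - w - (h : ℂ) • Y w) + (h : ℂ) • Y w‖ := by congr 1; abel
      _ ≤ _ := norm_add_le _ _
      _ ≤ 1 * h + h * B := by
        rw [norm_real_smul hh.le]
        gcongr
        · exact h1.trans (by gcongr; exact min_le_right _ _)
        · exact hBY w hw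
      _ = _ := by ring
  have h3 : ‖A' w‖ ≤ R + 1 := by
    have := norm_le_insert' (A' w) w
    have := h2.trans (min_le_left _ _)
    linarith
  have h4 := HA _ h3
  have h5 := hδX (A' w) w h3 (by linarith) (h2.trans (min_le_right _ _))
  have e : (A'.trans A) w - w - (h : ℂ) • (X w + Y w) = (A (A' w) - A' w - (h : ℂ) • X (A' w)) +
      (A' w - w - (h : ℂ) • Y w) + (h : ℂ) • (X (A' w) - X w) := by
    rw [Homeomorph.trans_apply, smul_add, smul_sub]; abel
  rw [e]
  refine (norm_add₃_le).trans ?_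
  rw [norm_real_smul hh.le]
  have h6 : min (ε / 3) 1 * h ≤ ε / 3 * h := by gcongr; exact min_le_left _ _
  have h7 : h * ‖X (A' w) - X w‖ ≤ h * (ε / 3) := by gcongr
  linarith

theorem Gen.sum {α : Type*} (s : Finset α) {X : α → (ι → ℂ) → (ι → ℂ)} (h : ∀ i ∈ s, Gen (X i)) :
    Gen (fun w => ∑ i ∈ s, X i w) := by
  classical
  induction s using Finset.induction_on with
  | empty => simpa using Gen.zero
  | insert a s ha ih =>
    simp_rw [Finset.sum_insert ha]
    exact (h a (by simp)).add (ih fun i hi => h i (by simp [hi]))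

theorem Gen.of_approx {X : (ι → ℂ) → (ι → ℂ)} (hc : Continuous X)
    (h : ∀ R : ℝ, ∀ ε > 0, ∃ Y, Gen Y ∧ ∀ w, ‖w‖ ≤ R → ‖Y w - X w‖ ≤ ε) : Gen X := by
  refine ⟨hc, fun R ε hε => ?_⟩
  obtain ⟨Y, hY, hYX⟩ := h R (ε / 2) (by positivity)
  obtain ⟨h₀, hh₀, H⟩ := hY.2 R (ε / 2) (by positivity)
  refine ⟨h₀, hh₀, fun h hh hlt => ?_⟩
  obtain ⟨A, hA, HA⟩ := H h hh hlt
  refine ⟨A, hA, fun w hw => ?_⟩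
  have e : A w - w - (h : ℂ) • X w = (A w - w - (h : ℂ) • Y w) + (h : ℂ) • (Y w - X w) := by
    rw [smul_sub]; abel
  rw [e]
  refine (norm_add_le _ _).trans ?_
  rw [norm_real_smul hh.le]
  have h1 := HA w hw
  have h2 : h * ‖Y w - X w‖ ≤ h * (ε / 2) := by gcongr; exact hYX w hw
  linarith

theorem Gen.shear {f : (ι → ℂ) → ℂ} (hf : Ent f) {v : ι → ℂ}
    (hv : ∀ w (c : ℂ), f (w + c • v) = f w) : Gen (fun w => f w • v) := by
  refine ⟨hf.continuous.smul continuous_const, fun R ε hε => ⟨1, one_pos, fun h hh _ => ?_⟩⟩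
  obtain ⟨A, hA, HA⟩ := exists_shear ((Ent.const (h : ℂ)).mul hf) (v := v)
    (fun w c => by simp only [hv])
  refine ⟨A, hA, fun w _ => ?_⟩
  rw [HA, mul_smul]
  simp
  positivity

theorem Gen.overshear {f : (ι → ℂ) → ℂ} (hf : Ent f) {v : ι → ℂ}
    (hv : ∀ w (c : ℂ), f (w + c • v) = f w) {μ : (ι → ℂ) →L[ℂ] ℂ} (hμ : μ v = 1) :
    Gen (fun w => (f w * μ w) • v) := by
  refine ⟨(hf.continuous.mul μ.continuous).smul continuous_const, fun R ε hε => ?_⟩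
  obtain ⟨B, hB, hBf⟩ := exists_bound_closedBall hf.continuous R
  obtain ⟨C, hC, hCμ⟩ := exists_bound_closedBall (f := fun w => μ w • v)
    (μ.continuous.smul continuous_const) R
  refine ⟨min (1 / B) (ε / (B ^ 2 * C)), by positivity, fun h hh hlt => ?_⟩
  obtain ⟨A, hA, HA⟩ := exists_overshear ((Ent.const (h : ℂ)).mul hf) (v := v)
    (fun w c => by simp only [hv]) hμ
  refine ⟨A, hA, fun w hw => ?_⟩
  have e : A w - w - (h : ℂ) • (f w * μ w) • v =
      (Complex.exp (h * f w) - 1 - h * f w) • (μ w • v) := by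
    rw [HA, smul_smul, smul_smul, add_sub_cancel_left, ← sub_smul]
    congr 1
    ring
  have h1 : ‖(h : ℂ) * f w‖ ≤ h * B := by
    rw [norm_mul, Complex.norm_real, Real.norm_of_nonneg hh.le]
    gcongr
    exact hBf w hw
  have h2 : h * B ≤ 1 := by
    have := (hlt.trans_le (min_le_left _ _)).le
    rwa [le_div_iff₀ hB] at this
  have h3 : h * (B ^ 2 * C) ≤ ε := by
    have := (hlt.trans_le (min_le_right _ _)).le
    rwa [le_div_iff₀ (by positivity)] at this
  rw [e, norm_smul]
  calc _ ≤ (h * B) ^ 2 * C := by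
        gcongr
        · exact (norm_exp_sub_one_sub_le (h1.trans h2)).trans (by gcongr)
        · exact hCμ w hw
    _ = h * (B ^ 2 * C) * h := by ring
    _ ≤ ε * h := by gcongr

omit [Fintype ι] in
theorem exists_vector_functional [Nontrivial ι] {l : (ι → ℂ) →L[ℂ] ℂ} {v : ι → ℂ} (hlv : l v ≠ 0) :
    ∃ (v₂ : ι → ℂ) (μ : (ι → ℂ) →L[ℂ] ℂ), l v₂ = 0 ∧ μ v₂ = 1 ∧ μ v = 0 := by
  classical
  obtain ⟨u, hu, hlu⟩ : ∃ u : ι → ℂ, u ≠ 0 ∧ l u = 0 := by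
    obtain ⟨i, j, hij⟩ := exists_pair_ne ι
    by_cases hi : l (Pi.single i 1) = 0
    · exact ⟨Pi.single i 1, by simp, hi⟩
    · refine ⟨l (Pi.single j 1) • Pi.single i 1 - l (Pi.single i 1) • Pi.single j 1, fun h => hi ?_,
        by simp [mul_comm]⟩
      have := congrFun h j
      simpa [Pi.single_apply, hij.symm] using this
  obtain ⟨j, hj⟩ := Function.ne_iff.1 hu
  have hj : u j ≠ 0 := hj
  set ν : (ι → ℂ) →L[ℂ] ℂ := ContinuousLinearMap.proj (R := ℂ) (φ := fun _ : ι => ℂ) j with hν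
  refine ⟨(u j)⁻¹ • u, ν - (ν v / l v) • l, by simp [hlu], ?_, ?_⟩
  · simp [hν, hlu, hj]
  · simp [hlv]

theorem Gen.exp_smul [Nontrivial ι] (a : ℂ) (l : (ι → ℂ) →L[ℂ] ℂ) (v : ι → ℂ) :
    Gen (fun w => (a * Complex.exp (l w)) • v) := by
  have key : ∀ (c : ℂ) (l : (ι → ℂ) →L[ℂ] ℂ) (v : ι → ℂ), l v = 0 →
      Gen (fun w => (c * Complex.exp (l w)) • v) := fun c l v h =>
    Gen.shear ((Ent.const c).mul (Ent.exp_linear l)) (fun w c => by simp [h])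
  by_cases hlv : l v = 0
  · exact key a l v hlv
  obtain ⟨v₂, μ, hl2, hμ2, hμv⟩ := exists_vector_functional hlv
  set c := l v with hc
  -- `exp l • v - c μ exp l • v₂` is a limit of sums of complete fields
  have hlim : Gen (fun w => (a * Complex.exp (l w)) • v -
      (a * c * Complex.exp (l w) * μ w) • v₂) := by
    refine Gen.of_approx (by fun_prop) fun R ε hε => ?_
    obtain ⟨B, hB, hBμ⟩ := exists_bound_closedBall μ.continuous R
    obtain ⟨C, hC, hCe⟩ := exists_bound_closedBall
      (f := fun w => (a * Complex.exp (l w)) • v) (by fun_prop) R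
    obtain ⟨C', hC', hCe'⟩ := exists_bound_closedBall
      (f := fun w => (a * c * Complex.exp (l w)) • v₂) (by fun_prop) R
    set θ : ℝ := min (1 / B) (ε / (2 * B * C + B ^ 2 * C')) with hθ
    have hθpos : 0 < θ := by positivity
    have hθ0 : (θ : ℂ) ≠ 0 := by exact_mod_cast hθpos.ne'
    refine ⟨_, ((key (a * (θ : ℂ)⁻¹) (l + (θ : ℂ) • μ) ((θ : ℂ) • v - c • v₂)
      (by simp [hl2, hμ2, hμv, ← hc, mul_comm])).add (key (a * c * (θ : ℂ)⁻¹) l v₂ hl2)),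
      fun w hw => ?_⟩
    have h1 : ‖(θ : ℂ) * μ w‖ ≤ θ * B := by
      rw [norm_mul, Complex.norm_real, Real.norm_of_nonneg hθpos.le]
      gcongr
      exact hBμ w hw
    have h2 : θ * B ≤ 1 := by
      have : θ ≤ 1 / B := min_le_left _ _
      rwa [le_div_iff₀ hB] at this
    have h3 : θ * (2 * B * C + B ^ 2 * C') ≤ ε := by
      have : θ ≤ ε / (2 * B * C + B ^ 2 * C') := min_le_right _ _
      rwa [le_div_iff₀ (by positivity)] at this
    have hexp := norm_exp_sub_one_sub_le (h1.trans h2)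
    have hexp2 : ‖Complex.exp (θ * μ w) - 1‖ ≤ 2 * (θ * B) := by
      have h5 := Complex.norm_exp_sub_one_le (h1.trans h2)
      linarith
    have e : (a * (θ : ℂ)⁻¹ * Complex.exp ((l + (θ : ℂ) • μ) w)) • ((θ : ℂ) • v - c • v₂) +
        (a * c * (θ : ℂ)⁻¹ * Complex.exp (l w)) • v₂ - ((a * Complex.exp (l w)) • v -
          (a * c * Complex.exp (l w) * μ w) • v₂) =
        (Complex.exp (θ * μ w) - 1) • ((a * Complex.exp (l w)) • v) -
        ((θ : ℂ)⁻¹ * (Complex.exp (θ * μ w) - 1 - θ * μ w)) •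
          ((a * c * Complex.exp (l w)) • v₂) := by
      have : Complex.exp ((l + (θ : ℂ) • μ) w) = Complex.exp (l w) * Complex.exp (θ * μ w) := by
        rw [← Complex.exp_add]; simp
      rw [this]
      ext i
      simp only [Pi.add_apply, Pi.sub_apply, Pi.smul_apply, smul_eq_mul]
      field_simp
      ring
    rw [e]
    refine (norm_sub_le _ _).trans ?_
    rw [norm_smul (Complex.exp (θ * μ w) - 1), norm_smul ((θ : ℂ)⁻¹ * _), norm_mul (θ : ℂ)⁻¹,
      norm_inv, Complex.norm_real, Real.norm_of_nonneg hθpos.le]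
    have h6 : θ⁻¹ * ‖Complex.exp (θ * μ w) - 1 - θ * μ w‖ ≤ θ * B ^ 2 := by
      rw [inv_mul_le_iff₀ hθpos]
      calc _ ≤ _ := hexp
        _ ≤ (θ * B) ^ 2 := by gcongr
        _ = _ := by ring
    calc _ ≤ 2 * (θ * B) * C + θ * B ^ 2 * C' := by
          gcongr
          · exact hCe w hw
          · exact hCe' w hw
      _ = θ * (2 * B * C + B ^ 2 * C') := by ring
      _ ≤ ε := h3
  have h2 : Gen (fun w => (a * c * Complex.exp (l w) * μ w) • v₂) :=
    Gen.overshear ((Ent.const (a * c)).mul (Ent.exp_linear l)) (fun w d => by simp [hl2]) hμ2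
  simpa using hlim.add h2

theorem Ent.gen_smul [Nontrivial ι] {f : (ι → ℂ) → ℂ} (hf : Ent f) (v : ι → ℂ) :
    Gen (fun w => f w • v) := by
  refine Gen.of_approx (hf.continuous.smul continuous_const) fun R ε hε => ?_
  obtain ⟨g, hg, hgf⟩ := hf.exists_approx R (ε := ε / (‖v‖ + 1)) (by positivity)
  refine ⟨fun w => g w • v, Ent.induction_approx (P := fun f => Gen fun w => f w • v)
    (fun c l => Gen.exp_smul c l v) (fun f g h1 h2 => ?_) hg, fun w hw => ?_⟩
  · simp_rw [add_smul]
    exact h1.add h2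
  · rw [← sub_smul, norm_smul]
    have := hgf w hw
    rw [le_div_iff₀ (by positivity)] at this
    nlinarith [norm_nonneg (g w - f w)]

theorem gen_of_ent [Nontrivial ι] {X : (ι → ℂ) → (ι → ℂ)} (hX : ∀ i, Ent fun w => X w i) :
    Gen X := by
  classical
  have := Gen.sum Finset.univ (X := fun i w => X w i • (Pi.single i 1 : ι → ℂ))
    (fun i _ => (hX i).gen_smul _)
  convert this using 2 with w
  exact pi_eq_sum_univ' (X w)

end Generators

/-! ### Approximating flows by automorphisms -/

section Flows

variable {ι : Type*} [Fintype ι]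

/-- Simultaneous approximation of flow curves by a single automorphism. -/
theorem Gen.exists_flow {X : (ι → ℂ) → (ι → ℂ)} (hX : Gen X) {Ω : Type*}
    {Y : Ω → (ι → ℂ) → (ι → ℂ)} {γ : Ω → ℝ → (ι → ℂ)} {L R B η δ : ℝ} (hL : 0 ≤ L) (hη : 0 < η)
    (hlip : ∀ ω a b, ‖Y ω a - Y ω b‖ ≤ L * ‖a - b‖)
    (hγ : ∀ ω t h, 0 ≤ t → 0 ≤ h → t + h ≤ 1 →
      ‖γ ω (t + h) - γ ω t - (h : ℂ) • Y ω (γ ω t)‖ ≤ B * h ^ 2)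
    (hR : ∀ ω t, 0 ≤ t → t ≤ 1 → ‖γ ω t‖ ≤ R)
    (hXY : ∀ ω t w, 0 ≤ t → t ≤ 1 → ‖w - γ ω t‖ ≤ δ → ‖X w - Y ω w‖ ≤ η)
    (hδ : 3 * η * Real.exp L ≤ δ) :
    ∃ A : (ι → ℂ) ≃ₜ (ι → ℂ), IsAut A ∧
      ∀ ω, ‖A (γ ω 0) - γ ω 1‖ ≤ 3 * η * Real.exp L := by
  obtain ⟨h₀, hh₀, H⟩ := hX.2 (R + δ) η hη
  obtain ⟨M, hM⟩ := exists_nat_gt (max (1 / h₀) (max B 0 / η))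
  have hM1 : 1 / h₀ < M := (le_max_left _ _).trans_lt hM
  have hM2 : max B 0 / η < M := (le_max_right _ _).trans_lt hM
  have hMpos : (0 : ℝ) < M := lt_trans (by positivity) hM1
  set h : ℝ := 1 / M with hh
  have hpos : 0 < h := by positivity
  have hlt : h < h₀ := by
    rw [hh, div_lt_iff₀ hMpos]; rwa [div_lt_iff₀ hh₀, mul_comm] at hM1
  have hBh : B * h ≤ η := by
    rw [div_lt_iff₀ hη] at hM2
    rw [hh, mul_one_div, div_le_iff₀ hMpos]
    linarith [le_max_left B 0]
  obtain ⟨A, hA, HA⟩ := H h hpos hlt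
  have hMh : (M : ℝ) * h = 1 := by rw [hh]; field_simp
  have hgrow : ∀ j : ℕ, j ≤ M → 3 * η * (j * h) * (1 + L * h) ^ j ≤ 3 * η * Real.exp L := by
    intro j hj
    have hjh : (j : ℝ) * h ≤ 1 := by
      rw [← hMh]; gcongr
    have h1 : (1 + L * h) ^ j ≤ Real.exp L := by
      calc (1 + L * h) ^ j ≤ (Real.exp (L * h)) ^ j := by
            gcongr
            linarith [Real.add_one_le_exp (L * h)]
        _ = Real.exp (L * (j * h)) := by rw [← Real.exp_nat_mul]; ring_nf
        _ ≤ Real.exp L := Real.exp_le_exp.2 (by nlinarith)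
    calc 3 * η * (j * h) * (1 + L * h) ^ j ≤ 3 * η * 1 * Real.exp L := by gcongr
      _ = _ := by ring
  have key : ∀ j : ℕ, j ≤ M → ∃ A' : (ι → ℂ) ≃ₜ (ι → ℂ), IsAut A' ∧
      ∀ ω, ‖A' (γ ω 0) - γ ω (j * h)‖ ≤ 3 * η * (j * h) * (1 + L * h) ^ j := by
    intro j
    induction j with
    | zero => exact fun _ => ⟨_, IsAut.refl, fun ω => by simp⟩
    | succ j ih =>
      intro hj
      obtain ⟨A', hA', HA'⟩ := ih (by omega)
      refine ⟨A'.trans A, hA'.trans hA, fun ω => ?_⟩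
      have h1 := HA' ω
      have h2 := h1.trans ((hgrow j (by omega)).trans hδ)
      set w := A' (γ ω 0) with hw
      set t : ℝ := j * h with ht
      have ht0 : 0 ≤ t := by positivity
      have hth : ((j + 1 : ℕ) : ℝ) * h = t + h := by push_cast; ring
      have hth1 : t + h ≤ 1 := by
        rw [← hth, ← hMh]; gcongr
      have ht1 : t ≤ 1 := by linarith
      have h3 : ‖w‖ ≤ R + δ := by
        calc ‖w‖ = ‖γ ω t + (w - γ ω t)‖ := by congr 1; abel
          _ ≤ _ := (norm_add_le _ _).trans (add_le_add (hR ω t ht0 ht1) h2)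
      have e : A w - γ ω (t + h) = (A w - w - (h : ℂ) • X w) + (w - γ ω t) +
          ((h : ℂ) • (X w - Y ω w) + (h : ℂ) • (Y ω w - Y ω (γ ω t))) -
          (γ ω (t + h) - γ ω t - (h : ℂ) • Y ω (γ ω t)) := by
        simp only [smul_sub]; abel
      have h4 : ‖A w - γ ω (t + h)‖ ≤ η * h + ‖w - γ ω t‖ +
          (h * η + h * (L * ‖w - γ ω t‖)) + B * h ^ 2 := by
        rw [e]
        refine (norm_sub_le _ _).trans (add_le_add ((norm_add_le _ _).trans (add_le_add
          ((norm_add_le _ _).trans (add_le_add (HA w h3) le_rfl)) ?_)) (hγ ω t h ht0 hpos.le hth1))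
        refine (norm_add_le _ _).trans ?_
        rw [norm_real_smul hpos.le, norm_real_smul hpos.le]
        gcongr
        · exact hXY ω t w ht0 ht1 h2
        · exact hlip ω _ _
      have h5 : (1 : ℝ) ≤ (1 + L * h) ^ (j + 1) :=
        one_le_pow₀ (by nlinarith)
      rw [hth]
      change ‖A w - γ ω (t + h)‖ ≤ _
      calc _ ≤ _ := h4
        _ ≤ η * h + h * η + η * h + (1 + L * h) * ‖w - γ ω t‖ := by nlinarith
        _ ≤ η * h + h * η + η * h + (1 + L * h) * (3 * η * t * (1 + L * h) ^ j) := by gcongr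
        _ = 3 * η * h * 1 + 3 * η * t * (1 + L * h) ^ (j + 1) := by ring
        _ ≤ 3 * η * h * (1 + L * h) ^ (j + 1) + 3 * η * t * (1 + L * h) ^ (j + 1) := by
          gcongr
        _ = _ := by ring
  obtain ⟨A', hA', HA'⟩ := key M le_rfl
  refine ⟨A', hA', fun ω => ?_⟩
  have := (HA' ω).trans (hgrow M le_rfl)
  rwa [hMh] at this

/-- Sharpening an entire function that roughly separates two sets. -/
theorem Ent.exists_sharpen {q : (ι → ℂ) → ℂ} (hq : Ent q) {ε : ℝ} (hε : 0 < ε) :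
    ∃ χ : (ι → ℂ) → ℂ, Ent χ ∧ (∀ w, ‖q w‖ ≤ 1 / 4 → ‖χ w‖ ≤ ε) ∧
      (∀ w, ‖q w - 1‖ ≤ 1 / 4 → ‖χ w - 1‖ ≤ ε) ∧ ∀ w, q w = 0 → χ w = 0 := by
  have key : ∀ s : ℕ, ∃ χ : (ι → ℂ) → ℂ, Ent χ ∧
      (∀ w, ‖q w‖ ≤ 1 / 4 → ‖χ w‖ ≤ 1 / 4 * (7 / 8) ^ s) ∧
      (∀ w, ‖q w - 1‖ ≤ 1 / 4 → ‖χ w - 1‖ ≤ 1 / 4 * (7 / 8) ^ s) ∧ ∀ w, q w = 0 → χ w = 0 := by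
    intro s
    induction s with
    | zero => exact ⟨q, hq, fun w h => by simpa using h, fun w h => by simpa using h, fun _ h => h⟩
    | succ s ih =>
      obtain ⟨χ, hχ, h0, h1, hz⟩ := ih
      have hp : (7 / 8 : ℝ) ^ s ≤ 1 := pow_le_one₀ (by norm_num) (by norm_num)
      have hb : ∀ y : ℂ, ‖y‖ ≤ 1 / 4 * (7 / 8) ^ s →
          ‖3 * y ^ 2 - 2 * y ^ 3‖ ≤ 1 / 4 * (7 / 8) ^ (s + 1) := fun y hy => by
        have hy4 : ‖y‖ ≤ 1 / 4 := by linarith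
        calc ‖3 * y ^ 2 - 2 * y ^ 3‖ ≤ ‖3 * y ^ 2‖ + ‖2 * y ^ 3‖ := norm_sub_le _ _
          _ = ‖y‖ * (3 * ‖y‖ + 2 * ‖y‖ ^ 2) := by simp; ring
          _ ≤ ‖y‖ * (7 / 8) := by gcongr; nlinarith [norm_nonneg y]
          _ ≤ (1 / 4 * (7 / 8) ^ s) * (7 / 8) := by gcongr
          _ = _ := by ring
      refine ⟨fun w => 3 * χ w ^ 2 - 2 * χ w ^ 3,
        ((Ent.const 3).mul (hχ.pow 2)).sub ((Ent.const 2).mul (hχ.pow 3)),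
        fun w hw => hb _ (h0 w hw), fun w hw => ?_, fun w hw => by simp [hz w hw]⟩
      have := hb (1 - χ w) (by rw [norm_sub_rev]; exact h1 w hw)
      convert this using 1
      rw [← norm_neg]
      congr 1
      ring
  obtain ⟨s, hs⟩ := exists_pow_lt_of_lt_one (y := (7 / 8 : ℝ)) hε (by norm_num)
  obtain ⟨χ, hχ, h0, h1, hz⟩ := key s
  have : (1 / 4 : ℝ) * (7 / 8) ^ s ≤ ε := by
    have : (0 : ℝ) ≤ (7 / 8) ^ s := by positivity
    linarith
  exact ⟨χ, hχ, fun w hw => (h0 w hw).trans this, fun w hw => (h1 w hw).trans this, hz⟩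

end Flows

section LocalFlows

variable {ι : Type*} [Fintype ι] [Nontrivial ι]

/-- A flow of an entire vector field can be cut off away from a set separated by an entire
function. -/
theorem exists_cutoff_flow {q : (ι → ℂ) → ℂ} (hq : Ent q) {Y : (ι → ℂ) → (ι → ℂ)}
    (hY : ∀ i, Ent fun w => Y w i) {L R B δ η : ℝ} (hL : 0 ≤ L)
    (hlip : ∀ a b, ‖Y a - Y b‖ ≤ L * ‖a - b‖) {S : Set (ι → ℂ)} (hSR : ∀ w ∈ S, ‖w‖ ≤ R)
    (hδ : 0 < δ) (hS : ∀ a ∈ S, ∀ w, ‖w - a‖ ≤ δ → ‖q w‖ ≤ 1 / 4) {Ω : Type*}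
    {γ : Ω → ℝ → (ι → ℂ)}
    (hγ : ∀ ω t h, 0 ≤ t → 0 ≤ h → t + h ≤ 1 →
      ‖γ ω (t + h) - γ ω t - (h : ℂ) • Y (γ ω t)‖ ≤ B * h ^ 2)
    (hR : ∀ ω t, 0 ≤ t → t ≤ 1 → ‖γ ω t‖ ≤ R)
    (hγq : ∀ ω t w, 0 ≤ t → t ≤ 1 → ‖w - γ ω t‖ ≤ δ → ‖q w - 1‖ ≤ 1 / 4) (hη : 0 < η) :
    ∃ A : (ι → ℂ) ≃ₜ (ι → ℂ), IsAut A ∧ (∀ w ∈ S, ‖A w - w‖ ≤ η) ∧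
      ∀ ω, ‖A (γ ω 0) - γ ω 1‖ ≤ η := by
  have hYc : Continuous Y := continuous_pi fun i => (hY i).continuous
  obtain ⟨C, hC, hCY⟩ := exists_bound_closedBall hYc (R + δ)
  set η' := min η δ / (3 * Real.exp L) with hη'
  have hη'pos : 0 < η' := by positivity
  have hη'e : 3 * η' * Real.exp L = min η δ := by rw [hη']; field_simp
  obtain ⟨χ, hχ, h0, h1, -⟩ := hq.exists_sharpen (ε := η' / C) (by positivity)
  have hX : Gen fun w => χ w • Y w := gen_of_ent fun i => hχ.mul (hY i)
  have hb : ∀ a w : ι → ℂ, ‖a‖ ≤ R → ‖w - a‖ ≤ δ → ‖Y w‖ ≤ C := fun a w ha hw =>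
    hCY w (by
      calc ‖w‖ = ‖a + (w - a)‖ := by congr 1; abel
        _ ≤ _ := (norm_add_le _ _).trans (add_le_add ha hw))
  have key := hX.exists_flow (Ω := S ⊕ Ω)
    (Y := fun ω => Sum.elim (fun _ _ => 0) (fun _ => Y) ω)
    (γ := fun ω => Sum.elim (fun s _ => s.1) γ ω) (L := L) (R := R) (B := max B 0) (η := η')
    (δ := δ) hL hη'pos ?_ ?_ ?_ ?_ (by rw [hη'e]; exact min_le_right _ _)
  · obtain ⟨A, hA, HA⟩ := key
    rw [hη'e] at HA
    exact ⟨A, hA, fun w hw => (HA (Sum.inl ⟨w, hw⟩)).trans (min_le_left _ _),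
      fun ω => (HA (Sum.inr ω)).trans (min_le_left _ _)⟩
  · rintro (s | ω) a b
    · simp; positivity
    · exact hlip a b
  · rintro (s | ω) t h ht hh hth
    · simp; positivity
    · refine (hγ ω t h ht hh hth).trans ?_
      gcongr
      exact le_max_left _ _
  · rintro (s | ω) t h0 h1
    · exact hSR _ s.2
    · exact hR ω t h0 h1
  · rintro (s | ω) t w ht0 ht1 hw
    · have h2 := hb _ w (hSR _ s.2) hw
      have h3 := h0 w (hS _ s.2 w hw)
      simp only [Sum.elim_inl, sub_zero, norm_smul]
      calc _ ≤ η' / C * C := by gcongr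
        _ = η' := by field_simp
    · have h2 := hb _ w (hR ω t ht0 ht1) hw
      have h3 := h1 w (hγq ω t w ht0 ht1 hw)
      have e : χ w • Y w - Y w = (χ w - 1) • Y w := by rw [sub_smul, one_smul]
      simp only [Sum.elim_inr, e, norm_smul]
      calc _ ≤ η' / C * C := by gcongr
        _ = η' := by field_simp

omit [Nontrivial ι] in
theorem exists_near_subset {V : Type*} [NormedAddCommGroup V] {K U : Set V} (hK : IsCompact K)
    (hU : IsOpen U) (hKU : K ⊆ U) : ∃ δ > 0, ∀ a ∈ K, ∀ w, ‖w - a‖ ≤ δ → w ∈ U := by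
  obtain ⟨δ, hδ, h⟩ := hK.exists_cthickening_subset_open hU hKU
  refine ⟨δ, hδ, fun a ha w hw => h ?_⟩
  exact mem_cthickening_of_dist_le w a δ K ha (by rwa [dist_eq_norm])

omit [Nontrivial ι] in
theorem exists_norm_le_of_isCompact {V : Type*} [NormedAddCommGroup V] {K : Set V}
    (hK : IsCompact K) : ∃ R > 0, ∀ a ∈ K, ‖a‖ ≤ R := by
  obtain ⟨R, hR⟩ := hK.isBounded.exists_norm_le
  exact ⟨|R| + 1, by positivity, fun a ha => (hR a ha).trans (by linarith [le_abs_self R])⟩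

/-- `q₁` can be reached from `q₀` by automorphisms close to the identity near `K` and close to a
translation near `q₀`. -/
def Reach (K : Set (ι → ℂ)) (q₀ q₁ : ι → ℂ) : Prop :=
  ∃ δ > 0, ∀ η > 0, ∃ A : (ι → ℂ) ≃ₜ (ι → ℂ), IsAut A ∧
    (∀ a ∈ K, ∀ w, ‖w - a‖ ≤ δ → ‖A w - w‖ ≤ η) ∧
    ∀ w, ‖w - q₀‖ ≤ δ → ‖A w - (w + (q₁ - q₀))‖ ≤ η

omit [Nontrivial ι] in
theorem Reach.trans {K : Set (ι → ℂ)} {a b c : ι → ℂ} (h : Reach K a b) (h' : Reach K b c) :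
    Reach K a c := by
  obtain ⟨δ, hδ, H⟩ := h
  obtain ⟨δ', hδ', H'⟩ := h'
  refine ⟨min δ (δ' / 2), by positivity, fun η hη => ?_⟩
  obtain ⟨A, hA, hAK, hAa⟩ := H (min (η / 2) (δ' / 2)) (by positivity)
  obtain ⟨A', hA', hAK', hAa'⟩ := H' (η / 2) (by positivity)
  refine ⟨A.trans A', hA.trans hA', fun x hx w hw => ?_, fun w hw => ?_⟩
  · have h1 := hAK x hx w (hw.trans (min_le_left _ _))
    have h2 := hAK' x hx (A w) (by
      calc ‖A w - x‖ = ‖(A w - w) + (w - x)‖ := by congr 1; abel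
        _ ≤ _ := (norm_add_le _ _).trans (add_le_add (h1.trans (min_le_right _ _))
          (hw.trans (min_le_right _ _)))
        _ = δ' := by ring)
    calc ‖A' (A w) - w‖ = ‖(A' (A w) - A w) + (A w - w)‖ := by congr 1; abel
      _ ≤ _ := (norm_add_le _ _).trans (add_le_add h2 (h1.trans (min_le_left _ _)))
      _ = η := by ring
  · have h1 := hAa w (hw.trans (min_le_left _ _))
    have h2 := hAa' (A w) (by
      calc ‖A w - b‖ = ‖(A w - (w + (b - a))) + (w - a)‖ := by congr 1; abel
        _ ≤ _ := (norm_add_le _ _).trans (add_le_add (h1.trans (min_le_right _ _))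
          (hw.trans (min_le_right _ _)))
        _ = δ' := by ring)
    calc ‖A' (A w) - (w + (c - a))‖ =
        ‖(A' (A w) - (A w + (c - b))) + (A w - (w + (b - a)))‖ := by congr 1; abel
      _ ≤ _ := (norm_add_le _ _).trans (add_le_add h2 (h1.trans (min_le_left _ _)))
      _ = η := by ring

/-- Points close to a point separated from `K` by an entire function can be reached from each
other. -/
theorem exists_reach {q : (ι → ℂ) → ℂ} (hq : Ent q) {K : Set (ι → ℂ)} (hK : IsCompact K)
    (hqK : ∀ a ∈ K, ‖q a‖ < 1 / 4) {e : ι → ℂ} (he : q e = 1) :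
    ∃ δ > 0, ∀ a b, ‖a - e‖ ≤ δ → ‖b - e‖ ≤ δ → Reach K a b := by
  obtain ⟨δ₁, hδ₁, h₁⟩ := exists_near_subset hK
    (U := {w | ‖q w‖ < 1 / 4}) (isOpen_lt hq.continuous.norm continuous_const) hqK
  obtain ⟨δ₂, hδ₂, h₂⟩ := exists_near_subset (isCompact_singleton (x := e))
    (U := {w | ‖q w - 1‖ < 1 / 4})
    (isOpen_lt (hq.continuous.sub continuous_const).norm continuous_const) (by simp [he])
  obtain ⟨R, hR, hKR⟩ := exists_norm_le_of_isCompact hK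
  set δ := min δ₁ δ₂ / 6 with hδ
  have hδpos : 0 < δ := by positivity
  have hd1 : 6 * δ ≤ δ₁ := by rw [hδ]; linarith [min_le_left δ₁ δ₂]
  have hd2 : 6 * δ ≤ δ₂ := by rw [hδ]; linarith [min_le_right δ₁ δ₂]
  refine ⟨δ, hδpos, fun a b ha hb => ⟨δ, hδpos, fun η hη => ?_⟩⟩
  have hab : ‖b - a‖ ≤ 2 * δ := by
    calc ‖b - a‖ = ‖(b - e) - (a - e)‖ := by congr 1; abel
      _ ≤ _ := (norm_sub_le _ _).trans (add_le_add hb ha)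
      _ = _ := by ring
  have hnear : ∀ w : {w // ‖w - a‖ ≤ δ}, ∀ t : ℝ, 0 ≤ t → t ≤ 1 →
      ‖w.1 + (t : ℂ) • (b - a) - e‖ ≤ 4 * δ := fun w t h0 h1 => by
    calc ‖w.1 + (t : ℂ) • (b - a) - e‖ = ‖(w.1 - a) + (a - e) + (t : ℂ) • (b - a)‖ := by
          congr 1; abel
      _ ≤ δ + δ + 1 * (2 * δ) := by
          refine (norm_add_le _ _).trans (add_le_add ((norm_add_le _ _).trans
            (add_le_add w.2 ha)) ?_)
          rw [norm_real_smul h0]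
          gcongr
      _ = _ := by ring
  have key := exists_cutoff_flow hq (Y := fun _ => b - a)
    (fun i => Ent.const _) (L := 0) (R := R + ‖e‖ + 4 * δ) (B := 0) (δ := δ) (η := η) le_rfl
    (by simp) (S := {w | ∃ a ∈ K, ‖w - a‖ ≤ δ}) ?_ hδpos ?_ (Ω := {w // ‖w - a‖ ≤ δ})
    (γ := fun w t => w.1 + (t : ℂ) • (b - a)) ?_ ?_ ?_ hη
  · obtain ⟨A, hA, hAS, hAγ⟩ := key
    refine ⟨A, hA, fun x hx w hw => hAS w ⟨x, hx, hw⟩, fun w hw => ?_⟩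
    simpa using hAγ ⟨w, hw⟩
  · rintro w ⟨x, hx, hw⟩
    calc ‖w‖ = ‖x + (w - x)‖ := by congr 1; abel
      _ ≤ R + δ := (norm_add_le _ _).trans (add_le_add (hKR x hx) hw)
      _ ≤ _ := by linarith [norm_nonneg e]
  · rintro w ⟨x, hx, hw⟩ z hz
    refine (h₁ x hx z ?_).le
    calc ‖z - x‖ = ‖(z - w) + (w - x)‖ := by congr 1; abel
      _ ≤ δ + δ := (norm_add_le _ _).trans (add_le_add hz hw)
      _ ≤ _ := by linarith
  · intro w t h _ _ _
    have : w.1 + ((t + h : ℝ) : ℂ) • (b - a) - (w.1 + (t : ℂ) • (b - a)) - (h : ℂ) • (b - a) =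
        0 := by
      push_cast; rw [add_smul]; abel
    rw [this]; simp
  · intro w t h0 h1
    calc ‖w.1 + (t : ℂ) • (b - a)‖ = ‖e + (w.1 + (t : ℂ) • (b - a) - e)‖ := by congr 1; abel
      _ ≤ _ := (norm_add_le _ _).trans (add_le_add le_rfl (hnear w t h0 h1))
      _ ≤ _ := by linarith
  · intro w t z h0 h1 hz
    refine (h₂ e rfl z ?_).le
    calc ‖z - e‖ = ‖(z - (w.1 + (t : ℂ) • (b - a))) + (w.1 + (t : ℂ) • (b - a) - e)‖ := by
          congr 1; abel
      _ ≤ _ := (norm_add_le _ _).trans (add_le_add hz (hnear w t h0 h1))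
      _ ≤ _ := by linarith

theorem reach_of_isPreconnected {K S : Set (ι → ℂ)} (hK : IsCompact K) (hS : IsPreconnected S)
    (hq : ∀ e ∈ S, ∃ q, Ent q ∧ (∀ a ∈ K, ‖q a‖ < 1 / 4) ∧ q e = 1) {a b : ι → ℂ} (ha : a ∈ S)
    (hb : b ∈ S) : Reach K a b := by
  refine (hS.induction₂ (fun x y => Reach K x y ∧ Reach K y x) (fun x hx => ?_)
    (fun x y z _ _ _ h h' => ⟨h.1.trans h'.1, h'.2.trans h.2⟩) (fun x y _ _ h => ⟨h.2, h.1⟩)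
    ha hb).1
  obtain ⟨q, hqE, hqK, hqx⟩ := hq x hx
  obtain ⟨δ, hδ, H⟩ := exists_reach hqE hK hqK hqx
  filter_upwards [mem_nhdsWithin_of_mem_nhds (closedBall_mem_nhds x hδ)] with y hy
  rw [mem_closedBall, dist_eq_norm] at hy
  exact ⟨H x y (by simpa using hδ.le) hy, H y x hy (by simpa using hδ.le)⟩

end LocalFlows

section Expansion

variable {ι : Type*} [Fintype ι] [Nontrivial ι]

omit [Nontrivial ι] in
theorem isCompact_planar_disc {P : (ι → ℂ) →L[ℂ] (ι → ℂ)} (c : ι → ℂ) (s : ℝ) :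
    IsCompact {w | ∃ u, P u = u ∧ ‖u‖ ≤ s ∧ w = c + u} := by
  have h : IsCompact (closedBall (0 : ι → ℂ) s ∩ {u | P u = u}) :=
    (isCompact_closedBall _ _).inter_right (isClosed_eq P.continuous continuous_id)
  convert h.image (continuous_const_add c) using 1
  ext w
  simp only [mem_image, mem_inter_iff, mem_closedBall, dist_zero_right]
  exact ⟨fun ⟨u, h1, h2, h3⟩ => ⟨u, ⟨h2, h1⟩, h3.symm⟩,
    fun ⟨u, ⟨h2, h1⟩, h3⟩ => ⟨u, h1, h2, h3.symm⟩⟩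

theorem exp_sub_one_sub_le {x : ℝ} (hx : 0 ≤ x) : |Real.exp x - 1 - x| ≤ x ^ 2 * Real.exp x := by
  have h0 := Real.add_one_le_exp x
  have h1 := Real.add_one_le_exp (-x)
  have h2 : Real.exp (-x) * Real.exp x = 1 := by rw [← Real.exp_add]; simp
  have h3 : Real.exp x - 1 ≤ x * Real.exp x := by nlinarith [Real.exp_pos x]
  rw [abs_of_nonneg (by linarith)]
  nlinarith

/-- Expansion along a planar disc by automorphisms close to the identity near `K`. -/
theorem exists_expansion {q : (ι → ℂ) → ℂ} (hq : Ent q) {K : Set (ι → ℂ)} (hK : IsCompact K)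
    (hqK : ∀ a ∈ K, ‖q a‖ < 1 / 4) {P : (ι → ℂ) →L[ℂ] (ι → ℂ)} (hP : ∀ u, P (P u) = P u)
    (hP1 : ∀ u, ‖P u‖ ≤ ‖u‖) {c : ι → ℂ} {s : ℝ} (hs : 0 ≤ s)
    (hqD : ∀ u, P u = u → ‖u‖ ≤ s → ‖q (c + u) - 1‖ < 1 / 4) :
    ∃ δ > 0, ∀ c', ‖c' - c‖ ≤ δ → ∀ τ : ℝ, 0 ≤ τ → ∀ η > 0,
      ∃ A : (ι → ℂ) ≃ₜ (ι → ℂ), IsAut A ∧ (∀ a ∈ K, ∀ w, ‖w - a‖ ≤ δ → ‖A w - w‖ ≤ η) ∧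
      ∀ v, ‖P v‖ ≤ Real.exp (-τ) * (s + δ) → ‖v - P v‖ ≤ δ →
        ‖A (c' + v) - (c' + ((Real.exp τ : ℝ) : ℂ) • P v + (v - P v))‖ ≤ η := by
  obtain ⟨δ₁, hδ₁, h₁⟩ := exists_near_subset hK
    (U := {w | ‖q w‖ < 1 / 4}) (isOpen_lt hq.continuous.norm continuous_const) hqK
  obtain ⟨δ₂, hδ₂, h₂⟩ := exists_near_subset (isCompact_planar_disc (P := P) c s)
    (U := {w | ‖q w - 1‖ < 1 / 4})
    (isOpen_lt (hq.continuous.sub continuous_const).norm continuous_const)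
    (by rintro _ ⟨u, h1, h2, rfl⟩; exact hqD u h1 h2)
  obtain ⟨R, hR, hKR⟩ := exists_norm_le_of_isCompact hK
  set δ := min δ₁ δ₂ / 6 with hδ
  have hδpos : 0 < δ := by positivity
  have hd1 : 6 * δ ≤ δ₁ := by rw [hδ]; linarith [min_le_left δ₁ δ₂]
  have hd2 : 6 * δ ≤ δ₂ := by rw [hδ]; linarith [min_le_right δ₁ δ₂]
  refine ⟨δ, hδpos, fun c' hc' τ hτ η hη => ?_⟩
  set T := {v : ι → ℂ // ‖P v‖ ≤ Real.exp (-τ) * (s + δ) ∧ ‖v - P v‖ ≤ δ} with hT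
  set γ : T → ℝ → (ι → ℂ) := fun v t =>
    c' + ((Real.exp (τ * t) : ℝ) : ℂ) • P v.1 + (v.1 - P v.1) with hγ
  have hcancel : Real.exp τ * (Real.exp (-τ) * (s + δ)) = s + δ := by
    rw [← mul_assoc, ← Real.exp_add]; simp
  have hexp : ∀ (v : T) (t : ℝ), t ≤ 1 → Real.exp (τ * t) * ‖P v.1‖ ≤ s + δ := fun v t ht => by
    refine le_trans (mul_le_mul (Real.exp_le_exp.2 ?_) v.2.1 (norm_nonneg _)
      (Real.exp_pos τ).le) hcancel.le
    nlinarith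
  have hnear : ∀ (v : T) (t : ℝ), t ≤ 1 → ∃ u, P u = u ∧ ‖u‖ ≤ s ∧ ‖γ v t - (c + u)‖ ≤ 3 * δ := by
    intro v t ht
    set x := ((Real.exp (τ * t) : ℝ) : ℂ) • P v.1 with hx
    have hxn : ‖x‖ ≤ s + δ := by
      rw [hx, norm_real_smul (Real.exp_pos _).le]; exact hexp v t ht
    have hx0 := norm_nonneg x
    refine ⟨((s / (s + δ) : ℝ) : ℂ) • x, by simp [hx, hP], ?_, ?_⟩
    · rw [norm_real_smul (by positivity), div_mul_eq_mul_div, div_le_iff₀ (by positivity)]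
      gcongr
    · have e : γ v t - (c + ((s / (s + δ) : ℝ) : ℂ) • x) =
          (c' - c) + ((δ / (s + δ) : ℝ) : ℂ) • x + (v.1 - P v.1) := by
        have : ((δ / (s + δ) : ℝ) : ℂ) = 1 - ((s / (s + δ) : ℝ) : ℂ) := by
          rw [← Complex.ofReal_one, ← Complex.ofReal_sub]
          congr 1
          field_simp
          ring
        rw [this, sub_smul, one_smul]
        simp only [hγ, ← hx]
        abel
      rw [e]
      have : ‖((δ / (s + δ) : ℝ) : ℂ) • x‖ ≤ δ := by
        rw [norm_real_smul (by positivity), div_mul_eq_mul_div, div_le_iff₀ (by positivity)]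
        gcongr
      calc _ ≤ δ + δ + δ := (norm_add_le _ _).trans (add_le_add ((norm_add_le _ _).trans
            (add_le_add hc' this)) v.2.2)
        _ = _ := by ring
  have key := exists_cutoff_flow hq (Y := fun w => (τ : ℂ) • P (w - c'))
    (L := τ) (R := R + ‖c‖ + s + 3 * δ) (B := τ ^ 2 * (s + δ)) (δ := δ) (η := η)
    ?_ hτ ?_ (S := {w | ∃ a ∈ K, ‖w - a‖ ≤ δ}) ?_ hδpos ?_ (Ω := T) (γ := γ) ?_ ?_ ?_ hη
  · obtain ⟨A, hA, hAS, hAγ⟩ := key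
    refine ⟨A, hA, fun x hx w hw => hAS w ⟨x, hx, hw⟩, fun v hv1 hv2 => ?_⟩
    have := hAγ ⟨v, hv1, hv2⟩
    simp only [hγ, mul_zero, mul_one, Real.exp_zero, Complex.ofReal_one, one_smul] at this
    rwa [show c' + P v + (v - P v) = c' + v by abel] at this
  · intro i
    have h1 : Ent fun w => P (w - c') i := by
      have := (Ent.linear ((ContinuousLinearMap.proj (R := ℂ) (φ := fun _ : ι => ℂ) i).comp P)).sub
        (Ent.const (P c' i))
      simpa using this
    exact (Ent.const (τ : ℂ)).mul h1
  · intro a b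
    rw [← smul_sub, ← map_sub, norm_real_smul hτ]
    gcongr
    simpa using hP1 (a - b)
  · rintro w ⟨x, hx, hw⟩
    calc ‖w‖ = ‖x + (w - x)‖ := by congr 1; abel
      _ ≤ R + δ := (norm_add_le _ _).trans (add_le_add (hKR x hx) hw)
      _ ≤ _ := by linarith [norm_nonneg c]
  · rintro w ⟨x, hx, hw⟩ z hz
    refine (h₁ x hx z ?_).le
    calc ‖z - x‖ = ‖(z - w) + (w - x)‖ := by congr 1; abel
      _ ≤ δ + δ := (norm_add_le _ _).trans (add_le_add hz hw)
      _ ≤ _ := by linarith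
  · intro v t h ht hh hth
    have e : γ v (t + h) - γ v t - (h : ℂ) • (τ : ℂ) • P (γ v t - c') =
        ((Real.exp (τ * t) * (Real.exp (τ * h) - 1 - τ * h) : ℝ) : ℂ) • P v.1 := by
      have h1 : P (γ v t - c') = ((Real.exp (τ * t) : ℝ) : ℂ) • P v.1 := by
        simp [hγ, hP]
      have h2 : Real.exp (τ * (t + h)) = Real.exp (τ * t) * Real.exp (τ * h) := by
        rw [← Real.exp_add]; ring_nf
      rw [h1]
      simp only [hγ, h2]
      push_cast
      module
    rw [e, norm_smul, Complex.norm_real, Real.norm_eq_abs, abs_mul, abs_of_pos (Real.exp_pos _)]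
    calc _ ≤ Real.exp (τ * t) * ((τ * h) ^ 2 * Real.exp (τ * h)) * ‖P v.1‖ := by
          gcongr
          exact exp_sub_one_sub_le (by positivity)
      _ = (τ * h) ^ 2 * (Real.exp (τ * (t + h)) * ‖P v.1‖) := by
          rw [show τ * (t + h) = τ * t + τ * h by ring, Real.exp_add]; ring
      _ ≤ (τ * h) ^ 2 * (s + δ) := by
          gcongr
          exact hexp v _ hth
      _ = _ := by ring
  · intro v t h0 h1
    obtain ⟨u, hu, hus, hun⟩ := hnear v t h1
    calc ‖γ v t‖ = ‖c + u + (γ v t - (c + u))‖ := by congr 1; abel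
      _ ≤ ‖c‖ + s + 3 * δ := (norm_add_le _ _).trans (add_le_add ((norm_add_le _ _).trans
        (add_le_add le_rfl hus)) hun)
      _ ≤ _ := by linarith
  · intro v t z h0 h1 hz
    obtain ⟨u, hu, hus, hun⟩ := hnear v t h1
    refine (h₂ (c + u) ⟨u, hu, hus, rfl⟩ z ?_).le
    calc ‖z - (c + u)‖ = ‖(z - γ v t) + (γ v t - (c + u))‖ := by congr 1; abel
      _ ≤ δ + 3 * δ := (norm_add_le _ _).trans (add_le_add hz hun)
      _ ≤ _ := by linarith

end Expansion

section Connectivity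

variable {ι : Type*} [Fintype ι] [Nontrivial ι]

theorem countable_zeros {f : ℂ → ℂ} (hf : Differentiable ℂ f) {x : ℂ} (hx : f x ≠ 0) :
    {z | f z = 0}.Countable := by
  have h1 := AnalyticOnNhd.preimage_zero_mem_codiscrete (f := f)
    (fun z _ => hf.analyticAt z) hx
  have h2 : DiscreteTopology {z | f z = 0} := by
    rw [discreteTopology_subtype_iff]
    intro z _
    have := mem_codiscreteWithin_iff_forall_mem_nhdsNE.1 h1 z (mem_univ z)
    rw [← disjoint_iff, disjoint_principal_right]
    filter_upwards [this] with y hy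
    simpa using hy
  exact countable_of_Lindelof_of_discrete (X := {z | f z = 0})

omit [Nontrivial ι] in
theorem exists_preconnected {u : (ι → ℂ) → ℂ} (hu : Differentiable ℂ u) {l : ι} {ρ : ℝ}
    (hρ : 0 < ρ) {e c : ι → ℂ} (he : ρ < ‖e l‖) (hue : u e ≠ 0) (hc : ρ < ‖c l‖) (huc : u c ≠ 0) :
    ∃ S : Set (ι → ℂ), IsPreconnected S ∧ e ∈ S ∧ c ∈ S ∧ ∀ w ∈ S, ρ < ‖w l‖ ∧ u w ≠ 0 := by
  classical
  have hρ0 : (ρ : ℂ) ≠ 0 := by exact_mod_cast hρ.ne'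
  have hlog : ∀ x : ι → ℂ, ρ < ‖x l‖ → ρ * Complex.exp (Complex.log (x l / ρ)) = x l ∧
      0 < (Complex.log (x l / ρ)).re := fun x hx => by
    have hx0 : x l ≠ 0 := norm_pos_iff.1 (hρ.trans hx)
    rw [Complex.exp_log (div_ne_zero hx0 hρ0), Complex.log_re, norm_div, Complex.norm_real,
      Real.norm_of_nonneg hρ.le]
    exact ⟨mul_div_cancel₀ _ hρ0, Real.log_pos ((one_lt_div hρ).2 hx)⟩
  obtain ⟨he1, he2⟩ := hlog e he
  set a := Complex.log (e l / ρ) with ha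
  obtain ⟨b, hb1, hb2, hab⟩ : ∃ b : ℂ, ρ * Complex.exp b = c l ∧ 0 < b.re ∧ b ≠ a := by
    obtain ⟨h1, h2⟩ := hlog c hc
    by_cases h : Complex.log (c l / ρ) = a
    · refine ⟨Complex.log (c l / ρ) + 2 * Real.pi * Complex.I, ?_, ?_, ?_⟩
      · rw [Complex.exp_add, Complex.exp_two_pi_mul_I, mul_one, h1]
      · simpa using h2
      · rw [h]; simp [Real.pi_ne_zero]
    · exact ⟨_, h1, h2, h⟩
  set p : ℂ → (ι → ℂ) := fun s i => if i = l then ρ * Complex.exp s else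
    e i + (s - a) / (b - a) * (c i - e i) with hp
  have hpd : Differentiable ℂ p := by
    refine differentiable_pi.2 fun i => ?_
    by_cases h : i = l
    · simp only [hp, h, if_true]; fun_prop
    · simp only [hp, h, if_false]; fun_prop
  have hpa : p a = e := by
    ext i
    by_cases h : i = l
    · simp [hp, h, he1]
    · simp [hp, h]
  have hpb : p b = c := by
    ext i
    by_cases h : i = l
    · simp [hp, h, hb1]
    · simp [hp, h, div_self (sub_ne_zero.2 hab)]
  set φ : ℂ → ℂ := fun ξ => (Real.exp ξ.re : ℝ) + (ξ.im : ℝ) * Complex.I with hφ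
  have hφre : ∀ ξ, (φ ξ).re = Real.exp ξ.re := fun ξ => by
    simp only [hφ, Complex.add_re, Complex.ofReal_re, Complex.mul_re, Complex.I_re, Complex.I_im,
      Complex.ofReal_im]
    ring
  have hφim : ∀ ξ, (φ ξ).im = ξ.im := fun ξ => by
    simp only [hφ, Complex.add_im, Complex.ofReal_im, Complex.mul_im, Complex.I_re, Complex.I_im,
      Complex.ofReal_re]
    ring
  have hφc : Continuous φ := by
    simp only [hφ]
    fun_prop
  have hφi : Function.Injective φ := fun x y h => by
    refine Complex.ext (Real.exp_injective ?_) ?_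
    · rw [← hφre, ← hφre y, h]
    · rw [← hφim x, ← hφim y, h]
  have hφs : ∀ s : ℂ, 0 < s.re → ∃ ξ, φ ξ = s := fun s hs =>
    ⟨⟨Real.log s.re, s.im⟩, Complex.ext (by rw [hφre, Real.exp_log hs]) (by rw [hφim])⟩
  have hZ : ({ξ | u (p (φ ξ)) = 0} : Set ℂ).Countable :=
    (countable_zeros (hu.comp hpd) (x := a) (by simpa [hpa] using hue)).preimage hφi
  have hconn := Set.Countable.isConnected_compl_of_one_lt_rank (E := ℂ) (by simp) hZ
  refine ⟨(fun ξ => p (φ ξ)) '' {ξ | u (p (φ ξ)) = 0}ᶜ,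
    hconn.isPreconnected.image _ (hpd.continuous.comp hφc).continuousOn, ?_, ?_, ?_⟩
  · obtain ⟨ξ, hξ⟩ := hφs a he2
    exact ⟨ξ, by simpa [hξ, hpa] using hue, by simp [hξ, hpa]⟩
  · obtain ⟨ξ, hξ⟩ := hφs b hb2
    exact ⟨ξ, by simpa [hξ, hpb] using huc, by simp [hξ, hpb]⟩
  · rintro _ ⟨ξ, hξ, rfl⟩
    refine ⟨?_, hξ⟩
    simp only [hp, if_true, norm_mul, Complex.norm_real, Real.norm_of_nonneg hρ.le,
      Complex.norm_exp, hφre]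
    have : 1 < Real.exp (Real.exp ξ.re) := Real.one_lt_exp_iff.2 (Real.exp_pos _)
    nlinarith

omit [Nontrivial ι] in
/-- A function separating a point from a compact set contained in `{‖w l‖ ≤ ρ} ∪ {u = 0}`. -/
theorem exists_separating {u : (ι → ℂ) → ℂ} (hu : Ent u) {l : ι} {ρ : ℝ} (hρ : 0 < ρ)
    {K : Set (ι → ℂ)} (hK : IsCompact K) (hKu : ∀ a ∈ K, ‖a l‖ ≤ ρ ∨ u a = 0) {e : ι → ℂ}
    (he : ρ < ‖e l‖) (hue : u e ≠ 0) {ε : ℝ} (hε : 0 < ε) :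
    ∃ N : ℕ, ∀ a ∈ K, ‖u a / u e * (a l / e l) ^ N‖ < ε := by
  obtain ⟨B, hB⟩ := hK.exists_bound_of_continuousOn hu.continuous.continuousOn
  have hel : 0 < ‖e l‖ := hρ.trans he
  have hr : ρ / ‖e l‖ < 1 := (div_lt_one hel).2 he
  have hu0 : 0 < ‖u e‖ := norm_pos_iff.2 hue
  obtain ⟨N, hN⟩ := exists_pow_lt_of_lt_one (y := ρ / ‖e l‖) (x := ε * ‖u e‖ / (|B| + 1))
    (by positivity) hr
  refine ⟨N, fun a ha => ?_⟩
  rcases hKu a ha with h | h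
  · rw [norm_mul, norm_div, norm_pow, norm_div]
    have h1 : ‖u a‖ ≤ |B| + 1 := (hB a ha).trans (by linarith [le_abs_self B])
    have h2 : (‖a l‖ / ‖e l‖) ^ N ≤ (ρ / ‖e l‖) ^ N := by gcongr
    calc _ ≤ (|B| + 1) / ‖u e‖ * (ρ / ‖e l‖) ^ N := by gcongr
      _ < (|B| + 1) / ‖u e‖ * (ε * ‖u e‖ / (|B| + 1)) := by gcongr
      _ = ε := by field_simp
  · simp [h, hε]

theorem reach_of_separating {u : (ι → ℂ) → ℂ} (hu : Ent u) {l : ι} {ρ : ℝ} (hρ : 0 < ρ)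
    {K : Set (ι → ℂ)} (hK : IsCompact K) (hKu : ∀ a ∈ K, ‖a l‖ ≤ ρ ∨ u a = 0) {e c : ι → ℂ}
    (he : ρ < ‖e l‖) (hue : u e ≠ 0) (hc : ρ < ‖c l‖) (huc : u c ≠ 0) : Reach K e c := by
  obtain ⟨S, hS, heS, hcS, h⟩ := exists_preconnected hu.differentiable hρ he hue hc huc
  refine reach_of_isPreconnected hK hS (fun x hx => ?_) heS hcS
  obtain ⟨hxl, hux⟩ := h x hx
  obtain ⟨N, hN⟩ := exists_separating hu hρ hK hKu hxl hux (ε := 1 / 4) (by norm_num)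
  refine ⟨fun w => u w / u x * (w l / x l) ^ N, ?_, hN, ?_⟩
  · simp_rw [div_eq_mul_inv]
    exact (hu.mul (Ent.const _)).mul (((Ent.coord l).mul (Ent.const _)).pow N)
  · have : x l ≠ 0 := norm_pos_iff.1 (hρ.trans hxl)
    simp [hux, this]

end Connectivity

section Splittings

variable {κ μ : Type*}

/-- The embedding of the coordinate plane spanned by the first block of a splitting. -/
def embJ (e : κ ⊕ μ ≃ κ ⊕ μ) : (κ → ℂ) →L[ℂ] (κ ⊕ μ → ℂ) :=
  ContinuousLinearMap.pi fun i =>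
    Sum.elim (fun a => ContinuousLinearMap.proj (R := ℂ) (φ := fun _ : κ => ℂ) a) (fun _ => 0)
      (e.symm i)

/-- The projection onto the first block of a splitting. -/
def projJ (e : κ ⊕ μ ≃ κ ⊕ μ) : (κ ⊕ μ → ℂ) →L[ℂ] (κ → ℂ) :=
  ContinuousLinearMap.pi fun a =>
    ContinuousLinearMap.proj (R := ℂ) (φ := fun _ : κ ⊕ μ => ℂ) (e (Sum.inl a))

/-- The projection onto the second block of a splitting. -/
def projI (e : κ ⊕ μ ≃ κ ⊕ μ) : (κ ⊕ μ → ℂ) →L[ℂ] (μ → ℂ) :=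
  ContinuousLinearMap.pi fun b =>
    ContinuousLinearMap.proj (R := ℂ) (φ := fun _ : κ ⊕ μ => ℂ) (e (Sum.inr b))

@[simp] theorem embJ_inl (e : κ ⊕ μ ≃ κ ⊕ μ) (u : κ → ℂ) (a : κ) :
    embJ e u (e (Sum.inl a)) = u a := by simp [embJ]

@[simp] theorem embJ_inr (e : κ ⊕ μ ≃ κ ⊕ μ) (u : κ → ℂ) (b : μ) :
    embJ e u (e (Sum.inr b)) = 0 := by simp [embJ]

@[simp] theorem projJ_apply (e : κ ⊕ μ ≃ κ ⊕ μ) (w : κ ⊕ μ → ℂ) (a : κ) :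
    projJ e w a = w (e (Sum.inl a)) := rfl

@[simp] theorem projI_apply (e : κ ⊕ μ ≃ κ ⊕ μ) (w : κ ⊕ μ → ℂ) (b : μ) :
    projI e w b = w (e (Sum.inr b)) := rfl

variable (κ μ) in
/-- The inclusion of the first block. -/
abbrev incl : (κ → ℂ) →L[ℂ] (κ ⊕ μ → ℂ) := embJ (Equiv.refl _)

@[simp] theorem incl_inl (u : κ → ℂ) (a : κ) : incl κ μ u (Sum.inl a) = u a :=
  embJ_inl (Equiv.refl _) u a

@[simp] theorem incl_inr (u : κ → ℂ) (b : μ) : incl κ μ u (Sum.inr b) = 0 :=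
  embJ_inr (Equiv.refl _) u b

@[simp] theorem projJ_embJ (e : κ ⊕ μ ≃ κ ⊕ μ) (u : κ → ℂ) : projJ e (embJ e u) = u := by
  ext a; simp

@[simp] theorem projI_embJ (e : κ ⊕ μ ≃ κ ⊕ μ) (u : κ → ℂ) : projI e (embJ e u) = 0 := by
  ext a; simp

theorem splitting_ext (e : κ ⊕ μ ≃ κ ⊕ μ) {w z : κ ⊕ μ → ℂ} (hJ : projJ e w = projJ e z)
    (hI : projI e w = projI e z) : w = z := by
  ext i
  obtain ⟨i, rfl⟩ := e.surjective i
  rcases i with a | b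
  · exact congrFun hJ a
  · exact congrFun hI b

variable [Fintype κ] [Fintype μ]

theorem norm_embJ (e : κ ⊕ μ ≃ κ ⊕ μ) (u : κ → ℂ) : ‖embJ e u‖ ≤ ‖u‖ := by
  refine (pi_norm_le_iff_of_nonneg (norm_nonneg _)).2 fun i => ?_
  obtain ⟨i, rfl⟩ := e.surjective i
  rcases i with a | b
  · rw [embJ_inl]; exact norm_le_pi_norm u a
  · rw [embJ_inr]; simp

theorem norm_projJ (e : κ ⊕ μ ≃ κ ⊕ μ) (w : κ ⊕ μ → ℂ) : ‖projJ e w‖ ≤ ‖w‖ :=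
  (pi_norm_le_iff_of_nonneg (norm_nonneg _)).2 fun _ => norm_le_pi_norm w _

theorem norm_projI (e : κ ⊕ μ ≃ κ ⊕ μ) (w : κ ⊕ μ → ℂ) : ‖projI e w‖ ≤ ‖w‖ :=
  (pi_norm_le_iff_of_nonneg (norm_nonneg _)).2 fun _ => norm_le_pi_norm w _

theorem norm_sub_embJ_projJ (e : κ ⊕ μ ≃ κ ⊕ μ) (w : κ ⊕ μ → ℂ) :
    ‖w - embJ e (projJ e w)‖ ≤ ‖w‖ := by
  refine (pi_norm_le_iff_of_nonneg (norm_nonneg _)).2 fun i => ?_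
  obtain ⟨i, rfl⟩ := e.surjective i
  rcases i with a | b
  · simp
  · simpa using norm_le_pi_norm w _

/-- The embedding attached to `Ψ` is transverse at the origin to the second block of the
splitting. -/
def Transverse (Ψ : (κ ⊕ μ → ℂ) → (κ ⊕ μ → ℂ)) (e : κ ⊕ μ ≃ κ ⊕ μ) : Prop :=
  Function.Bijective (fderiv ℂ (fun ζ => projJ e (Ψ (incl κ μ ζ))) 0)

/-- A point far away in both the source and the target coordinates. -/
theorem exists_far_point [DecidableEq κ] [DecidableEq μ] {Ψ : (κ ⊕ μ → ℂ) ≃ₜ (κ ⊕ μ → ℂ)}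
    (hΨ : IsAut Ψ) (a : κ) (j : μ) (l : κ ⊕ μ) {R ρ : ℝ} (hR : 0 ≤ R) (hρ : 0 < ρ) :
    ∃ z : κ ⊕ μ → ℂ, R < ‖z (Sum.inl a)‖ ∧ ρ < ‖Ψ z l‖ ∧ z (Sum.inr j) ≠ 0 := by
  obtain ⟨z, hz1, hz2⟩ : ∃ z : κ ⊕ μ → ℂ, R < ‖z (Sum.inl a)‖ ∧ ρ < ‖Ψ z l‖ := by
    by_contra! hcon
    set z₀ := Ψ.symm (fun _ => ((2 * ρ : ℝ) : ℂ)) with hz₀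
    have h0 : ‖Ψ z₀ l‖ = 2 * ρ := by
      rw [hz₀, Ψ.apply_symm_apply, Complex.norm_real, Real.norm_of_nonneg (by positivity)]
    have hzR : ‖z₀ (Sum.inl a)‖ ≤ R := by
      by_contra! h
      linarith [hcon z₀ h]
    set f : ℂ → ℂ := fun t => Ψ (Function.update z₀ (Sum.inl a) t) l with hf
    have hfd : Differentiable ℂ f := by
      have h1 : Differentiable ℂ fun t : ℂ => Function.update z₀ (Sum.inl a) t :=
        fun t => (hasFDerivAt_update z₀ t).differentiableAt
      exact (differentiable_pi.1 hΨ.differentiable l).comp h1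
    have := Complex.norm_le_of_forall_mem_frontier_norm_le (U := ball (0 : ℂ) (R + 1)) (f := f)
      (C := ρ) isBounded_ball hfd.diffContOnCl (fun t ht => by
        rw [frontier_ball _ (by positivity), mem_sphere, dist_zero_right] at ht
        exact hcon _ (by simp [ht])) (z := z₀ (Sum.inl a))
        (subset_closure (by simpa using by linarith))
    simp only [hf, Function.update_eq_self, h0] at this
    linarith
  have hO1 : IsOpen {z : κ ⊕ μ → ℂ | R < ‖z (Sum.inl a)‖} :=
    isOpen_lt continuous_const (continuous_apply _).norm
  have hO2 : IsOpen {z : κ ⊕ μ → ℂ | ρ < ‖Ψ z l‖} :=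
    isOpen_lt continuous_const ((continuous_apply l).comp Ψ.continuous).norm
  obtain ⟨z, hz, hz3⟩ := exists_ne_zero_of_open (f := fun z : κ ⊕ μ → ℂ => z (Sum.inr j))
    isOpen_univ convex_univ (by fun_prop) (p := fun _ => 1) (mem_univ _) one_ne_zero (hO1.inter hO2)
    (subset_univ _) ⟨z, hz1, hz2⟩
  exact ⟨z, hz.1, hz.2, hz3⟩

/-- Twisting the embedding close to the identity on `K` so that it passes through a given far
point. -/
theorem exists_twist {Ψ : (κ ⊕ μ → ℂ) ≃ₜ (κ ⊕ μ → ℂ)} (hΨ : IsAut Ψ)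
    {K : Set (κ ⊕ μ → ℂ)} (hK : IsCompact K) [Nonempty κ] (j : μ) (l : κ ⊕ μ) {ρ : ℝ}
    (hρ : 0 < ρ) :
    ∃ p : κ ⊕ μ → ℂ, ρ < ‖p l‖ ∧ Ψ.symm p (Sum.inr j) ≠ 0 ∧ ∀ ε > 0,
      ∃ T : (κ ⊕ μ → ℂ) ≃ₜ (κ ⊕ μ → ℂ), IsAut T ∧ (∀ w ∈ K, ‖T w - w‖ ≤ ε) ∧
        (∃ ζ, T (Ψ (incl κ μ ζ)) = p) ∧
        ∀ e, Transverse Ψ e → Transverse (fun w => T (Ψ w)) e := by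
  classical
  obtain ⟨a⟩ := ‹Nonempty κ›
  obtain ⟨R, hR, hKR⟩ := exists_norm_le_of_isCompact (hK.image Ψ.symm.continuous)
  obtain ⟨z, hz1, hz2, hz3⟩ := exists_far_point hΨ a j l hR.le hρ
  refine ⟨Ψ z, hz2, by simpa using hz3, fun ε hε => ?_⟩
  set v : κ ⊕ μ → ℂ := Sum.elim 0 (fun b => z (Sum.inr b)) with hv
  set t := z (Sum.inl a) with ht
  have ht0 : 0 < ‖t‖ := hR.trans hz1
  have ht0' : t ≠ 0 := norm_pos_iff.1 ht0
  obtain ⟨δ, hδ, hunif⟩ := exists_unif_closedBall Ψ.continuous (R + 1) hε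
  obtain ⟨d, hd⟩ := exists_pow_lt_of_lt_one (x := min δ 1 / (‖v‖ + 1)) (y := R / ‖t‖)
    (by positivity) ((div_lt_one ht0).2 hz1)
  obtain ⟨S, hS, hSw⟩ := exists_shear (f := fun w : κ ⊕ μ → ℂ => (w (Sum.inl a) * t⁻¹) ^ (d + 2))
    (v := v) (((Ent.coord _).mul (Ent.const _)).pow _) (fun w c => by simp [hv])
  refine ⟨(Ψ.symm.trans S).trans Ψ, (hΨ.symm.trans hS).trans hΨ, fun w hw => ?_,
    ⟨fun b => z (Sum.inl b), ?_⟩, fun e he => ?_⟩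
  · have h1 : ‖Ψ.symm w‖ ≤ R := hKR _ (mem_image_of_mem _ hw)
    have h2 : ‖S (Ψ.symm w) - Ψ.symm w‖ ≤ min δ 1 := by
      rw [hSw, add_sub_cancel_left, norm_smul, norm_pow, norm_mul, norm_inv, ← div_eq_mul_inv]
      have h3 : ‖Ψ.symm w (Sum.inl a)‖ ≤ R := (norm_le_pi_norm _ _).trans h1
      have h5 : R / ‖t‖ ≤ 1 := ((div_lt_one ht0).2 hz1).le
      calc _ ≤ (R / ‖t‖) ^ (d + 2) * (‖v‖ + 1) := by gcongr; linarith
        _ ≤ (R / ‖t‖) ^ d * (‖v‖ + 1) := by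
          gcongr ?_ * _
          exact pow_le_pow_of_le_one (by positivity) h5 (by omega)
        _ ≤ min δ 1 / (‖v‖ + 1) * (‖v‖ + 1) := by gcongr
        _ = _ := by field_simp
    have h4 : ‖S (Ψ.symm w)‖ ≤ R + 1 := by
      calc ‖S (Ψ.symm w)‖ = ‖Ψ.symm w + (S (Ψ.symm w) - Ψ.symm w)‖ := by congr 1; abel
        _ ≤ _ := (norm_add_le _ _).trans (add_le_add h1 (h2.trans (min_le_right _ _)))
    have := hunif _ _ h4 (h1.trans (by linarith)) (h2.trans (min_le_left _ _))
    simpa using this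
  · simp only [Homeomorph.trans_apply, Homeomorph.symm_apply_apply, hSw]
    congr 1
    ext i
    rcases i with b | b
    · simp [hv]
    · simp [hv, ← ht, ht0']
  · have e1 : (fun ζ => projJ e (((Ψ.symm.trans S).trans Ψ) (Ψ (incl κ μ ζ)))) =
        fun ζ => projJ e (Ψ (incl κ μ ζ + (ζ a * t⁻¹) ^ (d + 2) • v)) := by
      ext1 ζ
      simp [hSw]
    have hin : HasFDerivAt (fun ζ : κ → ℂ => incl κ μ ζ + (ζ a * t⁻¹) ^ (d + 2) • v)
        (incl κ μ) 0 := by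
      have h1 : HasFDerivAt (fun ζ : κ → ℂ => ζ a * t⁻¹)
          (t⁻¹ • ContinuousLinearMap.proj (R := ℂ) (φ := fun _ : κ => ℂ) a) 0 :=
        (ContinuousLinearMap.proj (R := ℂ) (φ := fun _ : κ => ℂ) a).hasFDerivAt.mul_const t⁻¹
      have h2 := ((incl κ μ).hasFDerivAt (x := (0 : κ → ℂ))).add ((h1.pow (d + 2)).smul_const v)
      exact h2.congr_fderiv (by ext x i; simp)
    have hΨd : HasFDerivAt (fun w => projJ e (Ψ w)) ((projJ e).comp (fderiv ℂ Ψ 0))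
        (0 : κ ⊕ μ → ℂ) := (projJ e).hasFDerivAt.comp _ (hΨ.differentiable 0).hasFDerivAt
    have hA := HasFDerivAt.comp (0 : κ → ℂ) (g := fun w => projJ e (Ψ w))
      (by simpa using hΨd) hin
    have hB := HasFDerivAt.comp (0 : κ → ℂ) (g := fun w => projJ e (Ψ w))
      (by simpa using hΨd) ((incl κ μ).hasFDerivAt)
    unfold Transverse at he ⊢
    rw [e1]
    have hA' := hA.fderiv
    have hB' := hB.fderiv
    simp only [Function.comp_def] at hA' hB'
    rw [hA']
    rwa [hB'] at he

end Splittings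

section Placement

variable {κ μ : Type*} [Fintype κ] [Fintype μ]

set_option maxHeartbeats 1000000 in
/-- Moving a piece of the embedded plane close to a given coordinate disc, by an automorphism close
to the identity on a compact set. -/
theorem exists_place [DecidableEq κ] [Nonempty κ] [Nonempty μ]
    {Ψ : (κ ⊕ μ → ℂ) ≃ₜ (κ ⊕ μ → ℂ)} (hΨ : IsAut Ψ) {e : κ ⊕ μ ≃ κ ⊕ μ} (he : Transverse Ψ e)
    {l : κ ⊕ μ} {ρ : ℝ} (hρ : 0 < ρ) {K : Set (κ ⊕ μ → ℂ)} (hK : IsCompact K)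
    (hKΨ : ∀ a ∈ K, ‖a l‖ ≤ ρ ∨ ∃ ζ, Ψ (incl κ μ ζ) = a) {c : κ ⊕ μ → ℂ} (hc : ρ < ‖c l‖)
    {s : ℝ} (hs : 0 ≤ s) {q : (κ ⊕ μ → ℂ) → ℂ} (hq : Ent q) (hqK : ∀ a ∈ K, ‖q a‖ < 1 / 4)
    (hqD : ∀ u : κ → ℂ, ‖u‖ ≤ s → ‖q (c + embJ e u) - 1‖ < 1 / 4) {ε : ℝ} (hε : 0 < ε) :
    ∃ Φ : (κ ⊕ μ → ℂ) ≃ₜ (κ ⊕ μ → ℂ), IsAut Φ ∧ ∃ σ : (κ → ℂ) → (κ → ℂ), Differentiable ℂ σ ∧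
      (∀ a ∈ K, ‖Φ a - a‖ ≤ ε) ∧
      ∀ u, ‖u‖ ≤ s → ‖Φ (Ψ (incl κ μ (σ u))) - (c + embJ e u)‖ ≤ ε := by
  obtain ⟨j⟩ := ‹Nonempty μ›
  obtain ⟨a₀⟩ := ‹Nonempty κ›
  have : Nonempty κ := ⟨a₀⟩
  have : Nontrivial (κ ⊕ μ) := ⟨⟨Sum.inl a₀, Sum.inr j, by simp⟩⟩
  set P : (κ ⊕ μ → ℂ) →L[ℂ] (κ ⊕ μ → ℂ) := (embJ e).comp (projJ e) with hPdef
  have hPapp : ∀ w, P w = embJ e (projJ e w) := fun w => rfl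
  have hPn : ∀ w, ‖P w‖ ≤ ‖w‖ := fun w => (norm_embJ e _).trans (norm_projJ e w)
  obtain ⟨δE, hδE, hE⟩ := exists_expansion hq hK hqK (P := P) (fun u => by simp [hPapp]) hPn hs
    (c := c) (fun u hu hus => by
      rw [← hu, hPapp]
      exact hqD _ ((norm_projJ e u).trans hus))
  obtain ⟨p, hpl, hpj, hT⟩ := exists_twist hΨ hK j l hρ
  have hu : Ent fun w => Ψ.symm w (Sum.inr j) := hΨ.2 (Sum.inr j)
  have hO1 : IsOpen {w : κ ⊕ μ → ℂ | ρ < ‖w l‖} :=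
    isOpen_lt continuous_const (continuous_apply l).norm
  set m₁ := min δE ε with hm₁
  have hm₁pos : 0 < m₁ := by positivity
  obtain ⟨c', ⟨hc'c, hc'l⟩, hc'j⟩ := exists_ne_zero_of_open
    (f := fun w => Ψ.symm w (Sum.inr j)) isOpen_univ convex_univ hu.differentiable.differentiableOn
    (p := p) (mem_univ _) hpj ((isOpen_ball (x := c) (ε := m₁ / 8)).inter hO1) (subset_univ _)
    ⟨c, mem_ball_self (by positivity), hc⟩
  have hReach : Reach K p c' := reach_of_separating hu hρ hK (fun a ha => (hKΨ a ha).imp_right (by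
    rintro ⟨ζ, rfl⟩
    simp)) hpl hpj hc'l hc'j
  obtain ⟨δR, hδR, hR⟩ := hReach
  set m := min m₁ δR with hm
  have hmpos : 0 < m := by positivity
  have hmE : m ≤ δE := (min_le_left _ _).trans (min_le_left _ _)
  have hmε : m ≤ ε := (min_le_left _ _).trans (min_le_right _ _)
  have hmR : m ≤ δR := min_le_right _ _
  have hm₁E : m₁ ≤ δE := min_le_left _ _
  have hm₁ε : m₁ ≤ ε := min_le_right _ _
  obtain ⟨T, hTA, hTK, ⟨ζe, hζe⟩, hTt⟩ := hT (m / 8) (by positivity)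
  set G : (κ → ℂ) → (κ ⊕ μ → ℂ) := fun ζ => T (Ψ (incl κ μ ζ)) with hG
  have hGd : Differentiable ℂ G :=
    hTA.differentiable.comp (hΨ.differentiable.comp (incl κ μ).differentiable)
  have hO2 : IsOpen {ζ : κ → ℂ | ‖G ζ - p‖ < m / 8} :=
    isOpen_lt (hGd.continuous.sub continuous_const).norm continuous_const
  obtain ⟨ζ, hζ, hbij⟩ := exists_bijective_fderiv_of_open (G := fun ζ => projJ e (G ζ)) isOpen_univ
    convex_univ ((projJ e).differentiable.comp hGd).differentiableOn (mem_univ 0) (hTt e he) hO2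
    (subset_univ _) ⟨ζe, show ‖G ζe - p‖ < m / 8 by rw [hG]; simp only [hζe]; simpa using hmpos⟩
  replace hζ : ‖G ζ - p‖ < m / 8 := hζ
  set D := fderiv ℂ (fun ζ => projJ e (G ζ)) ζ with hD
  set DG := fderiv ℂ G ζ with hDG
  have hDDG : ∀ x, D x = projJ e (DG x) := fun x => by
    have := ((projJ e).hasFDerivAt.comp ζ (hGd ζ).hasFDerivAt).fderiv
    simp only [Function.comp_def] at this
    rw [hD, this]
    rfl
  set L : (κ → ℂ) →L[ℂ] (κ → ℂ) :=
    LinearMap.toContinuousLinearMap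
      (LinearEquiv.ofBijective (D : (κ → ℂ) →ₗ[ℂ] (κ → ℂ)) hbij).symm.toLinearMap with hL
  have hDL : ∀ u, D (L u) = u := fun u =>
    LinearEquiv.apply_symm_apply (LinearEquiv.ofBijective (D : (κ → ℂ) →ₗ[ℂ] (κ → ℂ)) hbij) u
  set B := ‖DG‖ * (‖L‖ * s) + m / 8 with hB
  have hBpos : 0 < B := by positivity
  have hlo := (hGd ζ).hasFDerivAt.isLittleO
  have hlo2 := hlo.def (c := m / 16 / (‖L‖ * s + 1)) (by positivity)
  obtain ⟨r, hr, hrem⟩ := Metric.eventually_nhds_iff.1 hlo2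
  set h := min 1 (min (m / 8 / B) (r / (2 * (‖L‖ * s + 1)))) with hh
  have hh0 : 0 < h := by positivity
  have hh1 : h ≤ 1 := min_le_left _ _
  have hhB : h * B ≤ m / 8 := by
    calc h * B ≤ m / 8 / B * B := by
          gcongr; exact (min_le_right _ _).trans (min_le_left _ _)
      _ = _ := by field_simp
  have hhr : h * (‖L‖ * s + 1) < r := by
    calc h * (‖L‖ * s + 1) ≤ r / (2 * (‖L‖ * s + 1)) * (‖L‖ * s + 1) := by
          gcongr; exact (min_le_right _ _).trans (min_le_right _ _)
      _ = r / 2 := by field_simp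
      _ < r := by linarith
  obtain ⟨A, hAA, hAK, hAp⟩ := hR (h * (m / 16)) (by positivity)
  set c2 := G ζ + (c' - p) with hc2
  have hc2c : ‖c2 - c‖ ≤ m₁ / 4 := by
    have h1 : ‖c' - c‖ < m₁ / 8 := by simpa [dist_eq_norm] using hc'c
    have h2 : m ≤ m₁ := min_le_left _ _
    calc ‖c2 - c‖ = ‖(G ζ - p) + (c' - c)‖ := by rw [hc2]; congr 1; abel
      _ ≤ m / 8 + m₁ / 8 := (norm_add_le _ _).trans (add_le_add hζ.le h1.le)
      _ ≤ _ := by linarith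
  obtain ⟨E, hEA, hEK, hEv⟩ := hE c2 (by linarith) (-Real.log h)
    (by linarith [Real.log_nonpos hh0.le hh1]) (m / 8) (by positivity)
  rw [neg_neg, Real.exp_log hh0, Real.exp_neg, Real.exp_log hh0] at hEv
  have hhm : h * (m / 16) ≤ m / 16 := by nlinarith
  have hhm0 : 0 ≤ h * (m / 16) := by positivity
  refine ⟨(T.trans A).trans E, (hTA.trans hAA).trans hEA, fun u => ζ + (h : ℂ) • L u,
    (differentiable_const _).add ((L.differentiable).const_smul (h : ℂ)), fun a ha => ?_,
    fun u hu => ?_⟩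
  · have h1 := hTK a ha
    have h2 := hAK a ha (T a) (by linarith)
    have h12 : ‖A (T a) - a‖ ≤ h * (m / 16) + m / 8 := by
      calc _ = ‖(A (T a) - T a) + (T a - a)‖ := by congr 1; abel
        _ ≤ _ := (norm_add_le _ _).trans (add_le_add h2 h1)
    have h3 := hEK a ha (A (T a)) (by linarith)
    calc _ = ‖(E (A (T a)) - A (T a)) + (A (T a) - a)‖ := by simp
      _ ≤ _ := (norm_add_le _ _).trans (add_le_add h3 h12)
      _ ≤ ε := by linarith
  · set x : κ → ℂ := (h : ℂ) • L u with hx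
    have hLu : ‖L u‖ ≤ ‖L‖ * s := (L.le_opNorm u).trans (by gcongr)
    have hxn : ‖x‖ ≤ h * (‖L‖ * s) := by
      rw [hx, norm_real_smul hh0.le]; gcongr
    set rem := G (ζ + x) - G ζ - DG x with hremdef
    have hremn : ‖rem‖ ≤ h * (m / 16) := by
      have := hrem (y := ζ + x) (by
        rw [dist_self_add_left]
        exact (hxn.trans (by gcongr; linarith)).trans_lt hhr)
      simp only [add_sub_cancel_left] at this
      calc ‖rem‖ ≤ m / 16 / (‖L‖ * s + 1) * ‖x‖ := this
        _ ≤ m / 16 / (‖L‖ * s + 1) * (h * (‖L‖ * s + 1)) := by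
          gcongr
          exact hxn.trans (by gcongr; linarith)
        _ = _ := by field_simp
    set v := G (ζ + x) - G ζ with hv
    have hvr : v = DG x + rem := by rw [hremdef]; abel
    have hDGx : ‖DG x‖ ≤ h * (‖DG‖ * (‖L‖ * s)) := by
      calc ‖DG x‖ ≤ ‖DG‖ * ‖x‖ := DG.le_opNorm x
        _ ≤ ‖DG‖ * (h * (‖L‖ * s)) := by gcongr
        _ = _ := by ring
    have hvn : ‖v‖ ≤ h * (‖DG‖ * (‖L‖ * s)) + h * (m / 16) := by
      rw [hvr]; exact (norm_add_le _ _).trans (add_le_add hDGx hremn)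
    have hBexp : h * B = h * (‖DG‖ * (‖L‖ * s)) + h * (m / 16) + h * (m / 16) := by
      rw [hB]; ring
    set θ := A (G (ζ + x)) - (G (ζ + x) + (c' - p)) with hθ
    have hθn : ‖θ‖ ≤ h * (m / 16) := hAp _ (by
      calc ‖G (ζ + x) - p‖ = ‖v + (G ζ - p)‖ := by rw [hv]; congr 1; abel
        _ ≤ _ := (norm_add_le _ _).trans (add_le_add hvn hζ.le)
        _ ≤ δR := by linarith)
    have hVn : ‖v + θ‖ ≤ m / 8 :=
      ((norm_add_le _ _).trans (add_le_add hvn hθn)).trans (by linarith)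
    have hAw : A (G (ζ + x)) = c2 + (v + θ) := by rw [hθ, hc2, hv]; abel
    have hPDG : P (DG x) = (h : ℂ) • embJ e u := by
      rw [hPapp, ← hDDG, hx, map_smul, map_smul, hDL]
    have hPV : P (v + θ) = (h : ℂ) • embJ e u + P (rem + θ) := by
      rw [hvr, add_assoc, map_add, hPDG]
    have hPrem : ‖P (rem + θ)‖ ≤ h * (m / 8) :=
      (hPn _).trans ((norm_add_le _ _).trans (by linarith))
    have hPVn : ‖P (v + θ)‖ ≤ h * (s + δE) := by
      rw [hPV]
      calc _ ≤ ‖(h : ℂ) • embJ e u‖ + ‖P (rem + θ)‖ := norm_add_le _ _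
        _ ≤ h * s + h * (m / 8) := by
          rw [norm_real_smul hh0.le]
          gcongr
          exact (norm_embJ e u).trans hu
        _ ≤ _ := by rw [← mul_add]; gcongr; linarith
    have hVP : ‖(v + θ) - P (v + θ)‖ ≤ m / 8 := (norm_sub_embJ_projJ e _).trans hVn
    have hfin := hEv (v + θ) hPVn (by linarith)
    rw [← hAw] at hfin
    have hinv : ((h⁻¹ : ℝ) : ℂ) • P (v + θ) = embJ e u + ((h⁻¹ : ℝ) : ℂ) • P (rem + θ) := by
      rw [hPV, smul_add, smul_smul]
      have : ((h⁻¹ : ℝ) : ℂ) * (h : ℂ) = 1 := by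
        rw [← Complex.ofReal_mul, inv_mul_cancel₀ hh0.ne', Complex.ofReal_one]
      rw [this, one_smul]
    have hsm : ‖((h⁻¹ : ℝ) : ℂ) • P (rem + θ)‖ ≤ m / 8 := by
      rw [norm_real_smul (by positivity)]
      calc _ ≤ h⁻¹ * (h * (m / 8)) := by gcongr
        _ = _ := by field_simp
    show ‖E (A (G (ζ + x))) - (c + embJ e u)‖ ≤ ε
    rw [hinv] at hfin
    set y := ((h⁻¹ : ℝ) : ℂ) • P (rem + θ) with hy
    set z := (v + θ) - P (v + θ) with hz
    calc _ = ‖(E (A (G (ζ + x))) - (c2 + (embJ e u + y) + z)) + ((c2 - c) + (y + z))‖ := by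
          congr 1; abel
      _ ≤ m / 8 + (m₁ / 4 + (m / 8 + m / 8)) :=
        (norm_add_le _ _).trans (add_le_add hfin
          ((norm_add_le _ _).trans (add_le_add hc2c
            ((norm_add_le _ _).trans (add_le_add hsm hVP)))))
      _ ≤ ε := by linarith

end Placement

section MultiPlacement

variable {κ μ : Type*} [Fintype κ] [Fintype μ]

/-- Transversality is stable under perturbations that are small on the unit ball. -/
theorem Transverse.exists_of_close {Ψ : (κ ⊕ μ → ℂ) → (κ ⊕ μ → ℂ)} (hΨ : Differentiable ℂ Ψ)
    {e : κ ⊕ μ ≃ κ ⊕ μ} (he : Transverse Ψ e) :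
    ∃ δ > 0, ∀ Ψ' : (κ ⊕ μ → ℂ) → (κ ⊕ μ → ℂ), Differentiable ℂ Ψ' →
      (∀ ζ ∈ closedBall (0 : κ → ℂ) 1, ‖Ψ' (incl κ μ ζ) - Ψ (incl κ μ ζ)‖ ≤ δ) →
      Transverse Ψ' e := by
  obtain ⟨δ, hδ, h⟩ := exists_bijective_of_close he
  refine ⟨δ / 2, by positivity, fun Ψ' hΨ' hclose => h _ ?_⟩
  have hd : ∀ Ψ : (κ ⊕ μ → ℂ) → (κ ⊕ μ → ℂ), Differentiable ℂ Ψ →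
      Differentiable ℂ fun ζ => projJ e (Ψ (incl κ μ ζ)) := fun Ψ hΨ =>
    (projJ e).differentiable.comp (hΨ.comp (incl κ μ).differentiable)
  refine (norm_fderiv_sub_le_of_close one_pos (hd Ψ' hΨ').differentiableOn
    (hd Ψ hΨ).differentiableOn (ε := δ / 2) fun z hz => ?_).trans (by linarith)
  rw [← map_sub]
  exact (norm_projJ e _).trans (hclose z (ball_subset_closedBall hz))

omit [Fintype μ] in
theorem isCompact_disc (e : κ ⊕ μ ≃ κ ⊕ μ) (c : κ ⊕ μ → ℂ) (s : ℝ) :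
    IsCompact ((fun u => c + embJ e u) '' closedBall (0 : κ → ℂ) s) :=
  (isCompact_closedBall _ _).image (continuous_const.add (embJ e).continuous)

set_option maxHeartbeats 1000000 in
/-- Moving pieces of the embedded plane close to finitely many coordinate discs. -/
theorem exists_places [DecidableEq κ] [Nonempty κ] [Nonempty μ]
    {Ψ : (κ ⊕ μ → ℂ) ≃ₜ (κ ⊕ μ → ℂ)} (hΨ : IsAut Ψ) {e : κ ⊕ μ ≃ κ ⊕ μ} (he : Transverse Ψ e)
    {l : κ ⊕ μ} {r ρ : ℝ} (hρ : 0 < ρ) (hr : r < ρ) {C : Set (κ → ℂ)} (hC : IsCompact C)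
    (hC1 : closedBall 0 1 ⊆ C) (A : ℕ → Prop) {c : ℕ → κ ⊕ μ → ℂ} {s : ℕ → ℝ}
    {q : ℕ → (κ ⊕ μ → ℂ) → ℂ} (hcl : ∀ i, A i → ρ < ‖c i l‖) (hs : ∀ i, 0 ≤ s i)
    (hq : ∀ i, A i → Ent (q i)) (hqK : ∀ i, A i → ∀ a ∈ closedBall 0 ρ, ‖q i a‖ < 1 / 4)
    (hqF : ∀ i, A i → ∀ ζ ∈ C, ‖q i (Ψ (incl κ μ ζ))‖ < 1 / 4)
    (hqj : ∀ i j, A i → j < i → ∀ u, ‖u‖ ≤ s j → ‖q i (c j + embJ e u)‖ < 1 / 4)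
    (hqD : ∀ i, A i → ∀ u, ‖u‖ ≤ s i → ‖q i (c i + embJ e u) - 1‖ < 1 / 4) (N : ℕ) :
    ∀ ε > 0, ∃ Φ : (κ ⊕ μ → ℂ) ≃ₜ (κ ⊕ μ → ℂ), IsAut Φ ∧ ∃ σ : ℕ → (κ → ℂ) → (κ → ℂ),
      (∀ i, Differentiable ℂ (σ i)) ∧ (∀ a ∈ closedBall 0 r, ‖Φ a - a‖ ≤ ε) ∧
      (∀ ζ ∈ C, ‖Φ (Ψ (incl κ μ ζ)) - Ψ (incl κ μ ζ)‖ ≤ ε) ∧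
      ∀ i < N, A i → ∀ u, ‖u‖ ≤ s i →
        ‖Φ (Ψ (incl κ μ (σ i u))) - (c i + embJ e u)‖ ≤ ε := by
  induction N with
  | zero =>
    intro ε hε
    exact ⟨Homeomorph.refl _, IsAut.refl, fun _ => id, fun _ => differentiable_id,
      by simp [hε.le], by simp [hε.le], by simp⟩
  | succ N ih =>
    intro ε hε
    by_cases hA : A N
    · have hfin : {j | j < N ∧ A j}.Finite := (finite_lt_nat N).subset fun j hj => hj.1
      have hFc : Continuous fun ζ => Ψ (incl κ μ ζ) := Ψ.continuous.comp (incl κ μ).continuous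
      obtain ⟨δ, hδ, hδU⟩ := exists_near_subset
        (K := (fun ζ => Ψ (incl κ μ ζ)) '' C ∪
          ⋃ j ∈ {j | j < N ∧ A j}, (fun u => c j + embJ e u) '' closedBall (0 : κ → ℂ) (s j))
        (U := {w | ‖q N w‖ < 1 / 4})
        ((hC.image hFc).union (hfin.isCompact_biUnion fun j _ => isCompact_disc e _ _))
        (isOpen_lt (hq N hA).continuous.norm continuous_const) (by
          rintro w (⟨ζ, hζ, rfl⟩ | hw)
          · exact hqF N hA ζ hζ
          · simp only [mem_iUnion] at hw
            obtain ⟨j, hj, u, hu, rfl⟩ := hw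
            exact hqj N j hA hj.1 u (by simpa using hu))
      obtain ⟨δT, hδT, hT⟩ := he.exists_of_close hΨ.differentiable
      obtain ⟨Φ₁, hΦ₁, σ, hσ, h1, h2, h3⟩ :=
        ih (min (min (ε / 2) δ) (min (ρ - r) δT)) (by have := sub_pos.2 hr; positivity)
      have hm1 : min (min (ε / 2) δ) (min (ρ - r) δT) ≤ ε / 2 :=
        (min_le_left _ _).trans (min_le_left _ _)
      have hm2 : min (min (ε / 2) δ) (min (ρ - r) δT) ≤ δ :=
        (min_le_left _ _).trans (min_le_right _ _)
      have hm3 : min (min (ε / 2) δ) (min (ρ - r) δT) ≤ ρ - r :=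
        (min_le_right _ _).trans (min_le_left _ _)
      have hm4 : min (min (ε / 2) δ) (min (ρ - r) δT) ≤ δT :=
        (min_le_right _ _).trans (min_le_right _ _)
      set m := min (min (ε / 2) δ) (min (ρ - r) δT)
      have hΨ₁ : IsAut (Ψ.trans Φ₁) := hΨ.trans hΦ₁
      have hF₁c : Continuous fun ζ => Φ₁ (Ψ (incl κ μ ζ)) := Φ₁.continuous.comp hFc
      have he₁ : Transverse (Ψ.trans Φ₁) e := hT _ hΨ₁.differentiable fun ζ hζ =>
        (h2 ζ (hC1 hζ)).trans hm4
      obtain ⟨Φ₂, hΦ₂, τ, hτ, h4, h5⟩ := exists_place hΨ₁ he₁ hρ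
        (K := closedBall 0 ρ ∪ ((fun ζ => Φ₁ (Ψ (incl κ μ ζ))) '' C ∪
          ⋃ j ∈ {j | j < N ∧ A j},
            (fun u => Φ₁ (Ψ (incl κ μ (σ j u)))) '' closedBall (0 : κ → ℂ) (s j)))
        ((isCompact_closedBall _ _).union ((hC.image hF₁c).union
          (hfin.isCompact_biUnion fun j _ =>
            (isCompact_closedBall _ _).image (hF₁c.comp (hσ j).continuous)))) (l := l) (by
          rintro w (hw | ⟨ζ, hζ, rfl⟩ | hw)
          · left
            rw [mem_closedBall, dist_zero_right] at hw
            exact (norm_le_pi_norm w l).trans hw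
          · exact Or.inr ⟨ζ, rfl⟩
          · simp only [mem_iUnion] at hw
            obtain ⟨j, hj, u, hu, rfl⟩ := hw
            exact Or.inr ⟨σ j u, rfl⟩) (hcl N hA) (hs N) (hq N hA) (by
          rintro w (hw | ⟨ζ, hζ, rfl⟩ | hw)
          · exact hqK N hA w hw
          · exact hδU _ (Or.inl ⟨ζ, hζ, rfl⟩) _ ((h2 ζ hζ).trans hm2)
          · simp only [mem_iUnion] at hw
            obtain ⟨j, hj, u, hu, rfl⟩ := hw
            refine hδU (c j + embJ e u) (Or.inr ?_) _
              ((h3 j hj.1 hj.2 u (by simpa using hu)).trans hm2)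
            exact mem_biUnion (x := j) hj ⟨u, hu, rfl⟩) (hqD N hA) (ε := ε / 2) (by positivity)
      have hcomb : ∀ w z, w ∈ closedBall 0 ρ ∪ ((fun ζ => Φ₁ (Ψ (incl κ μ ζ))) '' C ∪
          ⋃ j ∈ {j | j < N ∧ A j},
            (fun u => Φ₁ (Ψ (incl κ μ (σ j u)))) '' closedBall (0 : κ → ℂ) (s j)) →
          ‖w - z‖ ≤ m → ‖Φ₂ w - z‖ ≤ ε := fun w z hw hwz => by
        calc ‖Φ₂ w - z‖ = ‖(Φ₂ w - w) + (w - z)‖ := by congr 1; abel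
          _ ≤ ε / 2 + ε / 2 := (norm_add_le _ _).trans (add_le_add (h4 w hw) (hwz.trans hm1))
          _ = ε := by ring
      refine ⟨Φ₁.trans Φ₂, hΦ₁.trans hΦ₂, Function.update σ N τ, fun i => ?_, fun a ha => ?_,
        fun ζ hζ => ?_, fun i hi hAi u hu => ?_⟩
      · rcases eq_or_ne i N with rfl | hi
        · simpa using hτ
        · simpa [hi] using hσ i
      · refine hcomb _ _ (Or.inl ?_) (h1 a ha)
        rw [mem_closedBall, dist_zero_right] at ha ⊢
        calc ‖Φ₁ a‖ = ‖(Φ₁ a - a) + a‖ := by simp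
          _ ≤ m + r := (norm_add_le _ _).trans (add_le_add (h1 a (by simpa using ha)) ha)
          _ ≤ ρ := by linarith
      · exact hcomb _ _ (Or.inr (Or.inl ⟨ζ, hζ, rfl⟩)) (h2 ζ hζ)
      · rcases eq_or_ne i N with rfl | hiN
        · simpa using (h5 u hu).trans (by linarith)
        · have hi' : i < N := by omega
          rw [Function.update_of_ne hiN]
          exact hcomb _ _ (Or.inr (Or.inr (mem_biUnion (x := i) ⟨hi', hAi⟩
            ⟨u, by simpa using hu, rfl⟩))) (h3 i hi' hAi u hu)
    · obtain ⟨Φ, hΦ, σ, hσ, h1, h2, h3⟩ := ih ε hε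
      refine ⟨Φ, hΦ, σ, hσ, h1, h2, fun i hi hAi => h3 i ?_ hAi⟩
      have : i ≠ N := fun h => hA (h ▸ hAi)
      omega

end MultiPlacement

section DiscSystems

/-- A sequence of points in given open sets with pairwise distinct `i₀`-th coordinates. -/
theorem exists_generic_seq {ι : Type*} [Fintype ι] (i₀ : ι) {O : ℕ → Set (ι → ℂ)}
    (hO : ∀ i, IsOpen (O i)) :
    ∃ c : ℕ → ι → ℂ, (∀ i, (O i).Nonempty → c i ∈ O i) ∧ ∀ i j, j < i → c i i₀ ≠ c j i₀ := by
  have hpick : ∀ (i : ℕ) (t : Finset ℂ), ∃ x : ι → ℂ, ((O i).Nonempty → x ∈ O i) ∧ x i₀ ∉ t := by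
    intro i t
    obtain ⟨b, hb⟩ := Infinite.exists_notMem_finset t
    by_cases hne : (O i).Nonempty
    · obtain ⟨x, hx, hxt⟩ := exists_ne_zero_of_open (f := fun x : ι → ℂ => ∏ a ∈ t, (x i₀ - a))
        isOpen_univ convex_univ
        (Ent.prod t fun a _ => (Ent.coord i₀).sub (Ent.const a)).differentiable.differentiableOn
        (p := fun _ => b) (mem_univ _)
        (Finset.prod_ne_zero_iff.2 fun a ha => sub_ne_zero.2 fun h : b = a => hb (h ▸ ha)) (hO i)
        (subset_univ _) hne
      exact ⟨x, fun _ => hx, fun h => hxt (Finset.prod_eq_zero h (sub_self _))⟩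
    · exact ⟨fun _ => b, fun h => absurd h hne, hb⟩
  choose pick hp1 hp2 using hpick
  set T : ℕ → Finset ℂ := fun i => Nat.rec ∅ (fun i t => insert (pick i t i₀) t) i with hT
  have hT1 : ∀ i j, j < i → pick j (T j) i₀ ∈ T i := by
    intro i
    induction i with
    | zero => simp
    | succ i ih =>
      intro j hj
      rcases Nat.lt_succ_iff_lt_or_eq.1 hj with h | rfl
      · exact Finset.mem_insert_of_mem (ih j h)
      · exact Finset.mem_insert_self _ _
  exact ⟨fun i => pick i (T i), fun i hi => hp1 i _ hi, fun i j hj h =>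
    hp2 i (T i) ((show pick i (T i) i₀ = pick j (T j) i₀ from h) ▸ hT1 i j hj)⟩

variable {κ μ : Type*} [Fintype κ] [Fintype μ]

/-- The disc of radius `s` around `c` in the direction of the first block of a splitting can be
separated from `K`. -/
def Valid (e : κ ⊕ μ ≃ κ ⊕ μ) (l : κ ⊕ μ) (ρ : ℝ) (K : Set (κ ⊕ μ → ℂ)) (s : ℝ)
    (c : κ ⊕ μ → ℂ) : Prop :=
  ρ < ‖c l‖ ∧ ∃ q, Ent q ∧ (∀ a ∈ K, ‖q a‖ < 1 / 4) ∧
    ∀ u, ‖u‖ ≤ s → ‖q (c + embJ e u) - 1‖ < 1 / 4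

theorem isOpen_valid (e : κ ⊕ μ ≃ κ ⊕ μ) (l : κ ⊕ μ) (ρ : ℝ) (K : Set (κ ⊕ μ → ℂ)) (s : ℝ) :
    IsOpen {c | Valid e l ρ K s c} := by
  have hO1 : IsOpen {w : κ ⊕ μ → ℂ | ρ < ‖w l‖} :=
    isOpen_lt continuous_const (continuous_apply l).norm
  rw [isOpen_iff_mem_nhds]
  rintro c ⟨hc, q, hq, hqK, hqD⟩
  obtain ⟨δ, hδ, h⟩ := exists_near_subset (isCompact_disc e c s) (U := {w | ‖q w - 1‖ < 1 / 4})
    (isOpen_lt (hq.continuous.sub continuous_const).norm continuous_const) (by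
      rintro w ⟨u, hu, rfl⟩
      exact hqD u (by simpa using hu))
  filter_upwards [hO1.mem_nhds hc, closedBall_mem_nhds c hδ] with c' hc' hcc'
  refine ⟨hc', q, hq, hqK, fun u hu => ?_⟩
  refine h (c + embJ e u) ⟨u, by simpa using hu, rfl⟩ _ ?_
  rw [add_sub_add_right_eq_sub, ← dist_eq_norm]
  exact hcc'

theorem exists_valid {e : κ ⊕ μ ≃ κ ⊕ μ} {l : κ ⊕ μ} {ρ : ℝ} {K : Set (κ ⊕ μ → ℂ)}
    {u : (κ ⊕ μ → ℂ) → ℂ} (hu : Ent u) (hρ : 0 < ρ) (hK : IsCompact K)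
    (hKu : ∀ a ∈ K, ‖a l‖ ≤ ρ ∨ u a = 0) {w : κ ⊕ μ → ℂ} (hw : ρ < ‖w l‖) (huw : u w ≠ 0) :
    ∃ n : ℕ, Valid e l ρ K (1 / ((n : ℝ) + 1)) w := by
  obtain ⟨N, hN⟩ := exists_separating hu hρ hK hKu hw huw (ε := 1 / 4) (by norm_num)
  have hq : Ent fun a => u a / u w * (a l / w l) ^ N := by
    simp_rw [div_eq_mul_inv]
    exact (hu.mul (Ent.const _)).mul (((Ent.coord l).mul (Ent.const _)).pow N)
  have hwl : w l ≠ 0 := norm_pos_iff.1 (hρ.trans hw)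
  obtain ⟨δ, hδ, h⟩ := exists_near_subset (isCompact_singleton (x := w))
    (U := {a | ‖u a / u w * (a l / w l) ^ N - 1‖ < 1 / 4})
    (isOpen_lt (hq.continuous.sub continuous_const).norm continuous_const) (by
      rintro _ rfl
      simp [huw, hwl])
  obtain ⟨n, hn⟩ := exists_nat_one_div_lt hδ
  refine ⟨n, hw, _, hq, hN, fun v hv => h w rfl _ ?_⟩
  rw [add_sub_cancel_left]
  exact ((norm_embJ e v).trans hv).trans hn.le

/-- A sequence of coordinate discs, dense among those separated from `K`, together with functions
separating each of them from `K` and from the preceding ones. -/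
theorem exists_disc_system [Nonempty μ] (e : κ ⊕ μ ≃ κ ⊕ μ) (l : κ ⊕ μ) (ρ : ℝ)
    {K : Set (κ ⊕ μ → ℂ)} (hK : IsCompact K) :
    ∃ (A : ℕ → Prop) (c : ℕ → κ ⊕ μ → ℂ) (s : ℕ → ℝ) (q : ℕ → (κ ⊕ μ → ℂ) → ℂ),
      (∀ i, A i → ρ < ‖c i l‖) ∧ (∀ i, 0 ≤ s i) ∧ (∀ i, A i → Ent (q i)) ∧
      (∀ i, A i → ∀ a ∈ K, ‖q i a‖ < 1 / 4) ∧
      (∀ i j, A i → j < i → ∀ u, ‖u‖ ≤ s j → ‖q i (c j + embJ e u)‖ < 1 / 4) ∧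
      (∀ i, A i → ∀ u, ‖u‖ ≤ s i → ‖q i (c i + embJ e u) - 1‖ < 1 / 4) ∧
      ∀ (w : κ ⊕ μ → ℂ) (n : ℕ), Valid e l ρ K (1 / ((n : ℝ) + 1)) w → ∀ δ > 0,
        ∃ i, A i ∧ s i = 1 / ((n : ℝ) + 1) ∧ ‖c i - w‖ < δ := by
  obtain ⟨b⟩ := ‹Nonempty μ›
  obtain ⟨d, hd⟩ := TopologicalSpace.exists_dense_seq (κ ⊕ μ → ℂ)
  set s : ℕ → ℝ := fun i => 1 / ((i.unpair.1 : ℝ) + 1) with hs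
  set O : ℕ → Set (κ ⊕ μ → ℂ) := fun i => {w | Valid e l ρ K (s i) w} ∩
    ball (d i.unpair.2.unpair.1) (1 / ((i.unpair.2.unpair.2 : ℝ) + 1)) with hO
  obtain ⟨c, hcO, hcd⟩ := exists_generic_seq (e (Sum.inr b)) (O := O)
    fun i => (isOpen_valid e l ρ K _).inter isOpen_ball
  have hV : ∀ i, (O i).Nonempty → Valid e l ρ K (s i) (c i) := fun i hi => (hcO i hi).1
  set τ : ℕ → (κ ⊕ μ → ℂ) → ℂ := fun i w => ∏ j ∈ Finset.range i,
    (w (e (Sum.inr b)) - c j (e (Sum.inr b))) * (c i (e (Sum.inr b)) - c j (e (Sum.inr b)))⁻¹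
    with hτ
  have hτE : ∀ i, Ent (τ i) := fun i => Ent.prod _ fun j _ =>
    ((Ent.coord _).sub (Ent.const _)).mul (Ent.const _)
  have hτ0 : ∀ i j, j < i → ∀ u, τ i (c j + embJ e u) = 0 := fun i j hj u =>
    Finset.prod_eq_zero (Finset.mem_range.2 hj) (by simp)
  have hτ1 : ∀ i u, τ i (c i + embJ e u) = 1 := fun i u =>
    Finset.prod_eq_one fun j hj => by
      simp [mul_inv_cancel₀ (sub_ne_zero.2 (hcd i j (Finset.mem_range.1 hj)))]
  have hq : ∀ i, ∃ q : (κ ⊕ μ → ℂ) → ℂ, (O i).Nonempty → Ent q ∧ (∀ a ∈ K, ‖q a‖ < 1 / 4) ∧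
      (∀ j < i, ∀ u, q (c j + embJ e u) = 0) ∧
      ∀ u, ‖u‖ ≤ s i → ‖q (c i + embJ e u) - 1‖ < 1 / 4 := by
    intro i
    by_cases hi : (O i).Nonempty
    · obtain ⟨-, q, hq, hqK, hqD⟩ := hV i hi
      obtain ⟨B, hB⟩ := hK.exists_bound_of_continuousOn (hτE i).continuous.continuousOn
      obtain ⟨χ, hχ, h0, h1, -⟩ := hq.exists_sharpen (ε := 1 / (8 * (|B| + 1))) (by positivity)
      have hle : 1 / (8 * (|B| + 1)) ≤ 1 / 8 := by
        apply one_div_le_one_div_of_le (by norm_num)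
        nlinarith [abs_nonneg B]
      refine ⟨fun w => χ w * τ i w, fun _ => ⟨hχ.mul (hτE i), fun a ha => ?_, fun j hj u => ?_,
        fun u hu => ?_⟩⟩
      · rw [norm_mul]
        calc _ ≤ 1 / (8 * (|B| + 1)) * (|B| + 1) := by
              gcongr
              · exact h0 a (hqK a ha).le
              · exact (hB a ha).trans (by linarith [le_abs_self B])
          _ = 1 / 8 := by field_simp
          _ < 1 / 4 := by norm_num
      · simp [hτ0 i j hj u]
      · simp only [hτ1, mul_one]
        exact (h1 _ (hqD u hu).le).trans_lt (hle.trans_lt (by norm_num))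
    · exact ⟨0, fun h => absurd h hi⟩
  choose q hq using hq
  refine ⟨fun i => (O i).Nonempty, c, s, q, fun i hi => (hV i hi).1, fun i => by positivity,
    fun i hi => (hq i hi).1, fun i hi => (hq i hi).2.1, fun i j hi hj u _ => ?_,
    fun i hi => (hq i hi).2.2.2, fun w n hw δ hδ => ?_⟩
  · rw [(hq i hi).2.2.1 j hj u]
    norm_num
  · obtain ⟨m, hm⟩ := exists_nat_one_div_lt (half_pos hδ)
    obtain ⟨k, hk⟩ := hd.exists_mem_open isOpen_ball ⟨w, mem_ball_self (x := w)
      (Nat.one_div_pos_of_nat (α := ℝ) (n := m))⟩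
    set i := Nat.pair n (Nat.pair k m) with hi
    have hsi : s i = 1 / ((n : ℝ) + 1) := by simp [hs, hi]
    have hne : (O i).Nonempty := ⟨w, by
      refine ⟨by rw [hsi]; exact hw, ?_⟩
      simpa [hi, dist_comm] using hk⟩
    refine ⟨i, hne, hsi, ?_⟩
    have h2 : dist (c i) (d k) < 1 / ((m : ℝ) + 1) := by simpa [hi] using (hcO i hne).2
    rw [← dist_eq_norm]
    have h3 : dist (d k) w < 1 / ((m : ℝ) + 1) := hk
    linarith [dist_triangle (c i) (d k) w]

end DiscSystems

section Stages

variable {κ μ : Type*} [Fintype κ] [Fintype μ]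

omit [Fintype κ] in
theorem fderiv_projI_comp (e : κ ⊕ μ ≃ κ ⊕ μ) {V : Type*} [NormedAddCommGroup V]
    [NormedSpace ℂ V] [Fintype κ] {g : V → (κ ⊕ μ → ℂ)} {z : V} (hg : DifferentiableAt ℂ g z) :
    fderiv ℂ (fun z => projI e (g z)) z = (projI e).comp (fderiv ℂ g z) :=
  ((projI e).hasFDerivAt.comp z hg.hasFDerivAt).fderiv

/-- The limit of a sequence of maps violating the bound contains a point at which it is transverse
to the first block, lies far away in the `l`-th direction and is separated from the embedding. -/
theorem exists_transverse_point [DecidableEq μ] {Ψ : (κ ⊕ μ → ℂ) ≃ₜ (κ ⊕ μ → ℂ)} (hΨ : IsAut Ψ)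
    (e : κ ⊕ μ ≃ κ ⊕ μ) {l : κ ⊕ μ} {ρ : ℝ} {G : (μ → ℂ) → (κ ⊕ μ → ℂ)} {a : ℝ} (ha : 0 < a)
    (hG : DifferentiableOn ℂ G (ball 0 a)) (hbij : ∀ v, ‖v‖ ≤ ‖projI e (fderiv ℂ G 0 v)‖)
    (h0 : ∀ ζ, Ψ (incl κ μ ζ) ≠ G 0) {z₀ : μ → ℂ} (hz₀ : z₀ ∈ ball 0 a) (hz₀l : ρ < ‖G z₀ l‖) :
    ∃ z ∈ ball (0 : μ → ℂ) a, ρ < ‖G z l‖ ∧ (∃ j : μ, Ψ.symm (G z) (Sum.inr j) ≠ 0) ∧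
      Function.Bijective (fderiv ℂ (fun z => projI e (G z)) z) := by
  have hmem0 : (0 : μ → ℂ) ∈ ball (0 : μ → ℂ) a := mem_ball_self ha
  have hj : ∃ j : μ, Ψ.symm (G 0) (Sum.inr j) ≠ 0 := by
    by_contra! hcon
    refine h0 (fun a => Ψ.symm (G 0) (Sum.inl a)) ?_
    rw [← Ψ.apply_symm_apply (G 0)]
    congr 1
    ext i
    rcases i with i | i
    · simp
    · simpa using (hcon i).symm
  obtain ⟨j, hj⟩ := hj
  set f : (μ → ℂ) → ℂ := fun z => Ψ.symm (G z) (Sum.inr j) with hf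
  have hfd : DifferentiableOn ℂ f (ball 0 a) :=
    (differentiable_pi.1 hΨ.symm.differentiable (Sum.inr j)).comp_differentiableOn hG
  have hO : IsOpen (ball (0 : μ → ℂ) a ∩ (fun z => ‖G z l‖) ⁻¹' Ioi ρ) :=
    (((continuous_apply l).comp_continuousOn hG.continuousOn).norm).isOpen_inter_preimage
      isOpen_ball isOpen_Ioi
  obtain ⟨z₁, hz₁, hfz₁⟩ := exists_ne_zero_of_open isOpen_ball (convex_ball _ _) hfd hmem0 hj hO
    inter_subset_left ⟨z₀, hz₀, hz₀l⟩
  have hO2 : IsOpen ((ball (0 : μ → ℂ) a ∩ (fun z => ‖G z l‖) ⁻¹' Ioi ρ) ∩ f ⁻¹' {0}ᶜ) :=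
    (hfd.continuousOn.mono inter_subset_left).isOpen_inter_preimage hO isOpen_compl_singleton
  have hG0 : DifferentiableAt ℂ G 0 := hG.differentiableAt (isOpen_ball.mem_nhds hmem0)
  obtain ⟨z, ⟨⟨hz, hzl⟩, hzf⟩, hzb⟩ := exists_bijective_fderiv_of_open isOpen_ball
    (convex_ball _ _) ((projI e).differentiable.comp_differentiableOn hG) hmem0 (by
      have hinj : Function.Injective (fderiv ℂ (projI e ∘ G) 0) := by
        rw [injective_iff_map_eq_zero]
        intro v hv
        have h1 := hbij v
        have h2 : fderiv ℂ (projI e ∘ G) 0 v = projI e (fderiv ℂ G 0 v) := by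
          rw [← ContinuousLinearMap.comp_apply, ← fderiv_projI_comp e hG0]
          rfl
        rw [← h2, hv, norm_zero] at h1
        exact norm_le_zero_iff.1 h1
      exact ⟨hinj, (LinearMap.injective_iff_surjective
        (f := (fderiv ℂ (projI e ∘ G) 0 : (μ → ℂ) →ₗ[ℂ] (μ → ℂ)))).1 hinj⟩) hO2
    (inter_subset_left.trans inter_subset_left) ⟨z₁, hz₁, hfz₁⟩
  exact ⟨z, hz, hzl, ⟨j, hzf⟩, hzb⟩

/-- A map transverse to the first block at `z₁` meets every map that is close to a coordinate disc
passing near the image of `z₁`. -/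
theorem exists_meeting (e : κ ⊕ μ ≃ κ ⊕ μ) {G : (μ → ℂ) → (κ ⊕ μ → ℂ)} {U : Set (μ → ℂ)}
    (hU : IsOpen U) (hG : DifferentiableOn ℂ G U) {z₁ : μ → ℂ} (hz₁ : z₁ ∈ U)
    (hbij : Function.Bijective (fderiv ℂ (fun z => projI e (G z)) z₁)) {s : ℝ} (hs : 0 < s) :
    ∃ ε > 0, ∀ (g : (μ → ℂ) → (κ ⊕ μ → ℂ)) (f : (κ → ℂ) → (κ ⊕ μ → ℂ)) (c : κ ⊕ μ → ℂ),
      DifferentiableOn ℂ g U → Differentiable ℂ f → (∀ z ∈ U, ‖g z - G z‖ ≤ ε) →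
      ‖c - G z₁‖ ≤ ε → (∀ u, ‖u‖ ≤ s → ‖f u - (c + embJ e u)‖ ≤ ε) → ∃ z u, g z = f u := by
  obtain ⟨R₀, hR₀, hR₀U⟩ := Metric.isOpen_iff.1 hU z₁ hz₁
  set R := min R₀ s with hR
  have hRpos : 0 < R := by positivity
  have hmem : ∀ x : (μ → ℂ) × (κ → ℂ), x ∈ ball (z₁, (0 : κ → ℂ)) R → x.1 ∈ U ∧ ‖x.2‖ ≤ s := by
    intro x hx
    rw [mem_ball, Prod.dist_eq, max_lt_iff] at hx
    refine ⟨hR₀U (hx.1.trans_le (min_le_left _ _)), ?_⟩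
    have := hx.2.le.trans (min_le_right R₀ s)
    simpa using this
  set H : (μ → ℂ) × (κ → ℂ) → (κ ⊕ μ → ℂ) := fun x => G x.1 - (G z₁ + embJ e x.2) with hH
  have hGz : DifferentiableAt ℂ G z₁ := hG.differentiableAt (hU.mem_nhds hz₁)
  have hmaps : MapsTo Prod.fst (ball (z₁, (0 : κ → ℂ)) R) U := fun x hx => (hmem x hx).1
  have hHd : DifferentiableOn ℂ H (ball (z₁, 0) R) :=
    (hG.comp differentiable_fst.differentiableOn hmaps).sub
      ((differentiable_const _).add ((embJ e).differentiable.comp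
        differentiable_snd)).differentiableOn
  have hder : HasFDerivAt H ((fderiv ℂ G z₁).comp (ContinuousLinearMap.fst ℂ _ _) -
      (embJ e).comp (ContinuousLinearMap.snd ℂ (μ → ℂ) (κ → ℂ))) (z₁, 0) := by
    have h1 : HasFDerivAt (fun x : (μ → ℂ) × (κ → ℂ) => G x.1)
        ((fderiv ℂ G z₁).comp (ContinuousLinearMap.fst ℂ _ _)) (z₁, 0) :=
      HasFDerivAt.comp (g := G) (z₁, (0 : κ → ℂ)) hGz.hasFDerivAt hasFDerivAt_fst
    have h2 : HasFDerivAt (fun x : (μ → ℂ) × (κ → ℂ) => embJ e x.2)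
        ((embJ e).comp (ContinuousLinearMap.snd ℂ (μ → ℂ) (κ → ℂ))) (z₁, 0) :=
      (embJ e).hasFDerivAt.comp (z₁, (0 : κ → ℂ)) hasFDerivAt_snd
    exact h1.sub (h2.const_add _)
  obtain ⟨ε, hε, hzero⟩ := exists_zero_of_close hRpos hHd (by simp [hH]) (by
    rw [hder.fderiv]
    intro w
    obtain ⟨z, hz⟩ := hbij.2 (projI e w)
    rw [fderiv_projI_comp e hGz] at hz
    refine ⟨(z, projJ e (fderiv ℂ G z₁ z - w)), splitting_ext e ?_ ?_⟩
    · simp [map_sub]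
    · simpa [map_sub] using hz)
  refine ⟨ε / 3, by positivity, fun g f c hg hf hgG hc hfc => ?_⟩
  obtain ⟨x, hx, hx0⟩ := hzero (fun x => g x.1 - f x.2)
    ((hg.comp differentiable_fst.differentiableOn hmaps).sub
      (hf.comp differentiable_snd).differentiableOn) (fun x hx => by
      obtain ⟨h1, h2⟩ := hmem x hx
      calc ‖g x.1 - f x.2 - H x‖
          = ‖(g x.1 - G x.1) - (f x.2 - (c + embJ e x.2)) - (c - G z₁)‖ := by
            simp only [hH]; congr 1; abel
        _ ≤ ε / 3 + ε / 3 + ε / 3 := (norm_sub_le _ _).trans (add_le_add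
            ((norm_sub_le _ _).trans (add_le_add (hgG _ h1) (hfc _ h2))) hc)
        _ = ε := by ring)
  exact ⟨x.1, x.2, sub_eq_zero.1 hx0⟩

set_option maxHeartbeats 1000000 in
/-- A small perturbation of the embedding after which maps avoiding it, transverse to the first
block of the given splitting, cannot be large in the `l`-th direction. -/
theorem exists_stage [Nonempty κ] [Nonempty μ] {Ψ : (κ ⊕ μ → ℂ) ≃ₜ (κ ⊕ μ → ℂ)} (hΨ : IsAut Ψ)
    {e : κ ⊕ μ ≃ κ ⊕ μ} (he : Transverse Ψ e) (l : κ ⊕ μ) {r : ℝ} (hr : 0 < r)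
    {C : Set (κ → ℂ)} (hC : IsCompact C) (hC1 : closedBall 0 1 ⊆ C) {ε η r' a a' : ℝ}
    (hε : 0 < ε) (hη : 0 < η) (ha : 0 < a) (haa : a < a') :
    ∃ Φ : (κ ⊕ μ → ℂ) ≃ₜ (κ ⊕ μ → ℂ), IsAut Φ ∧ (∀ w ∈ closedBall 0 r, ‖Φ w - w‖ ≤ ε) ∧
      (∀ ζ ∈ C, ‖Φ (Ψ (incl κ μ ζ)) - Ψ (incl κ μ ζ)‖ ≤ ε) ∧
      ∃ C' : Set (κ → ℂ), IsCompact C' ∧ ∃ ε' > 0, ∀ F : (κ → ℂ) → (κ ⊕ μ → ℂ),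
        Differentiable ℂ F → (∀ ζ ∈ C', ‖F ζ - Φ (Ψ (incl κ μ ζ))‖ ≤ ε') →
        ∀ g : (μ → ℂ) → (κ ⊕ μ → ℂ), Differentiable ℂ g → (∀ z ∈ ball 0 a', ‖g z‖ ≤ r') →
          (∀ v, ‖v‖ ≤ ‖projI e (fderiv ℂ g 0 v)‖) → (∀ ζ, η ≤ ‖Ψ (incl κ μ ζ) - g 0‖) →
          (∀ z ζ, g z ≠ F ζ) → ∀ z ∈ ball 0 a, ‖g z l‖ ≤ r + 1 := by
  classical
  set ρ := r + 1 / 2 with hρ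
  have hFc : Continuous fun ζ => Ψ (incl κ μ ζ) := Ψ.continuous.comp (incl κ μ).continuous
  set K : Set (κ ⊕ μ → ℂ) := closedBall 0 ρ ∪ (fun ζ => Ψ (incl κ μ ζ)) '' C with hK
  have hKc : IsCompact K := (isCompact_closedBall _ _).union (hC.image hFc)
  obtain ⟨A, c, s, q, hcl, hs, hq, hqK, hqj, hqD, hdense⟩ := exists_disc_system e l ρ hKc
  have hplace := fun N => exists_places hΨ he (r := r) (ρ := ρ) (l := l) (by positivity)
    (by linarith) hC hC1 A hcl hs hq (fun i hi a ha => hqK i hi a (Or.inl ha))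
    (fun i hi ζ hζ => hqK i hi _ (Or.inr ⟨ζ, hζ, rfl⟩)) hqj hqD N
    (min ε (1 / ((N : ℝ) + 1))) (lt_min hε Nat.one_div_pos_of_nat)
  choose Φ hΦ σ hσ h1 h2 h3 using hplace
  by_contra! hcon
  have hcon2 := fun N : ℕ => hcon (Φ N) (hΦ N) (fun w hw => (h1 N w hw).trans (min_le_left _ _))
    (fun ζ hζ => (h2 N ζ hζ).trans (min_le_left _ _))
    (⋃ i ∈ {i | i < N}, σ N i '' closedBall (0 : κ → ℂ) (s i))
    ((finite_lt_nat N).isCompact_biUnion fun i _ =>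
      (isCompact_closedBall _ _).image (hσ N i).continuous)
    (1 / ((N : ℝ) + 1)) Nat.one_div_pos_of_nat
  choose F hF hFclose g hg hgr hgv hgη hgF z hz hzl using hcon2
  set b := (a + a') / 2 with hb
  obtain ⟨φ, hφ, G, hG⟩ := exists_subseq_tendstoUniformlyOn (R := a') (R' := b) (by linarith)
    (fun N => (hg N).differentiableOn) hgr
  have hGU := hG.mono (ball_subset_closedBall (x := (0 : μ → ℂ)) (ε := b))
  have hlim : ∀ x ∈ ball (0 : μ → ℂ) b, DifferentiableAt ℂ G x ∧
      Tendsto (fun n => fderiv ℂ (g (φ n)) x) atTop (𝓝 (fderiv ℂ G x)) := fun x hx =>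
    limit_of_tendstoUniformlyOn isOpen_ball (fun n => (hg (φ n)).differentiableOn) hGU hx
  have hGd : DifferentiableOn ℂ G (ball 0 b) := fun x hx => (hlim x hx).1.differentiableWithinAt
  have hb0 : 0 < b := by linarith
  have h0b : (0 : μ → ℂ) ∈ ball (0 : μ → ℂ) b := mem_ball_self hb0
  have hab : ball (0 : μ → ℂ) a ⊆ ball 0 b := ball_subset_ball (by linarith)
  have hG0 := hGU.tendsto_at h0b
  have hunif : ∀ δ > 0, ∀ᶠ n in atTop, ∀ x ∈ ball (0 : μ → ℂ) b, ‖g (φ n) x - G x‖ ≤ δ := by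
    intro δ hδ
    filter_upwards [Metric.tendstoUniformlyOn_iff.1 hGU δ hδ] with n hn x hx
    rw [← dist_eq_norm, dist_comm]
    exact (hn x hx).le
  obtain ⟨n₀, hn₀⟩ := (hunif (1 / 4) (by norm_num)).exists
  have hz₀l : ρ < ‖G (z (φ n₀)) l‖ := by
    have h4 := hn₀ _ (hab (hz (φ n₀)))
    have h5 : ‖g (φ n₀) (z (φ n₀)) l - G (z (φ n₀)) l‖ ≤ 1 / 4 :=
      (norm_le_pi_norm (g (φ n₀) (z (φ n₀)) - G (z (φ n₀))) l).trans h4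
    have h6 := hzl (φ n₀)
    have h7 := norm_sub_norm_le (g (φ n₀) (z (φ n₀)) l) (G (z (φ n₀)) l)
    linarith
  obtain ⟨z₁, hz₁, hz₁l, ⟨j, hj⟩, hz₁b⟩ := exists_transverse_point hΨ e (l := l) (ρ := ρ) hb0 hGd
    (fun v => ge_of_tendsto (((by fun_prop : Continuous
      fun L : (μ → ℂ) →L[ℂ] (κ ⊕ μ → ℂ) => ‖projI e (L v)‖).tendsto _).comp (hlim 0 h0b).2)
      (Eventually.of_forall fun n => hgv (φ n) v)) (fun ζ h => by
      have h8 : η ≤ ‖Ψ (incl κ μ ζ) - G 0‖ := ge_of_tendsto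
        (tendsto_const_nhds.sub hG0).norm (Eventually.of_forall fun n => hgη (φ n) ζ)
      rw [h, sub_self, norm_zero] at h8
      linarith) (hab (hz (φ n₀))) hz₀l
  obtain ⟨n, hn⟩ := exists_valid (e := e) (l := l) (hΨ.2 (Sum.inr j)) (by positivity : 0 < ρ) hKc
    (by
      rintro w (hw | ⟨ζ, hζ, rfl⟩)
      · left
        rw [mem_closedBall, dist_zero_right] at hw
        exact (norm_le_pi_norm w l).trans hw
      · right
        simp) hz₁l hj
  obtain ⟨δ, hδ, hmeet⟩ := exists_meeting e isOpen_ball hGd hz₁ hz₁b (s := 1 / ((n : ℝ) + 1))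
    Nat.one_div_pos_of_nat
  obtain ⟨i, hAi, hsi, hci⟩ := hdense _ n hn δ hδ
  have hsmall : ∀ᶠ m in atTop, 2 / ((φ m : ℝ) + 1) < δ := by
    have : Tendsto (fun N : ℕ => 2 / ((N : ℝ) + 1)) atTop (𝓝 0) := by
      simpa [div_eq_mul_inv] using (tendsto_one_div_add_atTop_nhds_zero_nat (𝕜 := ℝ)).const_mul 2
    exact (this.comp hφ.tendsto_atTop).eventually_lt_const hδ
  obtain ⟨m, hm1, hm2, hm3⟩ := ((hunif δ hδ).and (hsmall.and
    (hφ.tendsto_atTop.eventually_gt_atTop i))).exists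
  obtain ⟨x, u, hxu⟩ := hmeet (g (φ m)) (fun u => F (φ m) (σ (φ m) i u)) (c i)
    (hg _).differentiableOn ((hF _).comp (hσ _ _)) hm1 hci.le (fun u hu => by
      rw [← hsi] at hu
      have h5 := hFclose (φ m) (σ (φ m) i u)
        (mem_biUnion (x := i) hm3 ⟨u, by simpa using hu, rfl⟩)
      have h6 := (h3 (φ m) i hm3 hAi u hu).trans (min_le_right _ _)
      calc _ = ‖(F (φ m) (σ (φ m) i u) - Φ (φ m) (Ψ (incl κ μ (σ (φ m) i u)))) +
            (Φ (φ m) (Ψ (incl κ μ (σ (φ m) i u))) - (c i + embJ e u))‖ := by congr 1; abel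
        _ ≤ 1 / ((φ m : ℝ) + 1) + 1 / ((φ m : ℝ) + 1) :=
          (norm_add_le _ _).trans (add_le_add h5 h6)
        _ = 2 / ((φ m : ℝ) + 1) := by ring
        _ ≤ δ := hm2.le)
  exact hgF _ _ _ hxu

end Stages

section Blocks

variable {κ μ : Type*} [Fintype κ] [Fintype μ]

/-- Maps avoiding `F`, transverse to the first block of the splitting `e` at the origin and
separated there from `F₁`, are bounded by `R` in the `l`-th direction on `ball 0 a` as soon as they
are bounded by `r'` on `ball 0 a'`. -/
def Trap (F F₁ : (κ → ℂ) → (κ ⊕ μ → ℂ)) (r η R r' a a' : ℝ) (e : κ ⊕ μ ≃ κ ⊕ μ) (l : κ ⊕ μ) :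
    Prop :=
  ∀ g : (μ → ℂ) → (κ ⊕ μ → ℂ), Differentiable ℂ g → (∀ z ∈ ball 0 a', ‖g z‖ ≤ r') →
    (∀ v, ‖v‖ ≤ ‖projI e (fderiv ℂ g 0 v)‖) → ‖g 0‖ ≤ r - η → (∀ ζ, η ≤ ‖F₁ ζ - g 0‖) →
    (∀ z ζ, g z ≠ F ζ) → ∀ z ∈ ball 0 a, ‖g z l‖ ≤ R

theorem exists_block_aux [Nonempty κ] [Nonempty μ] {C : Set (κ → ℂ)} {η ρ r' a a' : ℝ}
    (hC1 : closedBall 0 1 ⊆ C) (hη : 0 < η) (ha : 0 < a) (haa : a < a')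
    (S : Finset ((κ ⊕ μ ≃ κ ⊕ μ) × (κ ⊕ μ))) :
    ∀ (Ψ : (κ ⊕ μ → ℂ) ≃ₜ (κ ⊕ μ → ℂ)), IsAut Ψ → (∀ e, Transverse Ψ e) → ∀ r, 0 < r → r < ρ →
    ∀ C', C ⊆ C' → IsCompact C' → ∀ ε > 0, ∃ Φ : (κ ⊕ μ → ℂ) ≃ₜ (κ ⊕ μ → ℂ), IsAut Φ ∧
      (∀ e, Transverse (Ψ.trans Φ) e) ∧ (∀ w ∈ closedBall 0 r, ‖Φ w - w‖ ≤ ε) ∧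
      (∀ ζ ∈ C', ‖Φ (Ψ (incl κ μ ζ)) - Ψ (incl κ μ ζ)‖ ≤ ε) ∧
      ∃ D : Set (κ → ℂ), IsCompact D ∧ ∃ δ > 0, ∀ F : (κ → ℂ) → (κ ⊕ μ → ℂ),
        Differentiable ℂ F → (∀ ζ ∈ D, ‖F ζ - Φ (Ψ (incl κ μ ζ))‖ ≤ δ) →
        ∀ x ∈ S, Trap F (fun ζ => Φ (Ψ (incl κ μ ζ))) r η (ρ + 1) r' a a' x.1 x.2 := by
  classical
  induction S using Finset.induction_on with
  | empty =>
    intro Ψ hΨ hΨe r hr hrρ C' hC' hC'c ε hε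
    exact ⟨Homeomorph.refl _, IsAut.refl, hΨe, by simp [hε.le], by simp [hε.le], ∅,
      isCompact_empty, 1, one_pos, by simp⟩
  | insert x S hx ih =>
    intro Ψ hΨ hΨe r hr hrρ C' hC' hC'c ε hε
    have hgood : ∀ᶠ δ in 𝓝[>] (0 : ℝ), ∀ e, ∀ Ψ' : (κ ⊕ μ → ℂ) → (κ ⊕ μ → ℂ),
        Differentiable ℂ Ψ' →
        (∀ ζ ∈ closedBall (0 : κ → ℂ) 1, ‖Ψ' (incl κ μ ζ) - Ψ (incl κ μ ζ)‖ ≤ δ) →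
        Transverse Ψ' e := by
      refine eventually_all.2 fun e => ?_
      obtain ⟨δ, hδ, h⟩ := (hΨe e).exists_of_close hΨ.differentiable
      filter_upwards [Ioo_mem_nhdsGT hδ] with t ht Ψ' hΨ' hcl
      exact h Ψ' hΨ' fun ζ hζ => (hcl ζ hζ).trans ht.2.le
    obtain ⟨δ₀, hδ₀, hδ₀pos⟩ := (hgood.and self_mem_nhdsWithin).exists
    replace hδ₀pos : 0 < δ₀ := hδ₀pos
    have hρr : 0 < ρ - r := sub_pos.2 hrρ
    obtain ⟨Φ₁, hΦ₁, h1, h2, D₁, hD₁, δ₁, hδ₁, h3⟩ := exists_stage hΨ (hΨe x.1) x.2 (r := r)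
      (C := C') (ε := min (min (ε / 2) δ₀) (min ((ρ - r) / 2) (η / 8))) (η := η / 2) (r' := r')
      hr hC'c (hC1.trans hC') (by positivity) (by positivity) ha haa
    have hm1 : min (min (ε / 2) δ₀) (min ((ρ - r) / 2) (η / 8)) ≤ ε / 2 :=
      (min_le_left _ _).trans (min_le_left _ _)
    have hm2 : min (min (ε / 2) δ₀) (min ((ρ - r) / 2) (η / 8)) ≤ δ₀ :=
      (min_le_left _ _).trans (min_le_right _ _)
    have hm3 : min (min (ε / 2) δ₀) (min ((ρ - r) / 2) (η / 8)) ≤ (ρ - r) / 2 :=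
      (min_le_right _ _).trans (min_le_left _ _)
    have hm4 : min (min (ε / 2) δ₀) (min ((ρ - r) / 2) (η / 8)) ≤ η / 8 :=
      (min_le_right _ _).trans (min_le_right _ _)
    have hΨ₁ : IsAut (Ψ.trans Φ₁) := hΨ.trans hΦ₁
    obtain ⟨Φ₂, hΦ₂, h4, h5, h6, D₂, hD₂, δ₂, hδ₂, h7⟩ := ih (Ψ.trans Φ₁) hΨ₁
      (fun e => hδ₀ e _ hΨ₁.differentiable fun ζ hζ => (h2 ζ (hC' (hC1 hζ))).trans hm2)
      ((r + ρ) / 2) (by linarith) (by linarith) (C' ∪ D₁) (hC'.trans subset_union_left)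
      (hC'c.union hD₁) (min (min (ε / 2) (δ₁ / 2)) (η / 8)) (by positivity)
    have hn1 : min (min (ε / 2) (δ₁ / 2)) (η / 8) ≤ ε / 2 :=
      (min_le_left _ _).trans (min_le_left _ _)
    have hn2 : min (min (ε / 2) (δ₁ / 2)) (η / 8) ≤ δ₁ / 2 :=
      (min_le_left _ _).trans (min_le_right _ _)
    have hn3 : min (min (ε / 2) (δ₁ / 2)) (η / 8) ≤ η / 8 := min_le_right _ _
    refine ⟨Φ₁.trans Φ₂, hΦ₁.trans hΦ₂, h4, fun w hw => ?_, fun ζ hζ => ?_, D₁ ∪ D₂,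
      hD₁.union hD₂, min (δ₁ / 2) δ₂, by positivity, fun F hF hclose y hy => ?_⟩
    · have h8 := h1 w hw
      rw [mem_closedBall, dist_zero_right] at hw
      have h9 : ‖Φ₁ w‖ ≤ (r + ρ) / 2 := by
        calc ‖Φ₁ w‖ = ‖(Φ₁ w - w) + w‖ := by simp
          _ ≤ (ρ - r) / 2 + r := (norm_add_le _ _).trans (add_le_add (h8.trans hm3) hw)
          _ = _ := by ring
      calc ‖Φ₂ (Φ₁ w) - w‖ = ‖(Φ₂ (Φ₁ w) - Φ₁ w) + (Φ₁ w - w)‖ := by congr 1; abel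
        _ ≤ ε / 2 + ε / 2 := (norm_add_le _ _).trans
          (add_le_add ((h5 _ (by simpa using h9)).trans hn1) (h8.trans hm1))
        _ = ε := by ring
    · calc ‖Φ₂ (Φ₁ (Ψ (incl κ μ ζ))) - Ψ (incl κ μ ζ)‖
          = ‖(Φ₂ (Φ₁ (Ψ (incl κ μ ζ))) - Φ₁ (Ψ (incl κ μ ζ))) +
            (Φ₁ (Ψ (incl κ μ ζ)) - Ψ (incl κ μ ζ))‖ := by congr 1; abel
        _ ≤ ε / 2 + ε / 2 := (norm_add_le _ _).trans
          (add_le_add ((h6 ζ (Or.inl hζ)).trans hn1) ((h2 ζ hζ).trans hm1))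
        _ = ε := by ring
    · rcases Finset.mem_insert.1 hy with rfl | hy
      · intro g hg hgr hgv hg0 hgη hgF z hz
        refine (h3 F hF (fun ζ hζ => ?_) g hg hgr hgv (fun ζ => ?_) hgF z hz).trans (by linarith)
        · calc _ = ‖(F ζ - Φ₂ (Φ₁ (Ψ (incl κ μ ζ)))) +
                (Φ₂ (Φ₁ (Ψ (incl κ μ ζ))) - Φ₁ (Ψ (incl κ μ ζ)))‖ := by congr 1; abel
            _ ≤ δ₁ / 2 + δ₁ / 2 := (norm_add_le _ _).trans (add_le_add
              ((hclose ζ (Or.inl hζ)).trans (min_le_left _ _)) ((h6 ζ (Or.inr hζ)).trans hn2))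
            _ = δ₁ := by ring
        · by_contra! hlt
          have h8 : ‖Ψ (incl κ μ ζ)‖ ≤ r := by
            calc ‖Ψ (incl κ μ ζ)‖ = ‖(Ψ (incl κ μ ζ) - g 0) + g 0‖ := by simp
              _ ≤ η / 2 + (r - η) := (norm_add_le _ _).trans (add_le_add hlt.le hg0)
              _ ≤ r := by linarith
          have h9 := h1 _ (by simpa using h8)
          have h10 : ‖Φ₁ (Ψ (incl κ μ ζ))‖ ≤ (r + ρ) / 2 := by
            calc _ = ‖(Φ₁ (Ψ (incl κ μ ζ)) - Ψ (incl κ μ ζ)) + Ψ (incl κ μ ζ)‖ := by simp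
              _ ≤ (ρ - r) / 2 + r := (norm_add_le _ _).trans (add_le_add (h9.trans hm3) h8)
              _ = _ := by ring
          have h11 := h5 _ (by simpa using h10)
          have h12 : η ≤ ‖Φ₂ (Φ₁ (Ψ (incl κ μ ζ))) - g 0‖ := hgη ζ
          have h13 : ‖Φ₂ (Φ₁ (Ψ (incl κ μ ζ))) - g 0‖ ≤ η / 8 + η / 8 + η / 2 := by
            calc _ = ‖(Φ₂ (Φ₁ (Ψ (incl κ μ ζ))) - Φ₁ (Ψ (incl κ μ ζ))) +
                  (Φ₁ (Ψ (incl κ μ ζ)) - Ψ (incl κ μ ζ)) + (Ψ (incl κ μ ζ) - g 0)‖ := by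
                  congr 1; abel
              _ ≤ _ := (norm_add₃_le).trans (add_le_add (add_le_add (h11.trans hn3)
                (h9.trans hm4)) hlt.le)
          linarith
      · intro g hg hgr hgv hg0 hgη hgF
        exact h7 F hF (fun ζ hζ => (hclose ζ (Or.inr hζ)).trans (min_le_right _ _)) y hy g hg hgr
          hgv (by linarith) hgη hgF

/-- One block of the construction: maps avoiding a small perturbation of the new embedding which
are bounded by `r'` on `ball 0 a'` are bounded by `r + 2` on `ball 0 a`. -/
theorem exists_block [Nonempty κ] [Nonempty μ] {C : Set (κ → ℂ)} {η r r' a a' ε : ℝ}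
    (hC1 : closedBall 0 1 ⊆ C) (hC : IsCompact C) (hη : 0 < η) (ha : 0 < a) (haa : a < a')
    {Ψ : (κ ⊕ μ → ℂ) ≃ₜ (κ ⊕ μ → ℂ)} (hΨ : IsAut Ψ) (hΨe : ∀ e, Transverse Ψ e) (hr : 0 < r)
    (hε : 0 < ε) :
    ∃ Φ : (κ ⊕ μ → ℂ) ≃ₜ (κ ⊕ μ → ℂ), IsAut Φ ∧
      (∀ e, Transverse (Ψ.trans Φ) e) ∧ (∀ w ∈ closedBall 0 r, ‖Φ w - w‖ ≤ ε) ∧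
      (∀ ζ ∈ C, ‖Φ (Ψ (incl κ μ ζ)) - Ψ (incl κ μ ζ)‖ ≤ ε) ∧
      ∃ D : Set (κ → ℂ), IsCompact D ∧ ∃ δ > 0, ∀ F : (κ → ℂ) → (κ ⊕ μ → ℂ),
        Differentiable ℂ F → (∀ ζ ∈ D, ‖F ζ - Φ (Ψ (incl κ μ ζ))‖ ≤ δ) →
        ∀ e l, Trap F (fun ζ => Φ (Ψ (incl κ μ ζ))) r η (r + 2) r' a a' e l := by
  classical
  obtain ⟨Φ, h1, h2, h3, h4, D, hD, δ, hδ, h5⟩ := exists_block_aux (ρ := r + 1) (r' := r') hC1 hη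
    ha haa Finset.univ Ψ hΨ hΨe r hr (by linarith) C Subset.rfl hC ε hε
  refine ⟨Φ, h1, h2, h3, h4, D, hD, δ, hδ, fun F hF hFD e l => ?_⟩
  have := h5 F hF hFD (e, l) (Finset.mem_univ _)
  rwa [show r + 1 + 1 = r + 2 by ring] at this

end Blocks

section Start

/-- A linear automorphism for which the embedded plane is transverse to every coordinate plane of
complementary dimension. -/
theorem exists_start (k m : ℕ) :
    ∃ Ψ : (Fin k ⊕ Fin m → ℂ) ≃ₜ (Fin k ⊕ Fin m → ℂ), IsAut Ψ ∧ ∀ e, Transverse Ψ e := by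
  set x : Fin k ⊕ Fin m → ℂ := fun i => ((finSumFinEquiv i : ℕ) : ℂ) with hx
  have hxinj : Function.Injective x := fun i j h =>
    finSumFinEquiv.injective (Fin.ext (Nat.cast_injective h))
  set M : Matrix (Fin k ⊕ Fin m) (Fin k ⊕ Fin m) ℂ :=
    Matrix.of fun i j => x i ^ (finSumFinEquiv j : ℕ) with hM
  have hMv : M = (Matrix.vandermonde (x ∘ finSumFinEquiv.symm)).submatrix finSumFinEquiv
      finSumFinEquiv := by
    ext i j
    simp [hM, Matrix.vandermonde_apply]
  have hdet : IsUnit M.det := by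
    rw [hMv, Matrix.det_submatrix_equiv_self, isUnit_iff_ne_zero,
      Matrix.det_vandermonde_ne_zero_iff]
    exact hxinj.comp finSumFinEquiv.symm.injective
  have hEnt : ∀ (A : Matrix (Fin k ⊕ Fin m) (Fin k ⊕ Fin m) ℂ) i, Ent fun w => A.mulVec w i :=
    fun A i => Ent.sum Finset.univ fun j _ => (Ent.const (A i j)).mul (Ent.coord j)
  obtain ⟨Ψ, hΨ, hΨw, -⟩ := exists_isAut (hEnt M) (hEnt M⁻¹)
    (fun w => by rw [Matrix.mulVec_mulVec, Matrix.nonsing_inv_mul _ hdet, Matrix.one_mulVec])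
    (fun w => by rw [Matrix.mulVec_mulVec, Matrix.mul_nonsing_inv _ hdet, Matrix.one_mulVec])
  refine ⟨Ψ, hΨ, fun e => ?_⟩
  set V : Matrix (Fin k) (Fin k) ℂ := Matrix.vandermonde fun a => x (e (Sum.inl a)) with hV
  have hVdet : IsUnit V := by
    rw [Matrix.isUnit_iff_isUnit_det, isUnit_iff_ne_zero, hV, Matrix.det_vandermonde_ne_zero_iff]
    exact hxinj.comp (e.injective.comp Sum.inl_injective)
  have hfun : (fun ζ => projJ e (Ψ (incl (Fin k) (Fin m) ζ))) =
      (LinearMap.toContinuousLinearMap (Matrix.toLin' V) : (Fin k → ℂ) →L[ℂ] (Fin k → ℂ)) := by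
    ext ζ a
    simp [hΨw, Matrix.mulVec, dotProduct, hM, hV, Matrix.vandermonde_apply]
  unfold Transverse
  rw [hfun, ContinuousLinearMap.fderiv]
  exact ⟨Matrix.mulVec_injective_iff_isUnit.2 hVdet, Matrix.mulVec_surjective_iff_isUnit.2 hVdet⟩

end Start

section Sequence

variable (κ μ : Type*) [Fintype κ] [Fintype μ]

/-- The data at one step of the inductive construction: an automorphism, the radius of the ball on
which it has stabilised, a compact set of parameters and a tolerance. -/
structure Stage where
  /-- the automorphism -/
  Ψ : (κ ⊕ μ → ℂ) ≃ₜ (κ ⊕ μ → ℂ)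
  /-- the radius in the target -/
  r : ℝ
  /-- the compact set in the source -/
  C : Set (κ → ℂ)
  /-- the tolerance -/
  ε : ℝ
  isAut : IsAut Ψ
  transverse : ∀ e, Transverse Ψ e
  two_lt_r : 2 < r
  isCompact : IsCompact C
  unitBall_subset : closedBall 0 1 ⊆ C
  ε_pos : 0 < ε
  ε_le : ε ≤ 1 / 8

variable {κ μ}

/-- The embedding attached to a stage. -/
def Stage.emb (x : Stage κ μ) (ζ : κ → ℂ) : κ ⊕ μ → ℂ := x.Ψ (incl κ μ ζ)

/-- The relation between two consecutive stages. -/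
structure Stage.Step (Q : ℕ) (x y : Stage κ μ) : Prop where
  close : ∀ w ∈ closedBall 0 x.r, ‖y.Ψ (x.Ψ.symm w) - w‖ ≤ x.ε
  closeC : ∀ ζ ∈ x.C, ‖y.emb ζ - x.emb ζ‖ ≤ x.ε
  subset : x.C ⊆ y.C
  ε_le_half : y.ε ≤ x.ε / 2
  r_le : x.r + 3 ≤ y.r
  ball_subset : closedBall 0 ((Q : ℝ) + 2) ⊆ y.C
  bound : closedBall 0 ((Q : ℝ) + 1) ⊆ x.C → ∀ ζ ∈ closedBall 0 ((Q : ℝ) + 1), ‖y.emb ζ‖ ≤ y.r - 1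
  trap : ∀ F : (κ → ℂ) → (κ ⊕ μ → ℂ), Differentiable ℂ F →
    (∀ ζ ∈ y.C, ‖F ζ - y.emb ζ‖ ≤ 2 * y.ε) → ∀ e l,
      Trap F y.emb x.r x.ε (x.r + 2) (y.r + 2) (2 - 1 / ((Q : ℝ) + 1)) (2 - 1 / ((Q : ℝ) + 2)) e l

theorem Stage.differentiable_emb (x : Stage κ μ) : Differentiable ℂ x.emb :=
  x.isAut.differentiable.comp (incl κ μ).differentiable

theorem Stage.exists_step [Nonempty κ] [Nonempty μ] (x : Stage κ μ) (Q : ℕ) :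
    ∃ y, Stage.Step Q x y := by
  obtain ⟨B, hB, hBle⟩ := exists_bound_closedBall x.differentiable_emb.continuous ((Q : ℝ) + 1)
  have hQ : (0 : ℝ) ≤ Q := Q.cast_nonneg
  have hxr := x.two_lt_r
  have hxε := x.ε_pos
  have ha : 0 < 2 - 1 / ((Q : ℝ) + 1) := by
    have : 1 / ((Q : ℝ) + 1) ≤ 1 := by rw [div_le_one (by positivity)]; linarith
    linarith
  have haa : 2 - 1 / ((Q : ℝ) + 1) < 2 - 1 / ((Q : ℝ) + 2) := by
    have : 1 / ((Q : ℝ) + 2) < 1 / ((Q : ℝ) + 1) := by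
      apply one_div_lt_one_div_of_lt <;> linarith
    linarith
  obtain ⟨Φ, h1, h2, h3, h4, D, hD, δ, hδ, h5⟩ := exists_block (r' := x.r + 3 + (B + 2) + 2)
    x.unitBall_subset x.isCompact x.ε_pos ha haa x.isAut x.transverse (r := x.r) (by linarith)
    x.ε_pos
  refine ⟨⟨x.Ψ.trans Φ, x.r + 3 + (B + 2), x.C ∪ D ∪ closedBall 0 ((Q : ℝ) + 2),
    min (x.ε / 2) (δ / 2), x.isAut.trans h1, h2, by linarith,
    (x.isCompact.union hD).union (isCompact_closedBall _ _),
    x.unitBall_subset.trans (subset_union_left.trans subset_union_left), by positivity,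
    (min_le_left _ _).trans (by linarith [x.ε_le])⟩, ?_⟩
  constructor
  · intro w hw
    simpa using h3 w hw
  · exact h4
  · exact subset_union_left.trans subset_union_left
  · exact min_le_left _ _
  · change x.r + 3 ≤ x.r + 3 + (B + 2)
    linarith
  · exact subset_union_right
  · intro hsub ζ hζ
    change ‖Φ (x.Ψ (incl κ μ ζ))‖ ≤ x.r + 3 + (B + 2) - 1
    have h6 : ‖x.Ψ (incl κ μ ζ)‖ ≤ B := hBle ζ (by simpa using hζ)
    have h7 := h4 ζ (hsub hζ)
    calc _ = ‖(Φ (x.Ψ (incl κ μ ζ)) - x.Ψ (incl κ μ ζ)) + x.Ψ (incl κ μ ζ)‖ := by simp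
      _ ≤ x.ε + B := (norm_add_le _ _).trans (add_le_add h7 h6)
      _ ≤ _ := by linarith [x.ε_le]
  · intro F hF hcl
    refine h5 F hF fun ζ hζ => (hcl ζ (Or.inl (Or.inr hζ))).trans ?_
    change 2 * min (x.ε / 2) (δ / 2) ≤ δ
    linarith [min_le_right (x.ε / 2) (δ / 2)]

/-- An infinite sequence of stages. -/
theorem exists_stage_seq (k m : ℕ) (hk : 0 < k) (hm : 0 < m) :
    ∃ s : ℕ → Stage (Fin k) (Fin m), ∀ Q, Stage.Step Q (s Q) (s (Q + 1)) := by
  have : Nonempty (Fin k) := ⟨⟨0, hk⟩⟩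
  have : Nonempty (Fin m) := ⟨⟨0, hm⟩⟩
  obtain ⟨Ψ, hΨ, hΨe⟩ := exists_start k m
  choose f hf using fun (Q : ℕ) (x : Stage (Fin k) (Fin m)) => x.exists_step Q
  exact ⟨fun Q => Nat.rec ⟨Ψ, 3, closedBall 0 1, 1 / 8, hΨ, hΨe, by norm_num,
    isCompact_closedBall _ _, Subset.rfl, by norm_num, le_rfl⟩ f Q, fun Q => hf Q _⟩

variable {s : ℕ → Stage κ μ} (hs : ∀ Q, Stage.Step Q (s Q) (s (Q + 1)))
include hs

theorem ball_subset_C (Q : ℕ) : closedBall 0 ((Q : ℝ) + 1) ⊆ (s Q).C := by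
  cases Q with
  | zero => simpa using (s 0).unitBall_subset
  | succ Q =>
    have := (hs Q).ball_subset
    push_cast
    rwa [add_assoc, one_add_one_eq_two]

theorem ε_add_le (Q j : ℕ) : (s (Q + j)).ε ≤ (s Q).ε * (1 / 2) ^ j := by
  induction j with
  | zero => simp
  | succ j ih =>
    have := (hs (Q + j)).ε_le_half
    rw [← add_assoc, pow_succ]
    linarith

theorem r_add_le (Q j : ℕ) : (s Q).r + 3 * j ≤ (s (Q + j)).r := by
  induction j with
  | zero => simp
  | succ j ih =>
    have := (hs (Q + j)).r_le
    rw [← add_assoc]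
    push_cast
    linarith

theorem C_subset (Q j : ℕ) : (s Q).C ⊆ (s (Q + j)).C := by
  induction j with
  | zero => exact Subset.rfl
  | succ j ih => exact ih.trans (hs (Q + j)).subset

theorem norm_emb_add_sub_le (Q j : ℕ) {ζ : κ → ℂ} (hζ : ζ ∈ (s Q).C) :
    ‖(s (Q + j)).emb ζ - (s Q).emb ζ‖ ≤ 2 * (s Q).ε * (1 - (1 / 2) ^ j) := by
  induction j with
  | zero => simp
  | succ j ih =>
    have h1 := (hs (Q + j)).closeC ζ (C_subset hs Q j hζ)
    have h2 := ε_add_le hs Q j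
    rw [← add_assoc, pow_succ]
    calc _ = ‖((s (Q + j + 1)).emb ζ - (s (Q + j)).emb ζ) +
          ((s (Q + j)).emb ζ - (s Q).emb ζ)‖ := by congr 1; abel
      _ ≤ _ := (norm_add_le _ _).trans (add_le_add h1 ih)
      _ ≤ _ := by linarith

theorem norm_tail_sub_le (Q j : ℕ) {w : κ ⊕ μ → ℂ} (hw : ‖w‖ ≤ (s Q).r) :
    ‖(s (Q + j)).Ψ ((s Q).Ψ.symm w) - w‖ ≤ 2 * (s Q).ε * (1 - (1 / 2) ^ j) := by
  induction j with
  | zero => simp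
  | succ j ih =>
    have h2 := ε_add_le hs Q j
    have h3 := r_add_le hs Q j
    have h6 : ‖(s (Q + j)).Ψ ((s Q).Ψ.symm w)‖ ≤ (s (Q + j)).r := by
      rcases Nat.eq_zero_or_pos j with rfl | hj
      · simpa using hw
      · have h4 : (1 : ℝ) ≤ j := by exact_mod_cast hj
        have h5 : 2 * (s Q).ε * (1 - (1 / 2) ^ j) ≤ 2 * (s Q).ε * 1 := by
          have := (s Q).ε_pos
          gcongr
          simp
        calc _ = ‖((s (Q + j)).Ψ ((s Q).Ψ.symm w) - w) + w‖ := by simp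
          _ ≤ 2 * (s Q).ε * 1 + (s Q).r := (norm_add_le _ _).trans (add_le_add (ih.trans h5) hw)
          _ ≤ _ := by linarith [(s Q).ε_le]
    have h1 := (hs (Q + j)).close _ (by simpa using h6)
    rw [Homeomorph.symm_apply_apply] at h1
    rw [← add_assoc, pow_succ]
    calc _ = ‖((s (Q + j + 1)).Ψ ((s Q).Ψ.symm w) - (s (Q + j)).Ψ ((s Q).Ψ.symm w)) +
          ((s (Q + j)).Ψ ((s Q).Ψ.symm w) - w)‖ := by congr 1; abel
      _ ≤ _ := (norm_add_le _ _).trans (add_le_add h1 ih)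
      _ ≤ _ := by linarith

theorem norm_tail_sub_le' (Q j : ℕ) {w : κ ⊕ μ → ℂ} (hw : ‖w‖ ≤ (s Q).r) :
    ‖(s (Q + j)).Ψ ((s Q).Ψ.symm w) - w‖ ≤ 2 * (s Q).ε := by
  refine (norm_tail_sub_le hs Q j hw).trans ?_
  have h1 := (s Q).ε_pos
  have h2 : (0 : ℝ) ≤ (1 / 2) ^ j := by positivity
  nlinarith

theorem norm_emb_add_sub_le' (Q j : ℕ) {ζ : κ → ℂ} (hζ : ζ ∈ (s Q).C) :
    ‖(s (Q + j)).emb ζ - (s Q).emb ζ‖ ≤ 2 * (s Q).ε := by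
  refine (norm_emb_add_sub_le hs Q j hζ).trans ?_
  have h1 := (s Q).ε_pos
  have h2 : (0 : ℝ) ≤ (1 / 2) ^ j := by positivity
  nlinarith

theorem tendsto_ε : Tendsto (fun Q => (s Q).ε) atTop (𝓝 0) := by
  have h1 : Tendsto (fun Q : ℕ => (s 0).ε * (1 / 2 : ℝ) ^ Q) atTop (𝓝 0) := by
    simpa using (tendsto_pow_atTop_nhds_zero_of_lt_one (r := (1 / 2 : ℝ)) (by norm_num)
      (by norm_num)).const_mul (s 0).ε
  refine squeeze_zero (fun Q => (s Q).ε_pos.le) (fun Q => ?_) h1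
  simpa using ε_add_le hs 0 Q

theorem le_r (Q : ℕ) : (Q : ℝ) ≤ (s Q).r := by
  have := r_add_le hs 0 Q
  rw [zero_add] at this
  have h1 := (s 0).two_lt_r
  have h2 : (0 : ℝ) ≤ Q := Q.cast_nonneg
  linarith

theorem exists_limit : ∃ F : (κ → ℂ) → (κ ⊕ μ → ℂ),
    ∀ ζ, Tendsto (fun Q => (s Q).emb ζ) atTop (𝓝 (F ζ)) := by
  refine ⟨_, fun ζ => ((cauchySeq_tendsto_of_complete (Metric.cauchySeq_iff'.2
    fun ε hε => ?_)).choose_spec)⟩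
  obtain ⟨N, hN⟩ := exists_nat_ge ‖ζ‖
  obtain ⟨Q, hQN, hQ⟩ := ((eventually_ge_atTop N).and ((tendsto_ε hs).eventually
    (gt_mem_nhds (show (0 : ℝ) < ε / 2 by positivity)))).exists
  refine ⟨Q, fun n hn => ?_⟩
  obtain ⟨j, rfl⟩ := Nat.exists_eq_add_of_le hn
  have hζ : ζ ∈ (s Q).C := ball_subset_C hs Q (by
    have : (N : ℝ) ≤ Q := by exact_mod_cast hQN
    rw [mem_closedBall, dist_zero_right]
    linarith)
  rw [dist_eq_norm]
  exact (norm_emb_add_sub_le' hs Q j hζ).trans_lt (by linarith)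

variable {F : (κ → ℂ) → (κ ⊕ μ → ℂ)}
  (hF : ∀ ζ, Tendsto (fun Q => (s Q).emb ζ) atTop (𝓝 (F ζ)))
include hF

theorem norm_limit_sub_le (Q : ℕ) {ζ : κ → ℂ} (hζ : ζ ∈ (s Q).C) :
    ‖F ζ - (s Q).emb ζ‖ ≤ 2 * (s Q).ε := by
  refine le_of_tendsto (((hF ζ).sub_const _).norm) ?_
  filter_upwards [eventually_ge_atTop Q] with n hn
  obtain ⟨j, rfl⟩ := Nat.exists_eq_add_of_le hn
  exact norm_emb_add_sub_le' hs Q j hζ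

theorem norm_limit_sub_le_of_norm_le (Q : ℕ) {ζ : κ → ℂ} (hζ : ‖(s Q).emb ζ‖ ≤ (s Q).r) :
    ‖F ζ - (s Q).emb ζ‖ ≤ 2 * (s Q).ε := by
  refine le_of_tendsto (((hF ζ).sub_const _).norm) ?_
  filter_upwards [eventually_ge_atTop Q] with n hn
  obtain ⟨j, rfl⟩ := Nat.exists_eq_add_of_le hn
  simpa [Stage.emb] using norm_tail_sub_le' hs Q j hζ

theorem differentiable_limit : Differentiable ℂ F := by
  intro ζ
  have h : TendstoUniformlyOn (fun Q => (s Q).emb) F atTop (ball 0 (‖ζ‖ + 1)) := by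
    rw [Metric.tendstoUniformlyOn_iff]
    intro ε hε
    obtain ⟨N, hN⟩ := exists_nat_ge ‖ζ‖
    filter_upwards [eventually_ge_atTop N, (tendsto_ε hs).eventually
      (gt_mem_nhds (show (0 : ℝ) < ε / 2 by positivity))] with Q hQN hQ x hx
    rw [dist_eq_norm]
    refine (norm_limit_sub_le hs hF Q (ball_subset_C hs Q ?_)).trans_lt (by linarith)
    have : (N : ℝ) ≤ Q := by exact_mod_cast hQN
    rw [mem_ball, dist_zero_right] at hx
    rw [mem_closedBall, dist_zero_right]
    linarith
  exact (limit_of_tendstoUniformlyOn isOpen_ball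
    (fun Q => (s Q).differentiable_emb.differentiableOn) h (by simp)).1

theorem half_norm_sub_le (Q : ℕ) {ζ ζ' : κ → ℂ} (hζ : ‖ζ‖ ≤ (Q : ℝ) + 1)
    (hζ' : ‖ζ'‖ ≤ (Q : ℝ) + 1) :
    1 / 2 * ‖(s (Q + 1)).emb ζ - (s (Q + 1)).emb ζ'‖ ≤ ‖F ζ - F ζ'‖ := by
  refine ge_of_tendsto (((hF ζ).sub (hF ζ')).norm) ?_
  filter_upwards [eventually_ge_atTop (Q + 1)] with n hn
  obtain ⟨j, rfl⟩ := Nat.exists_eq_add_of_le hn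
  set x := s (Q + 1) with hx
  set y := s (Q + 1 + j) with hy
  have hb : ∀ ζ : κ → ℂ, ‖ζ‖ ≤ (Q : ℝ) + 1 → x.emb ζ ∈ closedBall 0 (x.r - 1) := fun ζ hζ => by
    simpa using (hs Q).bound (ball_subset_C hs Q) ζ (by simpa using hζ)
  have hd : Differentiable ℂ fun w => y.Ψ (x.Ψ.symm w) - w :=
    (y.isAut.differentiable.comp x.isAut.symm.differentiable).sub differentiable_id
  have hL := norm_sub_le_of_bound (f := fun w => y.Ψ (x.Ψ.symm w) - w)
    (S := closedBall 0 (x.r - 1)) (ρ := 1) (M := 1 / 4) (convex_closedBall _ _) one_pos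
    (fun _ _ => hd.differentiableOn) (fun w hw z hz => by
      have h1 : ‖z‖ ≤ x.r := by
        rw [mem_closedBall, dist_zero_right] at hw
        rw [mem_ball, dist_eq_norm] at hz
        calc ‖z‖ = ‖(z - w) + w‖ := by simp
          _ ≤ 1 + (x.r - 1) := (norm_add_le _ _).trans (add_le_add hz.le hw)
          _ = _ := by ring
      exact (norm_tail_sub_le' hs (Q + 1) j h1).trans (by linarith [x.ε_le])) (hb ζ' hζ')
    (hb ζ hζ)
  simp only [Stage.emb, Homeomorph.symm_apply_apply] at hL ⊢
  have h2 : ‖x.Ψ (incl κ μ ζ) - x.Ψ (incl κ μ ζ')‖ ≤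
      ‖y.Ψ (incl κ μ ζ) - y.Ψ (incl κ μ ζ')‖ + 2 * (1 / 4) / 1 *
        ‖x.Ψ (incl κ μ ζ) - x.Ψ (incl κ μ ζ')‖ := by
    calc _ = ‖(y.Ψ (incl κ μ ζ) - y.Ψ (incl κ μ ζ')) - (y.Ψ (incl κ μ ζ) - x.Ψ (incl κ μ ζ) -
          (y.Ψ (incl κ μ ζ') - x.Ψ (incl κ μ ζ')))‖ := by congr 1; abel
      _ ≤ _ := (norm_sub_le _ _).trans (add_le_add le_rfl hL)
  linarith

omit hs hF in
theorem norm_le_norm_incl (ζ : κ → ℂ) : ‖ζ‖ ≤ ‖incl κ μ ζ‖ := by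
  simpa using norm_projJ (Equiv.refl (κ ⊕ μ)) (incl κ μ ζ)

omit hs hF in
theorem Stage.injective_emb (x : Stage κ μ) : Function.Injective x.emb := fun ζ ζ' h => by
  have h1 := congrArg (projJ (Equiv.refl _)) (x.Ψ.injective h)
  simpa using h1

omit hs hF in
theorem Stage.injective_fderiv_emb (x : Stage κ μ) (ζ : κ → ℂ) :
    Function.Injective (fderiv ℂ x.emb ζ) := by
  have h1 : HasFDerivAt (fun ζ => projJ (Equiv.refl _) (x.Ψ.symm (x.emb ζ)))
      (((projJ (Equiv.refl _)).comp (fderiv ℂ x.Ψ.symm (x.emb ζ))).comp (fderiv ℂ x.emb ζ)) ζ :=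
    ((projJ (Equiv.refl _)).hasFDerivAt.comp _
      (x.isAut.symm.differentiable _).hasFDerivAt).comp ζ (x.differentiable_emb ζ).hasFDerivAt
  have h2 : (fun ζ => projJ (Equiv.refl _) (x.Ψ.symm (x.emb ζ))) = id := by
    ext1 ζ
    simp [Stage.emb]
  rw [h2] at h1
  have h3 := h1.unique (hasFDerivAt_id ζ)
  intro v w hvw
  have h4 := congrArg (fun l => l v) h3
  have h5 := congrArg (fun l => l w) h3
  simp only [ContinuousLinearMap.comp_apply, ContinuousLinearMap.id_apply] at h4 h5
  rw [← h4, ← h5, hvw]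

theorem injective_limit : Function.Injective F := by
  intro ζ ζ' h
  obtain ⟨Q, hQ⟩ := exists_nat_ge (max ‖ζ‖ ‖ζ'‖)
  have h1 := half_norm_sub_le hs hF Q (ζ := ζ) (ζ' := ζ')
    (by linarith [le_max_left ‖ζ‖ ‖ζ'‖]) (by linarith [le_max_right ‖ζ‖ ‖ζ'‖])
  rw [h, sub_self, norm_zero] at h1
  have h2 : ‖(s (Q + 1)).emb ζ - (s (Q + 1)).emb ζ'‖ ≤ 0 := by linarith
  exact (s (Q + 1)).injective_emb (sub_eq_zero.1 (norm_le_zero_iff.1 h2))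

theorem injective_fderiv_limit (ζ : κ → ℂ) : Function.Injective (fderiv ℂ F ζ) := by
  obtain ⟨Q, hQ⟩ := exists_nat_ge ‖ζ‖
  rw [injective_iff_map_eq_zero]
  intro v hv
  have hc : Tendsto (fun n : ℕ => ‖(n : ℂ)‖) atTop atTop := by
    simpa using tendsto_natCast_atTop_atTop (R := ℝ)
  have h1 := (differentiable_limit hs hF ζ).hasFDerivAt.lim v hc
  have h2 := ((s (Q + 1)).differentiable_emb ζ).hasFDerivAt.lim v hc
  have h3 : 1 / 2 * ‖fderiv ℂ (s (Q + 1)).emb ζ v‖ ≤ ‖fderiv ℂ F ζ v‖ := by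
    refine le_of_tendsto_of_tendsto (h2.norm.const_mul _) h1.norm ?_
    obtain ⟨N, hN⟩ := exists_nat_ge ‖v‖
    filter_upwards [eventually_ge_atTop (max N 1)] with n hn
    have hn1 : (1 : ℝ) ≤ n := by exact_mod_cast (le_max_right _ _).trans hn
    have hnN : (N : ℝ) ≤ n := by exact_mod_cast (le_max_left _ _).trans hn
    have h4 : ‖(n : ℂ)⁻¹ • v‖ ≤ 1 := by
      rw [norm_smul, norm_inv, Complex.norm_natCast, ← div_eq_inv_mul,
        div_le_one (by linarith)]
      linarith
    have := half_norm_sub_le hs hF Q (ζ := ζ + (n : ℂ)⁻¹ • v) (ζ' := ζ)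
      ((norm_add_le _ _).trans (add_le_add hQ h4)) (by linarith)
    rw [norm_smul, norm_smul]
    nlinarith [norm_nonneg (n : ℂ)]
  rw [hv, norm_zero] at h3
  have h4 : ‖fderiv ℂ (s (Q + 1)).emb ζ v‖ ≤ 0 := by linarith
  exact (injective_iff_map_eq_zero _).1 ((s (Q + 1)).injective_fderiv_emb ζ) v
    (norm_le_zero_iff.1 h4)

omit hs hF in
/-- A homeomorphism close to the identity on a ball keeps the exterior of the ball away from the
centre. -/
theorem sub_one_le_norm_of_close {Φ : (κ ⊕ μ → ℂ) ≃ₜ (κ ⊕ μ → ℂ)} {r : ℝ} (hr : 2 < r)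
    (h : ∀ w, ‖w‖ ≤ r → ‖Φ w - w‖ ≤ 1) {w : κ ⊕ μ → ℂ} (hw : r < ‖w‖) : r - 1 ≤ ‖Φ w‖ := by
  by_contra! hlt
  have hr1 : 0 < r - 1 := by linarith
  have h0 : ‖Φ 0‖ ≤ 1 := by simpa using h 0 (by simp; linarith)
  obtain ⟨u, hu, hz1⟩ : ∃ u : κ ⊕ μ → ℂ, ‖u‖ = r ∧ ‖Φ u‖ < r - 1 := by
    by_contra! hcon
    obtain ⟨z, -, hz1, hz2⟩ := (convex_ball (0 : κ ⊕ μ → ℂ) (r - 1)).isPreconnected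
      (Φ.symm ⁻¹' {u | ‖u‖ < r}) (Φ.symm ⁻¹' {u | r < ‖u‖})
      ((isOpen_lt continuous_norm continuous_const).preimage Φ.symm.continuous)
      ((isOpen_lt continuous_const continuous_norm).preimage Φ.symm.continuous)
      (fun z hz => by
        rw [mem_ball, dist_zero_right] at hz
        rcases lt_trichotomy ‖Φ.symm z‖ r with h1 | h1 | h1
        · exact Or.inl h1
        · have h2 := hcon _ h1
          rw [Φ.apply_symm_apply] at h2
          linarith
        · exact Or.inr h1)
      ⟨Φ 0, by simp; linarith, by simp; linarith⟩ ⟨Φ w, by simpa using hlt, by simpa using hw⟩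
    simp only [mem_preimage, Set.mem_ofPred_eq] at hz1 hz2
    linarith
  have h1 := h u hu.le
  have h2 : ‖u‖ ≤ ‖Φ u‖ + ‖Φ u - u‖ := by
    calc ‖u‖ = ‖Φ u - (Φ u - u)‖ := by simp
      _ ≤ _ := norm_sub_le _ _
  linarith

theorem sub_one_le_norm_limit (Q : ℕ) {ζ : κ → ℂ} (hζ : (s Q).r < ‖(s Q).emb ζ‖) :
    (s Q).r - 1 ≤ ‖F ζ‖ := by
  refine ge_of_tendsto (hF ζ).norm ?_
  filter_upwards [eventually_ge_atTop Q] with n hn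
  obtain ⟨j, rfl⟩ := Nat.exists_eq_add_of_le hn
  have := sub_one_le_norm_of_close (Φ := (s Q).Ψ.symm.trans (s (Q + j)).Ψ) (s Q).two_lt_r
    (fun w hw => (norm_tail_sub_le' hs Q j hw).trans (by linarith [(s Q).ε_le])) hζ
  simpa [Stage.emb] using this

theorem exists_norm_le_of_norm_limit_le (R : ℝ) : ∃ R', ∀ ζ, ‖F ζ‖ ≤ R → ‖ζ‖ ≤ R' := by
  obtain ⟨Q, hQ⟩ := exists_nat_gt (R + 1)
  obtain ⟨R', hR', h⟩ := exists_bound_closedBall (s Q).Ψ.symm.continuous (s Q).r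
  refine ⟨R', fun ζ hζ => ?_⟩
  have h1 : ‖(s Q).emb ζ‖ ≤ (s Q).r := by
    by_contra! hlt
    have := sub_one_le_norm_limit hs hF Q hlt
    have := le_r hs Q
    linarith
  have h2 := h _ h1
  rw [Stage.emb, Homeomorph.symm_apply_apply] at h2
  exact (norm_le_norm_incl ζ).trans h2

end Sequence

section Avoidance

variable {κ μ : Type*} [Fintype κ] [Fintype μ] {s : ℕ → Stage κ μ}
  (hs : ∀ Q, Stage.Step Q (s Q) (s (Q + 1))) {F : (κ → ℂ) → (κ ⊕ μ → ℂ)}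
  (hF : ∀ ζ, Tendsto (fun Q => (s Q).emb ζ) atTop (𝓝 (F ζ)))
include hs hF

theorem exists_pos_le_norm_limit_sub {x₀ : κ ⊕ μ → ℂ} (hx₀ : ∀ ζ, x₀ ≠ F ζ) :
    ∃ δ > 0, ∀ ζ, δ ≤ ‖F ζ - x₀‖ := by
  obtain ⟨R, hR⟩ := exists_norm_le_of_norm_limit_le hs hF (‖x₀‖ + 1)
  have hc : Continuous fun ζ => ‖F ζ - x₀‖ :=
    ((differentiable_limit hs hF).continuous.sub continuous_const).norm
  obtain ⟨ζ₀, -, hmin⟩ := (isCompact_closedBall (0 : κ → ℂ) (max R 0)).exists_isMinOn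
    ⟨0, by simp⟩ hc.continuousOn
  refine ⟨min ‖F ζ₀ - x₀‖ 1, lt_min (norm_pos_iff.2 (sub_ne_zero.2 (hx₀ ζ₀).symm)) one_pos,
    fun ζ => ?_⟩
  by_cases hζ : ‖F ζ‖ ≤ ‖x₀‖ + 1
  · exact (min_le_left _ _).trans (hmin (by simpa using Or.inl (hR ζ hζ)))
  · refine (min_le_right _ _).trans ?_
    have := norm_sub_norm_le (F ζ) x₀
    linarith

/-- Around a point off the limit embedding, the late stages keep their distance. -/
theorem exists_forall_ε_le {x₀ : κ ⊕ μ → ℂ} (hx₀ : ∀ ζ, x₀ ≠ F ζ) :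
    ∃ Q₀ : ℕ, ∀ Q ≥ Q₀, ‖x₀‖ ≤ (s Q).r - (s Q).ε ∧ ∀ ζ, (s Q).ε ≤ ‖(s (Q + 1)).emb ζ - x₀‖ := by
  obtain ⟨δ, hδ, hle⟩ := exists_pos_le_norm_limit_sub hs hF hx₀
  obtain ⟨N, hN⟩ := exists_nat_ge (‖x₀‖ + 1)
  obtain ⟨Q₀, hQ₀⟩ := eventually_atTop.1 ((eventually_ge_atTop N).and ((tendsto_ε hs).eventually
    (gt_mem_nhds (show (0 : ℝ) < δ / 2 by positivity))))
  refine ⟨Q₀, fun Q hQ => ?_⟩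
  obtain ⟨h1, h2⟩ := hQ₀ Q hQ
  have h3 : (N : ℝ) ≤ Q := by exact_mod_cast h1
  have h4 := le_r hs Q
  have h5 := (s Q).ε_le
  refine ⟨by linarith, fun ζ => ?_⟩
  have h6 := (hs Q).ε_le_half
  have h7 := (hs Q).r_le
  by_cases hζ : ‖(s (Q + 1)).emb ζ‖ ≤ (s (Q + 1)).r
  · have h8 := norm_limit_sub_le_of_norm_le hs hF (Q + 1) hζ
    have h9 : ‖F ζ - x₀‖ ≤ ‖F ζ - (s (Q + 1)).emb ζ‖ + ‖(s (Q + 1)).emb ζ - x₀‖ :=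
      norm_sub_le_norm_sub_add_norm_sub _ _ _
    have := hle ζ
    linarith
  · have := norm_sub_norm_le ((s (Q + 1)).emb ζ) x₀
    linarith

/-- An entire map whose derivative covers the second block of a splitting meets the limit
embedding. -/
theorem exists_eq_limit [Nonempty μ] {V : Type*} [NormedAddCommGroup V] [NormedSpace ℂ V]
    {g : V → (κ ⊕ μ → ℂ)} (hg : Differentiable ℂ g) (e : κ ⊕ μ ≃ κ ⊕ μ) (z₀ : V)
    (L : (μ → ℂ) →L[ℂ] V) (hL : ∀ v, projI e (fderiv ℂ g z₀ (L v)) = v) : ∃ z ζ, g z = F ζ := by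
  by_contra! hgF
  obtain ⟨Q₀, hQ₀⟩ := exists_forall_ε_le hs hF (hgF z₀)
  set t : ℝ := 2 * ((s Q₀).r + 2) + 1 with ht
  have hr0 := (s Q₀).two_lt_r
  have ht1 : 1 ≤ t := by linarith
  set h : (μ → ℂ) → (κ ⊕ μ → ℂ) := fun w => g (z₀ + (t : ℂ) • L w) with hh
  have hhd : Differentiable ℂ h := by fun_prop
  have h0 : h 0 = g z₀ := by simp [hh]
  have hfd : ∀ v, fderiv ℂ h 0 v = (t : ℂ) • fderiv ℂ g z₀ (L v) := by
    intro v
    have h1 : HasFDerivAt (fun w => z₀ + (t : ℂ) • L w) ((t : ℂ) • L) 0 :=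
      (L.hasFDerivAt.const_smul (t : ℂ)).const_add z₀
    have h2 := HasFDerivAt.comp (g := g) (g' := fderiv ℂ g z₀) (0 : μ → ℂ)
      (by simpa using (hg z₀).hasFDerivAt) h1
    rw [show h = g ∘ fun w => z₀ + (t : ℂ) • L w from rfl, h2.fderiv]
    simp
  have hexp : ∀ v, ‖projI e (fderiv ℂ h 0 v)‖ = t * ‖v‖ := by
    intro v
    rw [hfd, map_smul, hL, norm_smul, Complex.norm_real, Real.norm_of_nonneg (by linarith)]
  have hstep : ∀ Q ≥ Q₀, (∀ z ∈ ball 0 (2 - 1 / ((Q : ℝ) + 2)), ‖h z‖ ≤ (s (Q + 1)).r + 2) →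
      ∀ z ∈ ball 0 (2 - 1 / ((Q : ℝ) + 1)), ‖h z‖ ≤ (s Q).r + 2 := by
    intro Q hQ hb z hz
    have hr := (s Q).two_lt_r
    refine (pi_norm_le_iff_of_nonneg (by linarith)).2 fun l => ?_
    refine (hs Q).trap F (differentiable_limit hs hF)
      (fun ζ hζ => norm_limit_sub_le hs hF (Q + 1) hζ) e l h hhd hb (fun v => ?_) ?_ ?_
      (fun z ζ => hgF _ ζ) z hz
    · rw [hexp]
      nlinarith [norm_nonneg v]
    · rw [h0]
      exact (hQ₀ Q hQ).1
    · rw [h0]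
      exact (hQ₀ Q hQ).2
  obtain ⟨B, hB, hBle⟩ := exists_bound_closedBall hhd.continuous 2
  obtain ⟨N, hN⟩ := exists_nat_ge B
  have hdesc : ∀ j : ℕ, (∀ z ∈ ball 0 (2 - 1 / (((Q₀ + j : ℕ) : ℝ) + 1)),
      ‖h z‖ ≤ (s (Q₀ + j)).r + 2) →
      ∀ z ∈ ball 0 (2 - 1 / ((Q₀ : ℝ) + 1)), ‖h z‖ ≤ (s Q₀).r + 2 := by
    intro j
    induction j with
    | zero => exact fun h => h
    | succ j ih =>
      intro hb
      refine ih (hstep _ (by omega) ?_)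
      have e1 : ((Q₀ + (j + 1) : ℕ) : ℝ) + 1 = ((Q₀ + j : ℕ) : ℝ) + 2 := by push_cast; ring
      rwa [e1] at hb
  have hfin := hdesc N fun z hz => by
    have h1 : 0 < 1 / (((Q₀ + N : ℕ) : ℝ) + 1) := by positivity
    rw [mem_ball, dist_zero_right] at hz
    have h2 := hBle z (by linarith)
    have h3 := le_r hs (Q₀ + N)
    push_cast at h3
    have h4 : (0 : ℝ) ≤ Q₀ := Q₀.cast_nonneg
    linarith
  have hcauchy := norm_fderiv_le_of_ball (f := h) (x := 0) (ρ := 1) (M := (s Q₀).r + 2) one_pos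
    hhd.differentiableOn fun z hz => hfin z (ball_subset_ball (by
      have : 1 / ((Q₀ : ℝ) + 1) ≤ 1 := by
        rw [div_le_one (by positivity)]
        linarith [(Q₀.cast_nonneg : (0 : ℝ) ≤ Q₀)]
      linarith) hz)
  have h1 := hexp (fun _ => 1)
  have h2 := norm_projI e (fderiv ℂ h 0 (fun _ => 1))
  have h3 := (fderiv ℂ h 0).le_opNorm (fun _ => 1)
  have h4 : ‖(fun _ => 1 : μ → ℂ)‖ = 1 := by simp
  rw [h4] at h1 h3
  linarith

end Avoidance

section Rank

/-- A linear map of rank at least `m` covers some coordinate plane of dimension `m`. -/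
theorem exists_splitting_rightInverse {k m : ℕ} {V : Type*} [NormedAddCommGroup V]
    [NormedSpace ℂ V] [FiniteDimensional ℂ V] (A : V →ₗ[ℂ] (Fin k ⊕ Fin m → ℂ))
    (hA : m ≤ Module.finrank ℂ (LinearMap.range A)) :
    ∃ (e : Fin k ⊕ Fin m ≃ Fin k ⊕ Fin m) (L : (Fin m → ℂ) →L[ℂ] V),
      ∀ v, projI e (A (L v)) = v := by
  classical
  set T := (Module.finBasis ℂ V).equivFun.symm with hT
  set B := LinearMap.toMatrix' (A ∘ₗ T.toLinearMap) with hB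
  have hBr : m ≤ Module.finrank ℂ (Submodule.span ℂ (Set.range B.row)) := by
    rw [← Matrix.rank_eq_finrank_span_row, Matrix.rank, ← Matrix.toLin'_apply', hB,
      Matrix.toLin'_toMatrix', LinearMap.range_comp_of_range_eq_top _ (LinearEquiv.range T)]
    exact hA
  obtain ⟨f, hf, -, hfi⟩ := Submodule.exists_fun_fin_finrank_span_eq ℂ (Set.range B.row)
  choose ρ hρ using hf
  set σ : Fin m → Fin k ⊕ Fin m := fun b => ρ (Fin.castLE hBr b) with hσ
  have hσB : ∀ b, B.row (σ b) = f (Fin.castLE hBr b) := fun b => hρ _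
  have hσi : Function.Injective σ := fun b b' h => by
    have := hσB b
    rw [h, hσB b'] at this
    exact (Fin.castLE_injective hBr (hfi.injective this)).symm
  obtain ⟨e', he'⟩ := Finset.exists_equiv_extend_of_card_eq (t := Finset.univ)
    (s := Finset.univ.image (Sum.inr : Fin m → Fin k ⊕ Fin m)) (f := Sum.elim Sum.inl σ)
    (by simp) (by simp) (fun x hx y hy h => by
      simp only [Finset.coe_image, Finset.coe_univ, Set.image_univ, Set.mem_range] at hx hy
      obtain ⟨b, rfl⟩ := hx
      obtain ⟨b', rfl⟩ := hy
      exact congrArg _ (hσi h))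
  set e : Fin k ⊕ Fin m ≃ Fin k ⊕ Fin m :=
    e'.trans (Equiv.subtypeUnivEquiv fun x => Finset.mem_univ x) with he
  have heσ : ∀ b, e (Sum.inr b) = σ b := fun b => he' _ (by simp)
  have hrank : (B.submatrix σ id).rank = Fintype.card (Fin m) := by
    refine LinearIndependent.rank_matrix ?_
    have : (B.submatrix σ id).row = f ∘ Fin.castLE hBr := by
      ext1 b
      exact hσB b
    rw [this]
    exact hfi.comp _ (Fin.castLE_injective hBr)
  have hsurj : LinearMap.range (B.submatrix σ id).mulVecLin = ⊤ :=
    Submodule.eq_top_of_finrank_eq (by rw [← Matrix.rank, hrank]; simp)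
  obtain ⟨G, hG⟩ := LinearMap.exists_rightInverse_of_surjective _ hsurj
  refine ⟨e, LinearMap.toContinuousLinearMap (T.toLinearMap ∘ₗ G), fun v => ?_⟩
  have h1 := congrArg (fun l => l v) hG
  simp only [LinearMap.comp_apply, LinearMap.id_apply] at h1
  ext b
  have h2 : A (T (G v)) = B.mulVec (G v) := by
    rw [← Matrix.toLin'_apply, hB, Matrix.toLin'_toMatrix']
    rfl
  rw [projI_apply, heσ]
  refine Eq.trans ?_ (congrFun h1 b)
  simp only [LinearMap.coe_toContinuousLinearMap', LinearMap.comp_apply, LinearEquiv.coe_coe, h2]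
  rfl

end Rank

end EisenmanEmbedding

/-- Eisenman-hyperbolic complements of twisted embeddings (Forstnerič, Borell–Kutzschebauch):
for 1 ≤ k < n there is a proper holomorphic embedding F : ℂᵏ → ℂⁿ such that every holomorphic
map g : ℂᵖ → ℂⁿ avoiding F(ℂᵏ) has derivative of rank < n − k at every point. -/
theorem exists_embedding_with_eisenman_hyperbolic_complement
    (k n : ℕ) (hk : 1 ≤ k) (hkn : k < n) :
    ∃ F : EuclideanSpace ℂ (Fin k) → EuclideanSpace ℂ (Fin n),
      Differentiable ℂ F ∧ Function.Injective F ∧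
      (∀ K : Set (EuclideanSpace ℂ (Fin n)), IsCompact K → IsCompact (F ⁻¹' K)) ∧
      (∀ z, Function.Injective (fderiv ℂ F z)) ∧
      ∀ (p : ℕ), 1 ≤ p →
        ∀ g : EuclideanSpace ℂ (Fin p) → EuclideanSpace ℂ (Fin n),
          Differentiable ℂ g → (Set.range g ∩ Set.range F = ∅) →
          ∀ z : EuclideanSpace ℂ (Fin p),
            Module.finrank ℂ
              (LinearMap.range ((fderiv ℂ g z : EuclideanSpace ℂ (Fin p) →L[ℂ]
                EuclideanSpace ℂ (Fin n)) : EuclideanSpace ℂ (Fin p) →ₗ[ℂ]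
                EuclideanSpace ℂ (Fin n))) < n - k := by
  obtain ⟨m, rfl⟩ := Nat.exists_eq_add_of_le hkn.le
  have hm : 0 < m := by omega
  have : Nonempty (Fin m) := ⟨⟨0, hm⟩⟩
  obtain ⟨s, hs⟩ := EisenmanEmbedding.exists_stage_seq k m hk hm
  obtain ⟨F, hF⟩ := EisenmanEmbedding.exists_limit hs
  have hFd := EisenmanEmbedding.differentiable_limit hs hF
  let α : EuclideanSpace ℂ (Fin k) ≃L[ℂ] (Fin k → ℂ) := EuclideanSpace.equiv (Fin k) ℂ
  let β : EuclideanSpace ℂ (Fin (k + m)) ≃L[ℂ] (Fin k ⊕ Fin m → ℂ) :=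
    (EuclideanSpace.equiv (Fin (k + m)) ℂ).trans
      (LinearEquiv.funCongrLeft ℂ ℂ finSumFinEquiv).toContinuousLinearEquiv
  have hd : ∀ z, HasFDerivAt (fun z => β.symm (F (α z)))
      ((β.symm : (Fin k ⊕ Fin m → ℂ) →L[ℂ] _).comp
        ((fderiv ℂ F (α z)).comp (α : _ →L[ℂ] (Fin k → ℂ)))) z := fun z =>
    β.symm.hasFDerivAt.comp z ((hFd (α z)).hasFDerivAt.comp z α.hasFDerivAt)
  refine ⟨fun z => β.symm (F (α z)), fun z => (hd z).differentiableAt,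
    β.symm.injective.comp ((EisenmanEmbedding.injective_limit hs hF).comp α.injective),
    fun K hK => ?_, fun z => ?_, fun p _ g hg hgF z => ?_⟩
  · obtain ⟨R, hR⟩ := (hK.image β.continuous).isBounded.exists_norm_le
    obtain ⟨R', hR'⟩ := EisenmanEmbedding.exists_norm_le_of_norm_limit_le hs hF R
    have hcl : IsClosed ((fun z => β.symm (F (α z))) ⁻¹' K) :=
      hK.isClosed.preimage (β.symm.continuous.comp (hFd.continuous.comp α.continuous))
    refine ((isCompact_closedBall 0 R').image α.symm.continuous).of_isClosed_subset hcl
      fun z hz => ⟨α z, ?_, by simp⟩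
    rw [Metric.mem_closedBall, dist_zero_right]
    exact hR' _ (hR _ ⟨_, hz, by simp⟩)
  · rw [(hd z).fderiv]
    exact β.symm.injective.comp
      ((EisenmanEmbedding.injective_fderiv_limit hs hF _).comp α.injective)
  · by_contra! hrank
    rw [Nat.add_sub_cancel_left] at hrank
    have hGd : HasFDerivAt (fun z => β (g z))
        ((β : _ →L[ℂ] (Fin k ⊕ Fin m → ℂ)).comp (fderiv ℂ g z)) z :=
      β.hasFDerivAt.comp z (hg z).hasFDerivAt
    obtain ⟨e, L, hL⟩ := EisenmanEmbedding.exists_splitting_rightInverse (k := k) (m := m)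
      (β.toLinearEquiv.toLinearMap ∘ₗ (fderiv ℂ g z).toLinearMap) (by
        rw [LinearMap.range_comp, LinearEquiv.finrank_map_eq]
        exact hrank)
    obtain ⟨w, ζ, h⟩ := EisenmanEmbedding.exists_eq_limit hs hF (g := fun z => β (g z))
      (β.differentiable.comp hg) e z L (fun v => by
        rw [hGd.fderiv]
        exact hL v)
    have hmem : g w ∈ Set.range g ∩ Set.range fun z => β.symm (F (α z)) :=
      ⟨⟨w, rfl⟩, α.symm ζ, by simp [← h]⟩
    rw [hgF] at hmem
    exact hmem
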